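/- Let 0 < α ≤ 1, 1 ≤ r < ∞ with conjugate exponent r′, b > 1/r, and let (q,p) satisfy 2/q + 1/p = 1/r together with one of the following: (1) 4 ≤ q ≤ ∞ and 4 < p ≤ ∞; (2) 1/4 ≤ 1/p and 1/p + 1/q < 1/2; (3) (q,p) = (∞,2). Then there exists C > 0 (depending only on α, r, b, q, p) such that for every Schwartz function u on ℝ² (in variables (t,x)) one has ‖ |∂_x|^{α/q} u ‖_{L^q_t L^p_x(ℝ×ℝ)} ≤ C ‖u‖_{X̂^{0,b}_r}, where |∂_x|^{α/q} is the Fourier multiplier in x with symbol |ξ|^{α/q}. -/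

import Mathlib

open MeasureTheory ENNReal Complex

/-- Dispersion relation of the dispersion generalized Benjamin–Ono equation. -/
noncomputable def omegaBO (α ξ : ℝ) : ℝ := -ξ * |ξ| ^ (1 + α)

/-- Spatial Fourier transform φ̂(ξ) = ∫ e^{-ixξ} φ(x) dx. -/
noncomputable def ft1 (φ : ℝ → ℂ) (ξ : ℝ) : ℂ :=
  ∫ x : ℝ, Complex.exp (-Complex.I * ((x * ξ : ℝ) : ℂ)) * φ x

/-- The free propagator W_α(t)φ(x) = (2π)⁻¹ ∫ e^{i(xξ + tω(ξ))} φ̂(ξ) dξ. -/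
noncomputable def Wprop (α : ℝ) (φ : ℝ → ℂ) (t x : ℝ) : ℂ :=
  ((2 * Real.pi)⁻¹ : ℝ) *
    ∫ ξ : ℝ, Complex.exp (Complex.I * ((x * ξ + t * omegaBO α ξ : ℝ) : ℂ)) * ft1 φ ξ

/-- Space–time Fourier transform û(ξ,τ) of u(t,x). -/
noncomputable def ft2 (u : ℝ × ℝ → ℂ) (ξ τ : ℝ) : ℂ :=
  ∫ p : ℝ × ℝ, Complex.exp (-Complex.I * ((p.1 * τ + p.2 * ξ : ℝ) : ℂ)) * u p

/-- The Japanese bracket ⟨ξ⟩ = (1+ξ²)^{1/2}. -/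
noncomputable def jap (ξ : ℝ) : ℝ := (1 + ξ ^ 2) ^ ((1 : ℝ) / 2)

/-- The Bourgain norm ‖u‖_{X̂^{s,b}_ρ} adapted to Fourier–Lebesgue spaces;
`ρd` is the dual exponent ρ′. -/
noncomputable def Xnorm (α s b : ℝ) (ρd : ℝ≥0∞) (u : ℝ × ℝ → ℂ) : ℝ≥0∞ :=
  eLpNorm (fun q : ℝ × ℝ =>
    jap q.1 ^ s * jap (q.2 - omegaBO α q.1) ^ b * ‖ft2 u q.1 q.2‖) ρd volume

/-- The Fourier–Lebesgue norm ‖φ‖_{Ĥ^s_r}; `ρd` is the dual exponent r′. -/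
noncomputable def FLnorm (s : ℝ) (ρd : ℝ≥0∞) (φ : ℝ → ℂ) : ℝ≥0∞ :=
  eLpNorm (fun ξ : ℝ => jap ξ ^ s * ‖ft1 φ ξ‖) ρd volume

/-- Mixed norm ‖F‖_{L^q_t L^p_x}. -/
noncomputable def mixedNorm (q p : ℝ≥0∞) (F : ℝ → ℝ → ℂ) : ℝ≥0∞ :=
  eLpNorm (fun t : ℝ => (eLpNorm (F t) p volume).toReal) q volume

/-- The Fourier multiplier |∂_x|^θ in the space variable, applied at each time. -/
noncomputable def DxProp (θ : ℝ) (u : ℝ × ℝ → ℂ) (t x : ℝ) : ℂ :=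
  ((2 * Real.pi)⁻¹ : ℝ) *
    ∫ ξ : ℝ, ((|ξ| ^ θ : ℝ) : ℂ) * Complex.exp (Complex.I * ((x * ξ : ℝ) : ℂ)) *
      ∫ y : ℝ, Complex.exp (-Complex.I * ((y * ξ : ℝ) : ℂ)) * u (t, y)


lemma lint_rpow_Ioc {a R : ℝ} (ha : -1 < a) (hR : 0 < R) :
    ∫⁻ x in Set.Ioc 0 R, ENNReal.ofReal (x ^ a) = ENNReal.ofReal (R ^ (a + 1) / (a + 1)) := by
  have hi : IntervalIntegrable (fun x : ℝ => x ^ a) volume 0 R :=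
    intervalIntegral.intervalIntegrable_rpow' ha
  rw [intervalIntegrable_iff_integrableOn_Ioc_of_le hR.le] at hi
  rw [← ofReal_integral_eq_lintegral_ofReal hi, ← intervalIntegral.integral_of_le hR.le,
    integral_rpow (Or.inl ha), Real.zero_rpow (by linarith), sub_zero]
  filter_upwards [self_mem_ae_restrict measurableSet_Ioc] with x hx
  exact Real.rpow_nonneg hx.1.le _

lemma lint_rpow_Ioi {a R : ℝ} (ha : a < -1) (hR : 0 < R) :
    ∫⁻ x in Set.Ioi R, ENNReal.ofReal (x ^ a) = ENNReal.ofReal (R ^ (a + 1) / (-(a + 1))) := by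
  rw [← ofReal_integral_eq_lintegral_ofReal (integrableOn_Ioi_rpow_of_lt ha hR),
    integral_Ioi_rpow_of_lt ha hR]
  · congr 1; rw [div_neg, neg_div]
  · filter_upwards [self_mem_ae_restrict measurableSet_Ioi] with x hx
    exact Real.rpow_nonneg (hR.trans hx).le _

lemma lint_abs (h : ℝ → ℝ≥0∞) :
    ∫⁻ x : ℝ, h |x| = 2 * ∫⁻ x in Set.Ioi (0:ℝ), h x := by
  rw [← lintegral_add_compl _ (measurableSet_Ioi (a := (0:ℝ))), two_mul]
  congr 1
  · refine setLIntegral_congr_fun measurableSet_Ioi fun x hx => ?_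
    simp only [Set.mem_Ioi] at hx
    simp [abs_of_pos hx]
  · rw [Set.compl_Ioi, setLIntegral_congr (Iio_ae_eq_Iic (μ := volume) (a := (0:ℝ))).symm]
    have := (Measure.measurePreserving_neg (volume : Measure ℝ)).setLIntegral_comp_preimage_emb
      (MeasurableEquiv.neg ℝ).measurableEmbedding h (Set.Ioi 0)
    rw [← this]
    have : (Neg.neg ⁻¹' Set.Ioi (0:ℝ)) = Set.Iio 0 := by ext; simp
    rw [this]
    refine setLIntegral_congr_fun measurableSet_Iio fun x hx => ?_
    simp only [Set.mem_Iio] at hx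
    simp [abs_of_neg hx]

lemma lint_near {γ R : ℝ} (hγ1 : γ < 1) (hR : 0 < R) (x : ℝ) :
    ∫⁻ y in {y | |x - y| ≤ R}, ENNReal.ofReal (|x - y| ^ (-γ)) =
      ENNReal.ofReal (2 / (1 - γ) * R ^ (1 - γ)) := by
  have hm : MeasurableSet {y : ℝ | |x - y| ≤ R} :=
    measurableSet_le (by fun_prop) measurable_const
  rw [← lintegral_indicator hm]
  have h1 := lintegral_sub_left_eq_self (μ := (volume : Measure ℝ))
    (fun z => (Set.Iic R).indicator (fun z => ENNReal.ofReal (z ^ (-γ))) |z|) x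
  have h2 : ∀ y, ({y : ℝ | |x - y| ≤ R}).indicator (fun y => ENNReal.ofReal (|x - y| ^ (-γ))) y
      = (Set.Iic R).indicator (fun z => ENNReal.ofReal (z ^ (-γ))) |x - y| := by
    intro y; simp [Set.indicator]
  simp_rw [h2]
  rw [h1, lint_abs, lintegral_indicator measurableSet_Iic, Measure.restrict_restrict measurableSet_Iic,
    Set.inter_comm, Set.Ioi_inter_Iic, lint_rpow_Ioc (by linarith) hR]
  rw [show (2:ℝ≥0∞) = ENNReal.ofReal 2 by simp, ← ENNReal.ofReal_mul (by norm_num)]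
  congr 1
  rw [show -γ + 1 = 1 - γ by ring]; ring

lemma lint_far {R : ℝ} (hR : 0 < R) (x : ℝ) :
    ∫⁻ y in {y | |x - y| ≤ R}ᶜ, ENNReal.ofReal (|x - y| ^ (-2:ℝ)) =
      ENNReal.ofReal (2 * R⁻¹) := by
  have hm : MeasurableSet {y : ℝ | |x - y| ≤ R} :=
    measurableSet_le (by fun_prop) measurable_const
  rw [← lintegral_indicator hm.compl]
  have h1 := lintegral_sub_left_eq_self (μ := (volume : Measure ℝ))
    (fun z => (Set.Ioi R).indicator (fun z => ENNReal.ofReal (z ^ (-2:ℝ))) |z|) x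
  have h2 : ∀ y, ({y : ℝ | |x - y| ≤ R}ᶜ).indicator
      (fun y => ENNReal.ofReal (|x - y| ^ (-2:ℝ))) y
      = (Set.Ioi R).indicator (fun z => ENNReal.ofReal (z ^ (-2:ℝ))) |x - y| := by
    intro y; simp only [Set.indicator]; simp
  simp_rw [h2]
  rw [h1, lint_abs, lintegral_indicator measurableSet_Ioi, Measure.restrict_restrict measurableSet_Ioi,
    Set.inter_eq_left.2 (Set.Ioi_subset_Ioi hR.le), lint_rpow_Ioi (by norm_num) hR]
  rw [show (2:ℝ≥0∞) = ENNReal.ofReal 2 by simp, ← ENNReal.ofReal_mul (by norm_num)]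
  congr 1
  rw [show (-2:ℝ) + 1 = -1 by norm_num, Real.rpow_neg_one]; norm_num

lemma hls_pt {γ : ℝ} (hγ0 : 0 < γ) (hγ1 : γ < 1) :
    ∃ C : ℝ, 0 < C ∧ ∀ (h : ℝ → ℝ≥0∞), Measurable h → ∀ (x v n : ℝ), 0 < v → 0 < n →
      (∀ y, h y ≤ ENNReal.ofReal v) →
      (∫⁻ y, h y ^ (2 / (2 - γ))) ^ (1 / (2 / (2 - γ))) ≤ ENNReal.ofReal n →
      ∫⁻ y, h y * ENNReal.ofReal (|x - y| ^ (-γ)) ≤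
        ENNReal.ofReal (C * v ^ (2 / (2 - γ) - 1) * n ^ (2 - 2 / (2 - γ))) := by
  have h2γ : 0 < 2 - γ := by linarith
  refine ⟨2 / (1 - γ) + 2 ^ (γ / 2), by have : 0 < 1 - γ := by linarith
                                        positivity, ?_⟩
  intro h hm x v n hv hn hle hnorm
  set c := 2 / (2 - γ) with hc
  set R := (n / v) ^ c with hRdef
  have hR : 0 < R := by positivity
  have hms : MeasurableSet {y : ℝ | |x - y| ≤ R} :=
    measurableSet_le (by fun_prop) measurable_const
  rw [← lintegral_add_compl _ hms]
  have near : ∫⁻ y in {y | |x - y| ≤ R}, h y * ENNReal.ofReal (|x - y| ^ (-γ)) ≤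
      ENNReal.ofReal (v * (2 / (1 - γ) * R ^ (1 - γ))) := by
    calc _ ≤ ∫⁻ y in {y | |x - y| ≤ R}, ENNReal.ofReal v * ENNReal.ofReal (|x - y| ^ (-γ)) := by
          gcongr with y; exact hle y
      _ = _ := by
          rw [lintegral_const_mul _ (by fun_prop), lint_near hγ1 hR, ENNReal.ofReal_mul hv.le]
  have hcc : c.HolderConjugate (2 / γ) := by
    rw [Real.holderConjugate_iff]
    refine ⟨?_, ?_⟩
    · rw [hc, lt_div_iff₀ h2γ]; linarith
    · rw [hc]; field_simp; ring
  have far : ∫⁻ y in {y | |x - y| ≤ R}ᶜ, h y * ENNReal.ofReal (|x - y| ^ (-γ)) ≤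
      ENNReal.ofReal (n * (2 * R⁻¹) ^ (γ / 2)) := by
    refine (ENNReal.lintegral_mul_le_Lp_mul_Lq _ hcc hm.aemeasurable
      (by fun_prop : Measurable fun y => ENNReal.ofReal (|x - y| ^ (-γ))).aemeasurable).trans ?_
    rw [ENNReal.ofReal_mul hn.le, ← ENNReal.ofReal_rpow_of_nonneg (by positivity) (by positivity)]
    gcongr
    · refine le_trans ?_ hnorm
      gcongr
      exact Measure.restrict_le_self
    · rw [← lint_far hR x, one_div_div]
      refine le_of_eq ?_
      congr 1
      refine lintegral_congr fun y => ?_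
      rw [ENNReal.ofReal_rpow_of_nonneg (by positivity) (by positivity), ← Real.rpow_mul (abs_nonneg _)]
      congr 2; field_simp
  refine (add_le_add near far).trans ?_
  have : 0 < 1 - γ := by linarith
  rw [← ENNReal.ofReal_add (by positivity) (by positivity)]
  refine le_of_eq (congrArg _ ?_)
  have e1 : v * R ^ (1 - γ) = v ^ (c - 1) * n ^ (2 - c) := by
    rw [hRdef, ← Real.rpow_mul (by positivity), Real.div_rpow hn.le hv.le]
    have h1 : c * (1 - γ) = 2 - c := by rw [hc]; field_simp; ring
    have h2 : v ^ (c - 1) = v / v ^ (2 - c) := by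
      rw [show c - 1 = 1 - (2 - c) by ring, Real.rpow_sub hv 1 (2 - c), Real.rpow_one]
    rw [h1, h2]; ring
  have e2 : n * R⁻¹ ^ (γ / 2) = v ^ (c - 1) * n ^ (2 - c) := by
    have h1 : c * (γ / 2) = c - 1 := by rw [hc]; field_simp; ring
    rw [Real.inv_rpow hR.le, hRdef, ← Real.rpow_mul (by positivity), Real.div_rpow hn.le hv.le, h1]
    have h2 : n ^ (2 - c) = n / n ^ (c - 1) := by
      rw [show 2 - c = 1 - (c - 1) by ring, Real.rpow_sub hn 1 (c - 1), Real.rpow_one]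
    rw [h2, inv_div]; ring
  rw [Real.mul_rpow (by norm_num) (by positivity)]
  calc _ = 2 / (1 - γ) * (v * R ^ (1 - γ)) + 2 ^ (γ / 2) * (n * R⁻¹ ^ (γ / 2)) := by ring
    _ = _ := by rw [e1, e2]; ring

/-- Hardy–Littlewood–Sobolev (symmetric one-dimensional case). -/
lemma hls {γ : ℝ} (hγ0 : 0 < γ) (hγ1 : γ < 1) :
    ∃ C : NNReal, ∀ g : ℝ → NNReal, Measurable g →
      ∫⁻ x, ∫⁻ y, (g x : ℝ≥0∞) * g y * ENNReal.ofReal (|x - y| ^ (-γ)) ≤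
        C * (∫⁻ y, (g y : ℝ≥0∞) ^ (2 / (2 - γ))) ^ (2 - γ) := by
  obtain ⟨C, hC, H⟩ := hls_pt hγ0 hγ1
  have h2γ : 0 < 2 - γ := by linarith
  refine ⟨(2 * C).toNNReal, fun g hg => ?_⟩
  set c := 2 / (2 - γ) with hc
  have hc1 : 1 < c := by rw [hc, lt_div_iff₀ h2γ]; linarith
  set E := ∫⁻ y, (g y : ℝ≥0∞) ^ c with hE
  -- trivial cases
  by_cases hE0 : E = 0
  · have : ∀ᵐ y, g y = 0 := by
      rw [hE, lintegral_eq_zero_iff (by fun_prop)] at hE0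
      filter_upwards [hE0] with y hy
      simpa [show ¬ c < 0 by linarith, show (0:ℝ) < c by linarith] using hy
    have : ∫⁻ x, ∫⁻ y, (g x : ℝ≥0∞) * g y * ENNReal.ofReal (|x - y| ^ (-γ)) = 0 := by
      rw [lintegral_congr_ae (g := fun _ => 0), lintegral_zero]
      filter_upwards [this] with x hx
      simp [hx]
    rw [this]; exact zero_le
  by_cases hEt : E = ⊤
  · rw [hEt, ENNReal.top_rpow_of_pos h2γ, ENNReal.mul_top (by simp [hC])]; exact le_top
  have hEr : 0 < E.toReal := ENNReal.toReal_pos hE0 hEt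
  set n := E.toReal ^ (1 / c) with hn
  have hn0 : 0 < n := by positivity
  have hEn : E ^ (1 / c) = ENNReal.ofReal n := by
    rw [hn, ← ENNReal.ofReal_rpow_of_pos hEr, ENNReal.ofReal_toReal hEt]
  set k : ℝ → ℝ → ℝ≥0∞ := fun x y => ENNReal.ofReal (|x - y| ^ (-γ)) with hk
  have hkm : Measurable (Function.uncurry k) := by
    simp only [hk, Function.uncurry_def]; fun_prop
  set F : ℝ → ℝ → ℝ≥0∞ := fun x y => if g y ≤ g x then (g x : ℝ≥0∞) * g y * k x y else 0 with hF
  have hFm : Measurable (Function.uncurry F) := by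
    simp only [hF, Function.uncurry_def]
    refine Measurable.ite (measurableSet_le (by fun_prop) (by fun_prop)) ?_ measurable_const
    have := hkm; simp only [Function.uncurry_def] at this
    fun_prop
  have hFbd : ∀ x, ∫⁻ y, F x y ≤ ENNReal.ofReal (C * n ^ (2 - c)) * (g x : ℝ≥0∞) ^ c := by
    intro x
    by_cases hx : g x = 0
    · simp [hF, hx]
    have hv : (0:ℝ) < g x := by positivity
    have := H (fun y => if g y ≤ g x then (g y : ℝ≥0∞) else 0)
      (Measurable.ite (measurableSet_le (by fun_prop) (by fun_prop)) (by fun_prop) measurable_const)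
      x (g x) n hv hn0 (by
        intro y; split_ifs with h
        · simpa using h
        · exact zero_le) (by
        rw [← hEn]
        refine ENNReal.rpow_le_rpow (lintegral_mono fun y => ?_) (by positivity)
        refine ENNReal.rpow_le_rpow ?_ (by positivity)
        split_ifs <;> simp)
    calc ∫⁻ y, F x y = ∫⁻ y, (g x : ℝ≥0∞) * ((if g y ≤ g x then (g y : ℝ≥0∞) else 0) * k x y) := by
          refine lintegral_congr fun y => ?_
          simp only [hF]; split_ifs <;> simp [mul_assoc]
      _ = (g x : ℝ≥0∞) * ∫⁻ y, ((if g y ≤ g x then (g y : ℝ≥0∞) else 0) * k x y) := by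
          rw [lintegral_const_mul]
          refine (Measurable.ite (measurableSet_le (by fun_prop) (by fun_prop)) (by fun_prop) measurable_const).mul ?_
          exact hkm.comp (by fun_prop : Measurable fun y => (x, y))
      _ ≤ (g x : ℝ≥0∞) * ENNReal.ofReal (C * (g x : ℝ) ^ (c - 1) * n ^ (2 - c)) := by gcongr
      _ = _ := by
          have : (g x : ℝ≥0∞) = ENNReal.ofReal (g x) := by simp
          rw [this, ENNReal.ofReal_rpow_of_pos hv, ← ENNReal.ofReal_mul hv.le,
            ← ENNReal.ofReal_mul (by positivity)]
          congr 1
          rw [Real.rpow_sub hv, Real.rpow_one]; field_simp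
  have hFint : ∫⁻ x, ∫⁻ y, F x y ≤ ENNReal.ofReal C * E ^ (2 - γ) := by
    calc _ ≤ ∫⁻ x, ENNReal.ofReal (C * n ^ (2 - c)) * (g x : ℝ≥0∞) ^ c := lintegral_mono hFbd
      _ = ENNReal.ofReal (C * n ^ (2 - c)) * E := by rw [lintegral_const_mul _ (by fun_prop)]
      _ = _ := by
        rw [ENNReal.ofReal_mul hC.le, mul_assoc]
        congr 1
        rw [← ENNReal.ofReal_toReal hEt, ENNReal.ofReal_rpow_of_pos hEr, ← ENNReal.ofReal_mul (by positivity)]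
        congr 1
        rw [hn, ← Real.rpow_mul hEr.le]
        nth_rewrite 2 [← Real.rpow_one E.toReal]
        rw [← Real.rpow_add hEr]
        congr 1
        rw [hc]; field_simp; ring
  calc ∫⁻ x, ∫⁻ y, (g x : ℝ≥0∞) * g y * k x y
      ≤ ∫⁻ x, ∫⁻ y, (F x y + F y x) := by
        gcongr with x y
        have hsym : k y x = k x y := by simp only [hk, abs_sub_comm]
        simp only [hF]
        rcases le_total (g y) (g x) with h | h
        · rw [if_pos h]; exact le_self_add
        · rw [if_pos h, hsym, mul_comm (g y : ℝ≥0∞)]; exact le_add_self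
    _ = ∫⁻ x, ((∫⁻ y, F x y) + ∫⁻ y, F y x) := by
        refine lintegral_congr fun x => lintegral_add_left ?_ _
        exact hFm.comp (by fun_prop : Measurable fun y => (x, y))
    _ = (∫⁻ x, ∫⁻ y, F x y) + ∫⁻ x, ∫⁻ y, F y x := by
        refine lintegral_add_left ?_ _
        exact hFm.lintegral_prod_right
    _ = (∫⁻ x, ∫⁻ y, F x y) + ∫⁻ x, ∫⁻ y, F x y := by
        congr 1
        exact lintegral_lintegral_swap (f := fun x y => F y x) (hFm.comp measurable_swap).aemeasurable
    _ ≤ ENNReal.ofReal C * E ^ (2 - γ) + ENNReal.ofReal C * E ^ (2 - γ) := add_le_add hFint hFint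
    _ = _ := by
        rw [← two_mul, ← mul_assoc]
        congr 1
        rw [show ((2 * C).toNNReal : ℝ≥0∞) = ENNReal.ofReal (2 * C) from rfl,
          ENNReal.ofReal_mul (by norm_num)]; simp


/-- Auxiliary one-dimensional Fourier integral. -/
noncomputable def FT (g : ℝ → ℂ) (ξ : ℝ) : ℂ :=
  ∫ x : ℝ, Complex.exp (Complex.I * ((x * ξ : ℝ) : ℂ)) * g x

lemma norm_expI (a : ℝ) : ‖Complex.exp (Complex.I * (a : ℂ))‖ = 1 := by
  rw [mul_comm]; exact Complex.norm_exp_ofReal_mul_I a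

lemma gauss_ft {g : ℝ → ℂ} (hgm : Measurable g) (hg : Integrable g) {s : ℝ} (hs : 0 < s) :
    ∫⁻ ξ, ENNReal.ofReal (Real.exp (-(s * ξ ^ 2))) * ‖FT g ξ‖ₑ ^ 2 ≤
      ENNReal.ofReal (√(Real.pi / s)) * ∫⁻ x, ∫⁻ y, ‖g x‖ₑ * ‖g y‖ₑ *
        ENNReal.ofReal (Real.exp (-(x - y) ^ 2 / (4 * s))) := by
  set H : ℝ → ℝ × ℝ → ℂ := fun ξ p => (Real.exp (-(s * ξ ^ 2)) : ℂ) *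
    (Complex.exp (Complex.I * (((p.1 - p.2) * ξ : ℝ) : ℂ)) * (g p.1 * (starRingEnd ℂ) (g p.2))) with hH
  have hgg : Integrable (fun p : ℝ × ℝ => g p.1 * (starRingEnd ℂ) (g p.2)) := by
    have hc : Integrable (fun y => (starRingEnd ℂ) (g y)) := by
      refine hg.congr' ?_ ?_
      · exact (Complex.continuous_conj.comp_aestronglyMeasurable hg.1)
      · simp
    exact hg.mul_prod hc
  have hgauss : Integrable (fun ξ : ℝ => (Real.exp (-(s * ξ ^ 2)) : ℂ)) := by
    have := (integrable_exp_neg_mul_sq hs).ofReal (𝕜 := ℂ)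
    simpa [neg_mul] using this
  have hHint : Integrable (Function.uncurry H) := by
    have h1 := hgauss.mul_prod hgg
    refine h1.congr' ?_ ?_
    · have : (Function.uncurry H) = fun z : ℝ × (ℝ × ℝ) =>
        Complex.exp (Complex.I * (((z.2.1 - z.2.2) * z.1 : ℝ) : ℂ)) *
        ((Real.exp (-(s * z.1 ^ 2)) : ℂ) * (g z.2.1 * (starRingEnd ℂ) (g z.2.2))) := by
        ext z; simp only [hH, Function.uncurry]; ring
      rw [this]
      refine AEStronglyMeasurable.mul ?_ h1.1
      exact (by fun_prop : Continuous _).aestronglyMeasurable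
    · refine Filter.Eventually.of_forall fun z => ?_
      simp only [hH, Function.uncurry, norm_mul, norm_expI, one_mul]
  have hprod : ∀ ξ, ∫ p, H ξ p = ((Real.exp (-(s * ξ ^ 2)) * ‖FT g ξ‖ ^ 2 : ℝ) : ℂ) := by
    intro ξ
    simp only [hH]
    rw [integral_const_mul]
    rw [Complex.ofReal_mul, Complex.ofReal_pow]
    congr 1
    rw [← Complex.mul_conj']
    simp only [FT]
    rw [← integral_conj]
    erw [← integral_prod_mul]
    refine integral_congr_ae (Filter.Eventually.of_forall fun p => ?_)
    simp only [map_mul]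
    rw [← Complex.exp_conj]
    simp only [map_mul, Complex.conj_I, Complex.conj_ofReal]
    rw [show Complex.I * (((p.1 - p.2) * ξ : ℝ) : ℂ) =
      Complex.I * ((p.1 * ξ : ℝ) : ℂ) + -Complex.I * ((p.2 * ξ : ℝ) : ℂ) by push_cast; ring,
      Complex.exp_add]
    ring
  have hreal : Integrable (fun ξ => Real.exp (-(s * ξ ^ 2)) * ‖FT g ξ‖ ^ 2) := by
    have := hHint.integral_prod_left
    simp only [Function.uncurry_apply_pair, hprod] at this
    exact this.re
  have hnn : ∀ ξ, 0 ≤ Real.exp (-(s * ξ ^ 2)) * ‖FT g ξ‖ ^ 2 := fun ξ => by positivity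
  have e1 : ∫⁻ ξ, ENNReal.ofReal (Real.exp (-(s * ξ ^ 2))) * ‖FT g ξ‖ₑ ^ 2 =
      ENNReal.ofReal (∫ ξ, Real.exp (-(s * ξ ^ 2)) * ‖FT g ξ‖ ^ 2) := by
    rw [ofReal_integral_eq_lintegral_ofReal hreal (Filter.Eventually.of_forall hnn)]
    refine lintegral_congr fun ξ => ?_
    rw [ENNReal.ofReal_mul (by positivity), ENNReal.ofReal_pow (by positivity), ofReal_norm]
  have e2 : ((∫ ξ, Real.exp (-(s * ξ ^ 2)) * ‖FT g ξ‖ ^ 2 : ℝ) : ℂ) =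
      ∫ p : ℝ × ℝ, (g p.1 * (starRingEnd ℂ) (g p.2)) *
        ((√(Real.pi / s) * Real.exp (-(p.1 - p.2) ^ 2 / (4 * s)) : ℝ) : ℂ) := by
    rw [← integral_complex_ofReal]
    simp_rw [← hprod]
    rw [integral_integral_swap hHint]
    refine integral_congr_ae (Filter.Eventually.of_forall fun p => ?_)
    simp only [hH]
    have hG := fourierIntegral_gaussian (b := (s : ℂ)) (by simpa using hs) ((p.1 - p.2 : ℝ) : ℂ)
    have : ∀ ξ : ℝ, (Real.exp (-(s * ξ ^ 2)) : ℂ) *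
      (Complex.exp (Complex.I * (((p.1 - p.2) * ξ : ℝ) : ℂ)) * (g p.1 * (starRingEnd ℂ) (g p.2)))
      = (g p.1 * (starRingEnd ℂ) (g p.2)) * (cexp (I * ((p.1 - p.2 : ℝ) : ℂ) * ↑ξ) * cexp (-(s:ℂ) * ↑ξ ^ 2)) := by
      intro ξ; push_cast
      rw [show -((s:ℂ) * (ξ:ℂ)^2) = -(s:ℂ) * (ξ:ℂ)^2 by ring,
        show I * (((p.1:ℂ) - p.2) * (ξ:ℂ)) = I * ((p.1:ℂ) - p.2) * (ξ:ℂ) by ring]; ring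
    simp_rw [this]
    rw [integral_const_mul, hG]
    congr 1
    push_cast
    congr 1
    rw [Real.sqrt_eq_rpow, Complex.ofReal_cpow (by positivity)]
    push_cast; rfl
  rw [e1]
  have e3 : (∫ ξ, Real.exp (-(s * ξ ^ 2)) * ‖FT g ξ‖ ^ 2) = ‖((∫ ξ, Real.exp (-(s * ξ ^ 2)) * ‖FT g ξ‖ ^ 2 : ℝ) : ℂ)‖ := by
    rw [Complex.norm_real, Real.norm_of_nonneg (integral_nonneg hnn)]
  rw [e3, ofReal_norm, e2]
  refine (enorm_integral_le_lintegral_enorm _).trans ?_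
  have hgc : Measurable fun y => (starRingEnd ℂ) (g y) := Complex.continuous_conj.measurable.comp hgm
  have hmm : Measurable fun p : ℝ × ℝ => (g p.1 * (starRingEnd ℂ) (g p.2)) *
        ((√(Real.pi / s) * Real.exp (-(p.1 - p.2) ^ 2 / (4 * s)) : ℝ) : ℂ) :=
    ((hgm.comp measurable_fst).mul (hgc.comp measurable_snd)).mul (by fun_prop)
  rw [Measure.volume_eq_prod, lintegral_prod _ hmm.enorm.aemeasurable, ← lintegral_const_mul' _ _ ENNReal.ofReal_ne_top]
  refine lintegral_mono fun x => ?_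
  rw [← lintegral_const_mul' _ _ ENNReal.ofReal_ne_top]
  refine lintegral_mono fun y => le_of_eq ?_
  simp only [enorm_mul]
  rw [show ‖(starRingEnd ℂ) (g y)‖ₑ = ‖g y‖ₑ by simp [← ofReal_norm], ← ofReal_norm ((√(Real.pi / s) * Real.exp (-(x - y) ^ 2 / (4 * s)) : ℝ) : ℂ), Complex.norm_real,
    Real.norm_of_nonneg (by positivity), ENNReal.ofReal_mul (by positivity)]
  ring

lemma measurable_FT {g : ℝ → ℂ} (hgm : Measurable g) : Measurable (FT g) := by
  have : StronglyMeasurable fun ξ : ℝ => ∫ x : ℝ, Complex.exp (Complex.I * ((x * ξ : ℝ) : ℂ)) * g x := by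
    refine StronglyMeasurable.integral_prod_right' (f := fun p : ℝ × ℝ => Complex.exp (Complex.I * ((p.2 * p.1 : ℝ) : ℂ)) * g p.2) ?_
    exact (by fun_prop : Measurable _).stronglyMeasurable
  exact this.measurable

lemma lint_gauss {s : ℝ} (hs : 0 < s) (x : ℝ) :
    ∫⁻ y, ENNReal.ofReal (Real.exp (-(x - y) ^ 2 / (4 * s))) = ENNReal.ofReal (√(4 * Real.pi * s)) := by
  have h1 := lintegral_sub_left_eq_self (μ := (volume : Measure ℝ))
    (fun z => ENNReal.ofReal (Real.exp (-z ^ 2 / (4 * s)))) x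
  rw [h1]
  have h2 : ∀ z : ℝ, Real.exp (-z ^ 2 / (4 * s)) = Real.exp (-(1 / (4 * s)) * z ^ 2) := by
    intro z; congr 1; ring
  simp_rw [h2]
  rw [← ofReal_integral_eq_lintegral_ofReal (integrable_exp_neg_mul_sq (by positivity))
    (Filter.Eventually.of_forall fun z => (Real.exp_pos _).le), integral_gaussian]
  congr 2
  field_simp

lemma enn_two_mul_le (a b : ℝ≥0∞) : 2 * (a * b) ≤ a ^ 2 + b ^ 2 := by
  rw [two_mul]
  rcases le_total a b with h | h
  · rcases eq_or_ne b ⊤ with rfl | hb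
    · simp
    lift b to NNReal using hb
    lift a to NNReal using ne_top_of_le_ne_top (by simp) h
    norm_cast
    have := two_mul_le_add_sq a b
    linarith
  · rcases eq_or_ne a ⊤ with rfl | ha
    · simp
    lift a to NNReal using ha
    lift b to NNReal using ne_top_of_le_ne_top (by simp) h
    norm_cast
    have := two_mul_le_add_sq a b
    linarith

lemma planch {g : ℝ → ℂ} (hgm : Measurable g) (hg : Integrable g) :
    ∫⁻ ξ, ‖FT g ξ‖ₑ ^ 2 ≤ ENNReal.ofReal (2 * Real.pi) * ∫⁻ x, ‖g x‖ₑ ^ 2 := by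
  have hFm := measurable_FT hgm
  have key : ∀ s : ℝ, 0 < s → ∫⁻ ξ, ENNReal.ofReal (Real.exp (-(s * ξ ^ 2))) * ‖FT g ξ‖ₑ ^ 2 ≤
      ENNReal.ofReal (2 * Real.pi) * ∫⁻ x, ‖g x‖ₑ ^ 2 := by
    intro s hs
    refine (gauss_ft hgm hg hs).trans ?_
    set k : ℝ → ℝ → ℝ≥0∞ := fun x y => ENNReal.ofReal (Real.exp (-(x - y) ^ 2 / (4 * s))) with hk
    have hkm : Measurable (Function.uncurry k) := by
      simp only [hk, Function.uncurry_def]; fun_prop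
    have hkm1 : ∀ x, Measurable (k x) := fun x => by simp only [hk]; fun_prop
    have hksymm : ∀ x y, k x y = k y x := by
      intro x y; simp only [hk]; congr 3; ring
    have hkm' : Measurable fun p : ℝ × ℝ => k p.1 p.2 := hkm
    set e := ENNReal.ofReal (√(4 * Real.pi * s))
    have hki : ∀ x, ∫⁻ y, k x y = e := fun x => lint_gauss hs x
    have h1 : ∫⁻ x, ∫⁻ y, ‖g x‖ₑ ^ 2 * k x y = e * ∫⁻ x, ‖g x‖ₑ ^ 2 := by
      rw [← lintegral_const_mul _ (by fun_prop)]
      refine lintegral_congr fun x => ?_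
      rw [lintegral_const_mul _ (hkm1 x), hki, mul_comm]
    have h2 : ∫⁻ x, ∫⁻ y, ‖g y‖ₑ ^ 2 * k x y = e * ∫⁻ x, ‖g x‖ₑ ^ 2 := by
      rw [← h1, lintegral_lintegral_swap (by simp only [Function.uncurry_def]; fun_prop)]
      refine lintegral_congr fun x => lintegral_congr fun y => ?_
      rw [hksymm]
    have h3 : 2 * ∫⁻ x, ∫⁻ y, ‖g x‖ₑ * ‖g y‖ₑ * k x y ≤ 2 * (e * ∫⁻ x, ‖g x‖ₑ ^ 2) := by
      calc _ = ∫⁻ x, ∫⁻ y, 2 * (‖g x‖ₑ * ‖g y‖ₑ * k x y) := by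
            rw [← lintegral_const_mul' _ _ (by simp)]
            refine lintegral_congr fun x => ?_
            rw [← lintegral_const_mul' _ _ (by simp)]
        _ ≤ ∫⁻ x, ∫⁻ y, (‖g x‖ₑ ^ 2 * k x y + ‖g y‖ₑ ^ 2 * k x y) := by
            refine lintegral_mono fun x => lintegral_mono fun y => ?_
            rw [← mul_assoc, ← add_mul]
            gcongr
            exact enn_two_mul_le _ _
        _ = ∫⁻ x, ((∫⁻ y, ‖g x‖ₑ ^ 2 * k x y) + ∫⁻ y, ‖g y‖ₑ ^ 2 * k x y) := by
            refine lintegral_congr fun x => lintegral_add_left ?_ _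
            exact (hkm1 x).const_mul _
        _ = (∫⁻ x, ∫⁻ y, ‖g x‖ₑ ^ 2 * k x y) + ∫⁻ x, ∫⁻ y, ‖g y‖ₑ ^ 2 * k x y := by
            refine lintegral_add_left ?_ _
            exact Measurable.lintegral_prod_right' (f := fun p : ℝ × ℝ => ‖g p.1‖ₑ ^ 2 * k p.1 p.2) (by fun_prop)
        _ = _ := by rw [h1, h2, two_mul]
    have h4 := (ENNReal.mul_le_mul_iff_right (by simp) (by simp)).1 h3
    calc _ ≤ ENNReal.ofReal √(Real.pi / s) * (e * ∫⁻ x, ‖g x‖ₑ ^ 2) := by gcongr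
      _ = _ := by
        rw [← mul_assoc, ← ENNReal.ofReal_mul (by positivity), ← Real.sqrt_mul (by positivity)]
        congr 2
        rw [show Real.pi / s * (4 * Real.pi * s) = (2 * Real.pi) ^ 2 by field_simp; norm_num]
        exact Real.sqrt_sq (by positivity)
  have hlim : Filter.Tendsto (fun n : ℕ => ∫⁻ ξ, ENNReal.ofReal (Real.exp (-((1 / ((n:ℝ) + 1)) * ξ ^ 2))) * ‖FT g ξ‖ₑ ^ 2)
      Filter.atTop (nhds (∫⁻ ξ, ‖FT g ξ‖ₑ ^ 2)) := by
    refine lintegral_tendsto_of_tendsto_of_monotone (fun n => by fun_prop) ?_ ?_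
    · refine Filter.Eventually.of_forall fun ξ n m hnm => ?_
      dsimp only
      gcongr
    · refine Filter.Eventually.of_forall fun ξ => ?_
      have h1 : Filter.Tendsto (fun n : ℕ => Real.exp (-((1 / ((n:ℝ) + 1)) * ξ ^ 2))) Filter.atTop (nhds 1) := by
        have := (tendsto_one_div_add_atTop_nhds_zero_nat (𝕜 := ℝ)).mul_const (ξ ^ 2)
        have := (Real.continuous_exp.tendsto _).comp this.neg
        simpa [Function.comp_def] using this
      have h2 := ENNReal.tendsto_ofReal h1
      have h3 := ENNReal.Tendsto.mul_const (b := ‖FT g ξ‖ₑ ^ 2) h2 (Or.inl (by simp))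
      simpa using h3
  exact le_of_tendsto' hlim fun n => key _ (by positivity)

lemma pitt_lower {γ : ℝ} (hγ1 : γ < 1) {ξ : ℝ} (hξ : ξ ≠ 0) :
    ENNReal.ofReal (|ξ| ^ (γ - 1)) ≤ ENNReal.ofReal (Real.exp 1 * ((1 - γ) / 2)) *
      ∫⁻ s in Set.Ioi (0:ℝ), ENNReal.ofReal (s ^ ((1 - γ) / 2 - 1)) *
        ENNReal.ofReal (Real.exp (-(s * ξ ^ 2))) := by
  have hσ : 0 < (1 - γ) / 2 := by linarith
  set σ := (1 - γ) / 2 with hσd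
  have hξ2 : 0 < (ξ ^ 2)⁻¹ := by positivity
  have h1 : ENNReal.ofReal (((ξ ^ 2)⁻¹) ^ σ / σ) * ENNReal.ofReal (Real.exp (-1)) ≤
      ∫⁻ s in Set.Ioi (0:ℝ), ENNReal.ofReal (s ^ (σ - 1)) * ENNReal.ofReal (Real.exp (-(s * ξ ^ 2))) := by
    have := lint_rpow_Ioc (a := σ - 1) (by linarith) hξ2
    rw [sub_add_cancel] at this
    rw [← this, ← lintegral_mul_const _ (by fun_prop)]
    refine le_trans ?_ (lintegral_mono_set (Set.Ioc_subset_Ioi_self : Set.Ioc 0 (ξ ^ 2)⁻¹ ⊆ Set.Ioi 0))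
    refine setLIntegral_mono (by fun_prop) fun s hs => ?_
    gcongr
    have := mul_le_mul_of_nonneg_right hs.2 (sq_nonneg ξ)
    rwa [inv_mul_cancel₀ (by positivity)] at this
  refine le_trans (le_of_eq ?_) (mul_le_mul_right h1 _)
  rw [← ENNReal.ofReal_mul (by positivity), ← ENNReal.ofReal_mul (by positivity)]
  congr 1
  rw [Real.exp_neg, Real.inv_rpow (by positivity), ← sq_abs, ← Real.rpow_natCast, ← Real.rpow_mul (by positivity),
    ← Real.rpow_neg (by positivity)]
  have : γ - 1 = -(((2:ℕ):ℝ) * σ) := by rw [hσd]; push_cast; ring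
  rw [this]
  field_simp

lemma pitt_upper {γ : ℝ} (hγ0 : 0 < γ) (hγ1 : γ < 1) {d : ℝ} (hd : d ≠ 0) :
    ∫⁻ s in Set.Ioi (0:ℝ), ENNReal.ofReal (s ^ ((1 - γ) / 2 - 1)) *
        (ENNReal.ofReal (√(Real.pi / s)) * ENNReal.ofReal (Real.exp (-d ^ 2 / (4 * s)))) ≤
      ENNReal.ofReal (√Real.pi * (4 / (1 - γ / 2) + 2 / γ)) * ENNReal.ofReal (|d| ^ (-γ)) := by
  have hd2 : 0 < d ^ 2 := by positivity
  have hpt : ∀ s ∈ Set.Ioi (0:ℝ), ENNReal.ofReal (s ^ ((1 - γ) / 2 - 1)) *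
        (ENNReal.ofReal (√(Real.pi / s)) * ENNReal.ofReal (Real.exp (-d ^ 2 / (4 * s)))) =
        ENNReal.ofReal √Real.pi * (ENNReal.ofReal (s ^ (-γ / 2 - 1)) * ENNReal.ofReal (Real.exp (-d ^ 2 / (4 * s)))) := by
    intro s hs
    have hs : 0 < s := hs
    rw [← ENNReal.ofReal_mul (by positivity), ← ENNReal.ofReal_mul (by positivity), ← ENNReal.ofReal_mul (by positivity), ← ENNReal.ofReal_mul (by positivity)]
    congr 1
    rw [Real.sqrt_div (by positivity), Real.sqrt_eq_rpow s,
      show -γ / 2 - 1 = ((1 - γ) / 2 - 1) - 1 / 2 by ring, Real.rpow_sub hs _ (1 / 2)]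
    ring
  rw [setLIntegral_congr_fun measurableSet_Ioi hpt, lintegral_const_mul _ (by fun_prop),
    ENNReal.ofReal_mul (by positivity), mul_assoc]
  gcongr
  rw [← Set.Ioc_union_Ioi_eq_Ioi hd2.le]
  refine (lintegral_union_le _ _ _).trans ?_
  have hdr : (d ^ 2) ^ (-γ / 2) = |d| ^ (-γ) := by
    rw [← sq_abs, ← Real.rpow_natCast, ← Real.rpow_mul (by positivity)]
    congr 1; push_cast; ring
  have h1 : ∫⁻ s in Set.Ioc 0 (d ^ 2), ENNReal.ofReal (s ^ (-γ / 2 - 1)) * ENNReal.ofReal (Real.exp (-d ^ 2 / (4 * s)))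
      ≤ ENNReal.ofReal (4 / (1 - γ / 2) * |d| ^ (-γ)) := by
    calc _ ≤ ∫⁻ s in Set.Ioc 0 (d ^ 2), ENNReal.ofReal (s ^ (-γ / 2)) * ENNReal.ofReal (4 / d ^ 2) := by
          refine setLIntegral_mono (by fun_prop) fun s hs => ?_
          have hs0 : 0 < s := hs.1
          rw [← ENNReal.ofReal_mul (by positivity), ← ENNReal.ofReal_mul (by positivity)]
          apply ENNReal.ofReal_le_ofReal
          have hy : 0 < d ^ 2 / (4 * s) := by positivity
          have : Real.exp (-d ^ 2 / (4 * s)) ≤ (d ^ 2 / (4 * s))⁻¹ := by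
            rw [neg_div, Real.exp_neg]
            gcongr
            linarith [Real.add_one_le_exp (d ^ 2 / (4 * s))]
          calc _ ≤ s ^ (-γ / 2 - 1) * (d ^ 2 / (4 * s))⁻¹ := by gcongr
            _ = _ := by rw [Real.rpow_sub hs0, Real.rpow_one]; field_simp
      _ = _ := by
          rw [lintegral_mul_const _ (by fun_prop), lint_rpow_Ioc (by linarith) hd2, ← ENNReal.ofReal_mul (by
            have : 0 < -γ / 2 + 1 := by linarith
            positivity)]
          congr 1
          rw [Real.rpow_add hd2, Real.rpow_one, hdr]
          have : -γ / 2 + 1 = 1 - γ / 2 := by ring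
          rw [this]; field_simp
  have h2 : ∫⁻ s in Set.Ioi (d ^ 2), ENNReal.ofReal (s ^ (-γ / 2 - 1)) * ENNReal.ofReal (Real.exp (-d ^ 2 / (4 * s)))
      ≤ ENNReal.ofReal (2 / γ * |d| ^ (-γ)) := by
    calc _ ≤ ∫⁻ s in Set.Ioi (d ^ 2), ENNReal.ofReal (s ^ (-γ / 2 - 1)) := by
          refine setLIntegral_mono (by fun_prop) fun s hs => ?_
          have hs0 : 0 < s := hd2.trans hs
          refine mul_le_of_le_one_right zero_le ?_
          rw [ENNReal.ofReal_le_one, Real.exp_le_one_iff, neg_div]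
          have : 0 < d ^ 2 / (4 * s) := by positivity
          linarith
      _ = _ := by
          rw [lint_rpow_Ioi (by linarith) hd2]
          congr 1
          rw [show -γ / 2 - 1 + 1 = -γ / 2 by ring, hdr]; field_simp
  refine (add_le_add h1 h2).trans (le_of_eq ?_)
  have : 0 < 1 - γ / 2 := by linarith
  rw [← ENNReal.ofReal_add (by positivity) (by positivity), ← ENNReal.ofReal_mul (by positivity)]
  congr 1; ring

lemma pitt {γ : ℝ} (hγ0 : 0 < γ) (hγ1 : γ < 1) :
    ∃ C : NNReal, ∀ g : ℝ → ℂ, Measurable g → Integrable g →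
      ∫⁻ ξ, ‖FT g ξ‖ₑ ^ 2 * ENNReal.ofReal (|ξ| ^ (γ - 1)) ≤
        C * (∫⁻ x, ‖g x‖ₑ ^ (2 / (2 - γ))) ^ (2 - γ) := by
  obtain ⟨C, hC⟩ := hls hγ0 hγ1
  refine ⟨(Real.exp 1 * ((1 - γ) / 2)).toNNReal * ((√Real.pi * (4 / (1 - γ / 2) + 2 / γ)).toNNReal * C), fun g hgm hg => ?_⟩
  have hFm := measurable_FT hgm
  set σ := (1 - γ) / 2
  push_cast
  have hne : ∀ a : ℝ, ∀ᵐ ξ : ℝ, ξ ≠ a := fun a => by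
    simp [ae_iff]
  calc ∫⁻ ξ, ‖FT g ξ‖ₑ ^ 2 * ENNReal.ofReal (|ξ| ^ (γ - 1))
      ≤ ∫⁻ ξ, ENNReal.ofReal (Real.exp 1 * σ) * ∫⁻ s in Set.Ioi (0:ℝ), ENNReal.ofReal (s ^ (σ - 1)) *
        (ENNReal.ofReal (Real.exp (-(s * ξ ^ 2))) * ‖FT g ξ‖ₑ ^ 2) := by
        refine lintegral_mono_ae ?_
        filter_upwards [hne 0] with ξ hξ
        refine (mul_le_mul_right (pitt_lower hγ1 hξ) _).trans (le_of_eq ?_)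
        rw [mul_left_comm, ← lintegral_const_mul _ (by fun_prop)]
        congr 1
        refine lintegral_congr fun s => ?_
        ring
    _ = ENNReal.ofReal (Real.exp 1 * σ) * ∫⁻ s in Set.Ioi (0:ℝ), ENNReal.ofReal (s ^ (σ - 1)) * ∫⁻ ξ,
        (ENNReal.ofReal (Real.exp (-(s * ξ ^ 2))) * ‖FT g ξ‖ₑ ^ 2) := by
        rw [lintegral_const_mul' _ _ ENNReal.ofReal_ne_top, lintegral_lintegral_swap
          (by simp only [Function.uncurry_def]; fun_prop)]
        congr 1
        refine lintegral_congr fun s => ?_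
        rw [lintegral_const_mul _ (by fun_prop)]
    _ ≤ ENNReal.ofReal (Real.exp 1 * σ) * ∫⁻ s in Set.Ioi (0:ℝ), ENNReal.ofReal (s ^ (σ - 1)) *
        (ENNReal.ofReal (√(Real.pi / s)) * ∫⁻ x, ∫⁻ y, ‖g x‖ₑ * ‖g y‖ₑ *
        ENNReal.ofReal (Real.exp (-(x - y) ^ 2 / (4 * s)))) := by
        refine mul_le_mul_right (setLIntegral_mono' measurableSet_Ioi fun s hs => ?_) _
        exact mul_le_mul_right (gauss_ft hgm hg hs) _
    _ = ENNReal.ofReal (Real.exp 1 * σ) * ∫⁻ s in Set.Ioi (0:ℝ), ∫⁻ z : ℝ × ℝ, ‖g z.1‖ₑ * ‖g z.2‖ₑ * (ENNReal.ofReal (s ^ (σ - 1)) *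
        (ENNReal.ofReal (√(Real.pi / s)) * ENNReal.ofReal (Real.exp (-(z.1 - z.2) ^ 2 / (4 * s))))) := by
        congr 1
        refine lintegral_congr fun s => ?_
        rw [Measure.volume_eq_prod, lintegral_prod _ (by fun_prop), ← mul_assoc, ← lintegral_const_mul' _ _ (by finiteness)]
        refine lintegral_congr fun x => ?_
        rw [← lintegral_const_mul' _ _ (by finiteness)]
        refine lintegral_congr fun y => ?_
        ring
    _ = ENNReal.ofReal (Real.exp 1 * σ) * ∫⁻ z : ℝ × ℝ, ‖g z.1‖ₑ * ‖g z.2‖ₑ * ∫⁻ s in Set.Ioi (0:ℝ), (ENNReal.ofReal (s ^ (σ - 1)) *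
        (ENNReal.ofReal (√(Real.pi / s)) * ENNReal.ofReal (Real.exp (-(z.1 - z.2) ^ 2 / (4 * s))))) := by
        rw [lintegral_lintegral_swap (by simp only [Function.uncurry_def]; fun_prop)]
        congr 1
        refine lintegral_congr fun z => ?_
        rw [lintegral_const_mul _ (by fun_prop)]
    _ = ENNReal.ofReal (Real.exp 1 * σ) * ∫⁻ x, ∫⁻ y, ‖g x‖ₑ * ‖g y‖ₑ * ∫⁻ s in Set.Ioi (0:ℝ), (ENNReal.ofReal (s ^ (σ - 1)) *
        (ENNReal.ofReal (√(Real.pi / s)) * ENNReal.ofReal (Real.exp (-(x - y) ^ 2 / (4 * s))))) := by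
        rw [Measure.volume_eq_prod, lintegral_prod]
        refine AEMeasurable.mul (by fun_prop) (Measurable.aemeasurable ?_)
        exact Measurable.lintegral_prod_right' (f := fun w : (ℝ × ℝ) × ℝ => (ENNReal.ofReal (w.2 ^ (σ - 1)) *
        (ENNReal.ofReal (√(Real.pi / w.2)) * ENNReal.ofReal (Real.exp (-(w.1.1 - w.1.2) ^ 2 / (4 * w.2)))))) (by fun_prop)
    _ ≤ ENNReal.ofReal (Real.exp 1 * σ) * ∫⁻ x, ∫⁻ y, ENNReal.ofReal (√Real.pi * (4 / (1 - γ / 2) + 2 / γ)) *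
          (‖g x‖ₑ * ‖g y‖ₑ * ENNReal.ofReal (|x - y| ^ (-γ))) := by
        refine mul_le_mul_right (lintegral_mono fun x => lintegral_mono_ae ?_) _
        filter_upwards [hne x] with y hy
        refine (mul_le_mul_right (pitt_upper hγ0 hγ1 (sub_ne_zero.2 hy.symm)) _).trans (le_of_eq ?_)
        ring
    _ = ENNReal.ofReal (Real.exp 1 * σ) * (ENNReal.ofReal (√Real.pi * (4 / (1 - γ / 2) + 2 / γ)) * ∫⁻ x, ∫⁻ y,
          (‖g x‖ₑ * ‖g y‖ₑ * ENNReal.ofReal (|x - y| ^ (-γ)))) := by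
        congr 1
        rw [← lintegral_const_mul' _ _ ENNReal.ofReal_ne_top]
        refine lintegral_congr fun x => ?_
        rw [← lintegral_const_mul' _ _ ENNReal.ofReal_ne_top]
    _ ≤ _ := by
        rw [mul_assoc, mul_assoc]
        refine mul_le_mul_right (mul_le_mul_right ?_ _) _
        exact hC (fun x => ‖g x‖₊) (by fun_prop)


/-- Kernel of the propagator with derivative weight. -/
noncomputable def KK (α Y t x ξ : ℝ) : ℂ :=
  Complex.exp (Complex.I * ((x * ξ + t * omegaBO α ξ : ℝ) : ℂ)) * ((|ξ| ^ (α * Y) : ℝ) : ℂ)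

structure NiceF (N : ℝ) (f : ℝ → ℂ) : Prop where
  meas : Measurable f
  bdd : ∃ B : ℝ, ∀ ξ, ‖f ξ‖ ≤ B
  supp : ∀ ξ, ξ ∉ Set.Icc N⁻¹ N → f ξ = 0

structure NiceG (N : ℝ) (G : ℝ × ℝ → ℂ) : Prop where
  meas : Measurable G
  bdd : ∃ B : ℝ, ∀ z, ‖G z‖ ≤ B
  supp : ∀ z, z ∉ Set.Icc (-N) N ×ˢ Set.Icc (-N) N → G z = 0

noncomputable def Fn (A : ℝ) (f : ℝ → ℂ) : ℝ≥0∞ := (∫⁻ ξ, ‖f ξ‖ₑ ^ (1 / A)) ^ A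

noncomputable def Mn (P Q : ℝ) (G : ℝ × ℝ → ℂ) : ℝ≥0∞ :=
  (∫⁻ t, (∫⁻ x, ‖G (t, x)‖ₑ ^ (1 / P)) ^ (P / Q)) ^ Q

noncomputable def pair (α Y : ℝ) (f : ℝ → ℂ) (G : ℝ × ℝ → ℂ) : ℂ :=
  ∫ w : (ℝ × ℝ) × ℝ, KK α Y w.1.1 w.1.2 w.2 * f w.2 * G w.1

def Est (α P Q : ℝ) (M : NNReal) : Prop :=
  ∀ N : ℝ, 0 < N → ∀ f G, NiceF N f → NiceG N G →
    ‖pair α (1 - Q) f G‖ₑ ≤ M * Fn (2 * Q + P - 2) f * Mn P Q G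

lemma measurable_omegaBO (α : ℝ) : Measurable (omegaBO α) := by
  unfold omegaBO; fun_prop

lemma measurable_KK (α Y : ℝ) : Measurable fun w : (ℝ × ℝ) × ℝ => KK α Y w.1.1 w.1.2 w.2 := by
  unfold KK
  have := measurable_omegaBO α
  fun_prop

@[fun_prop]
lemma measurable_KK' {X : Type*} [MeasurableSpace X] (α Y : ℝ) {t x ξ : X → ℝ} (ht : Measurable t)
    (hx : Measurable x) (hξ : Measurable ξ) : Measurable fun w => KK α Y (t w) (x w) (ξ w) :=
  (measurable_KK α Y).comp ((ht.prodMk hx).prodMk hξ)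

lemma norm_KK (α Y t x ξ : ℝ) : ‖KK α Y t x ξ‖ = |ξ| ^ (α * Y) := by
  unfold KK
  rw [norm_mul, norm_expI, one_mul, Complex.norm_real, Real.norm_of_nonneg (by positivity)]

lemma enorm_KK (α Y t x ξ : ℝ) : ‖KK α Y t x ξ‖ₑ = ENNReal.ofReal (|ξ| ^ (α * Y)) := by
  rw [← ofReal_norm, norm_KK]

lemma NiceF.integrable {N : ℝ} {f : ℝ → ℂ} (h : NiceF N f) : Integrable f := by
  obtain ⟨B, hB⟩ := h.bdd
  have : IntegrableOn f (Set.Icc N⁻¹ N) :=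
    Measure.integrableOn_of_bounded (M := B) (by simp) h.meas.aestronglyMeasurable (Filter.Eventually.of_forall hB)
  exact (integrableOn_iff_integrable_of_support_subset (fun x hx => by
    by_contra h'; exact hx (h.supp x h'))).1 this

lemma NiceG.integrable {N : ℝ} {G : ℝ × ℝ → ℂ} (h : NiceG N G) : Integrable G := by
  obtain ⟨B, hB⟩ := h.bdd
  have : IntegrableOn G (Set.Icc (-N) N ×ˢ Set.Icc (-N) N) := by
    refine Measure.integrableOn_of_bounded (M := B) ?_ h.meas.aestronglyMeasurable (Filter.Eventually.of_forall hB)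
    rw [Measure.volume_eq_prod, Measure.prod_prod, Real.volume_Icc]; finiteness
  exact (integrableOn_iff_integrable_of_support_subset (fun x hx => by
    by_contra h'; exact hx (h.supp x h'))).1 this

lemma rpow_bdd {N ξ : ℝ} (hN : 0 < N) (e : ℝ) (h : ξ ∈ Set.Icc N⁻¹ N) :
    |ξ| ^ e ≤ N ^ e + (N⁻¹) ^ e := by
  have hN' : 0 < N⁻¹ := by positivity
  have hξ : 0 < ξ := lt_of_lt_of_le hN' h.1
  rw [abs_of_pos hξ]
  rcases le_total 0 e with he | he
  · have := Real.rpow_le_rpow hξ.le h.2 he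
    have : 0 ≤ (N⁻¹) ^ e := by positivity
    linarith
  · have := Real.rpow_le_rpow_of_nonpos hN' h.1 he
    have : 0 ≤ N ^ e := by positivity
    linarith

lemma NiceF.mul {N : ℝ} {f : ℝ → ℂ} (h : NiceF N f) {m : ℝ → ℂ} (hm : Measurable m) {B : ℝ}
    (hB : ∀ ξ ∈ Set.Icc N⁻¹ N, ‖m ξ‖ ≤ B) : NiceF N (fun ξ => m ξ * f ξ) := by
  obtain ⟨B', hB'⟩ := h.bdd
  refine ⟨hm.mul h.meas, ⟨|B| * |B'|, fun ξ => ?_⟩, fun ξ hξ => by rw [h.supp ξ hξ, mul_zero]⟩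
  by_cases hξ : ξ ∈ Set.Icc N⁻¹ N
  · rw [norm_mul]
    exact mul_le_mul ((hB ξ hξ).trans (le_abs_self _)) ((hB' ξ).trans (le_abs_self _)) (norm_nonneg _) (abs_nonneg _)
  · rw [h.supp ξ hξ, mul_zero, norm_zero]; positivity

lemma NiceG.mul {N : ℝ} {G : ℝ × ℝ → ℂ} (h : NiceG N G) {m : ℝ × ℝ → ℂ} (hm : Measurable m) {B : ℝ}
    (hB : ∀ z ∈ Set.Icc (-N) N ×ˢ Set.Icc (-N) N, ‖m z‖ ≤ B) : NiceG N (fun z => m z * G z) := by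
  obtain ⟨B', hB'⟩ := h.bdd
  refine ⟨hm.mul h.meas, ⟨|B| * |B'|, fun ξ => ?_⟩, fun ξ hξ => by rw [h.supp ξ hξ, mul_zero]⟩
  by_cases hξ : ξ ∈ Set.Icc (-N) N ×ˢ Set.Icc (-N) N
  · rw [norm_mul]
    exact mul_le_mul ((hB ξ hξ).trans (le_abs_self _)) ((hB' ξ).trans (le_abs_self _)) (norm_nonneg _) (abs_nonneg _)
  · rw [h.supp ξ hξ, mul_zero, norm_zero]; positivity

lemma NiceF.weight {N : ℝ} (hN : 0 < N) {f : ℝ → ℂ} (h : NiceF N f) (e : ℝ) :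
    NiceF N (fun ξ => ((|ξ| ^ e : ℝ) : ℂ) * f ξ) := by
  refine h.mul (by fun_prop) (B := N ^ e + (N⁻¹) ^ e) fun ξ hξ => ?_
  rw [Complex.norm_real, Real.norm_of_nonneg (by positivity)]
  exact rpow_bdd hN e hξ

/-- integrability from weighted integrability -/
lemma integrable_KKfG {α Y : ℝ} {f : ℝ → ℂ} {G : ℝ × ℝ → ℂ} (hfm : Measurable f) (hGm : Measurable G)
    (hf : Integrable fun ξ => ((|ξ| ^ (α * Y) : ℝ) : ℂ) * f ξ) (hG : Integrable G) :
    Integrable fun w : (ℝ × ℝ) × ℝ => KK α Y w.1.1 w.1.2 w.2 * f w.2 * G w.1 := by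
  have h1 := hG.mul_prod hf
  refine h1.congr' ?_ ?_
  · exact (by fun_prop : Measurable _).aestronglyMeasurable
  · refine Filter.Eventually.of_forall fun w => ?_
    simp only [norm_mul, norm_KK, Complex.norm_real]
    rw [Real.norm_of_nonneg (by positivity)]; ring

lemma integrable_nice {α Y N : ℝ} (hN : 0 < N) {f : ℝ → ℂ} {G : ℝ × ℝ → ℂ} (hf : NiceF N f) (hG : NiceG N G) :
    Integrable fun w : (ℝ × ℝ) × ℝ => KK α Y w.1.1 w.1.2 w.2 * f w.2 * G w.1 :=
  integrable_KKfG hf.meas hG.meas (hf.weight hN _).integrable hG.integrable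

lemma pair_eq1 {α Y N : ℝ} (hN : 0 < N) {f : ℝ → ℂ} {G : ℝ × ℝ → ℂ} (hf : NiceF N f) (hG : NiceG N G) :
    pair α Y f G = ∫ ξ, f ξ * ∫ z : ℝ × ℝ, KK α Y z.1 z.2 ξ * G z := by
  unfold pair
  rw [Measure.volume_eq_prod (ℝ × ℝ) ℝ, integral_prod_symm _ (integrable_nice hN hf hG)]
  refine integral_congr_ae (Filter.Eventually.of_forall fun ξ => ?_)
  simp only
  rw [← integral_const_mul]
  refine integral_congr_ae (Filter.Eventually.of_forall fun z => ?_)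
  simp only; ring

lemma pair_eq2 {α Y N : ℝ} (hN : 0 < N) {f : ℝ → ℂ} {G : ℝ × ℝ → ℂ} (hf : NiceF N f) (hG : NiceG N G) :
    pair α Y f G = ∫ z : ℝ × ℝ, (∫ ξ, KK α Y z.1 z.2 ξ * f ξ) * G z := by
  unfold pair
  rw [Measure.volume_eq_prod (ℝ × ℝ) ℝ, integral_prod _ (integrable_nice hN hf hG)]
  refine integral_congr_ae (Filter.Eventually.of_forall fun ξ => ?_)
  simp only
  rw [← integral_mul_const]

lemma Est.mono {α P Q : ℝ} {M M' : NNReal} (h : Est α P Q M) (hM : M ≤ M') : Est α P Q M' := by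
  intro N hN f G hf hG
  refine (h N hN f G hf hG).trans ?_
  gcongr

lemma est_O (α : ℝ) : Est α 1 1 1 := by
  intro N hN f G hf hG
  unfold pair
  refine (enorm_integral_le_lintegral_enorm _).trans ?_
  have hfm := hf.meas
  have hGm := hG.meas
  simp only [enorm_mul, enorm_KK, Fn, Mn]
  norm_num
  rw [Measure.volume_eq_prod (ℝ × ℝ) ℝ, lintegral_prod _ (by fun_prop)]
  rw [← lintegral_prod (fun z => ‖G z‖ₑ) (by fun_prop), ← Measure.volume_eq_prod, ← lintegral_const_mul _ (by fun_prop)]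
  refine lintegral_mono fun z => ?_
  dsimp only
  rw [lintegral_mul_const _ (by fun_prop)]

/-- Cauchy-Schwarz. -/
lemma cs_lint {X : Type*} [MeasurableSpace X] (μ : Measure X) {f g : X → ℝ≥0∞} (hf : AEMeasurable f μ) (hg : AEMeasurable g μ) :
    ∫⁻ x, f x * g x ∂μ ≤ (∫⁻ x, f x ^ 2 ∂μ) ^ (1 / 2 : ℝ) * (∫⁻ x, g x ^ 2 ∂μ) ^ (1 / 2 : ℝ) := by
  have := ENNReal.lintegral_mul_le_Lp_mul_Lq μ (p := 2) (q := 2) ⟨by norm_num, by norm_num, by norm_num⟩ hf hg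
  simpa using this

lemma est_C (α : ℝ) : Est α (1 / 2) 1 (Real.sqrt (2 * Real.pi)).toNNReal := by
  intro N hN f G hf hG
  have hfm := hf.meas
  have hGm := hG.meas
  have hGs : ∀ t, Integrable fun x => G (t, x) := by
    intro t
    obtain ⟨B, hB⟩ := hG.bdd
    have : IntegrableOn (fun x => G (t, x)) (Set.Icc (-N) N) :=
      Measure.integrableOn_of_bounded (M := B) (by simp) (by fun_prop : Measurable _).aestronglyMeasurable (Filter.Eventually.of_forall fun x => hB _)
    exact (integrableOn_iff_integrable_of_support_subset (fun x hx => by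
      by_contra h'; exact hx (hG.supp (t, x) fun h'' => h' h''.2))).1 this
  have hI := (integrable_nice (α := α) (Y := 1 - 1) hN hf hG)
  have e1 : pair α (1 - 1) f G = ∫ t, ∫ ξ, (Complex.exp (Complex.I * ((t * omegaBO α ξ : ℝ) : ℂ)) * f ξ) * FT (fun x => G (t, x)) ξ := by
    unfold pair
    have hI' : Integrable (fun w : (ℝ × ℝ) × ℝ => KK α (1-1) w.1.1 w.1.2 w.2 * f w.2 * G w.1) ((volume.prod volume).prod volume) := hI
    rw [Measure.volume_eq_prod (ℝ × ℝ) ℝ, Measure.volume_eq_prod ℝ ℝ]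
    rw [integral_prod _ hI', integral_prod _ hI'.integral_prod_left]
    refine integral_congr_ae ?_
    have h3 : Integrable (fun w : ℝ × ℝ × ℝ => KK α (1-1) w.1 w.2.1 w.2.2 * f w.2.2 * G (w.1, w.2.1)) (volume.prod (volume.prod volume)) := by
      have := (measurePreserving_prodAssoc (volume : Measure ℝ) (volume : Measure ℝ) (volume : Measure ℝ)).symm.integrable_comp hI'.1
      exact this.2 hI'
    filter_upwards [h3.prod_right_ae] with t ht
    rw [integral_integral_swap ht]
    refine integral_congr_ae (Filter.Eventually.of_forall fun ξ => ?_)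
    simp only [FT]
    rw [← integral_const_mul]
    refine integral_congr_ae (Filter.Eventually.of_forall fun x => ?_)
    simp only [KK, sub_self, mul_zero, Real.rpow_zero, Complex.ofReal_one, mul_one]
    rw [Complex.ofReal_add, mul_add, Complex.exp_add]; ring
  rw [e1]
  refine (enorm_integral_le_lintegral_enorm _).trans ?_
  have hF1 : Fn (2 * 1 + 1 / 2 - 2) f = (∫⁻ ξ, ‖f ξ‖ₑ ^ 2) ^ (1 / 2 : ℝ) := by
    simp only [Fn]; norm_num
  have hM1 : Mn (1 / 2) 1 G = ∫⁻ t, (∫⁻ x, ‖G (t, x)‖ₑ ^ 2) ^ (1 / 2 : ℝ) := by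
    simp only [Mn]; norm_num
  rw [hF1, hM1, ← lintegral_const_mul _ (by
    refine Measurable.pow_const ?_ _
    exact Measurable.lintegral_prod_right' (f := fun z : ℝ × ℝ => ‖G z‖ₑ ^ 2) (by fun_prop))]
  refine lintegral_mono fun t => ?_
  refine (enorm_integral_le_lintegral_enorm _).trans ?_
  have hFm : Measurable (FT fun x => G (t, x)) := measurable_FT (by fun_prop)
  simp only [enorm_mul]
  have h1 : ∀ ξ, ‖Complex.exp (Complex.I * ((t * omegaBO α ξ : ℝ) : ℂ))‖ₑ = 1 := fun ξ => by
    rw [← ofReal_norm, norm_expI, ENNReal.ofReal_one]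
  simp only [h1, one_mul]
  refine (cs_lint _ (by fun_prop) (by fun_prop)).trans ?_
  rw [mul_comm ((_ : NNReal) : ℝ≥0∞), mul_assoc]
  refine mul_le_mul_right ?_ _
  refine (ENNReal.rpow_le_rpow (planch (by fun_prop) (hGs t)) (by norm_num)).trans (le_of_eq ?_)
  rw [ENNReal.mul_rpow_of_nonneg _ _ (by norm_num), ENNReal.ofReal_rpow_of_pos (by positivity), ← Real.sqrt_eq_rpow]
  rfl


lemma vdc1 {ψ ρ v v' m m' : ℝ → ℝ} {a b : ℝ} (hab : a ≤ b)
    (hψ : ∀ x ∈ Set.Icc a b, HasDerivAt ψ (ρ x) x) (hv : ∀ x ∈ Set.Icc a b, HasDerivAt v (v' x) x)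
    (hvρ : ∀ x ∈ Set.Icc a b, v x * ρ x = 1) (hψc : Continuous ψ)
    (hm : ∀ x ∈ Set.Icc a b, HasDerivAt m (m' x) x) (hm' : ∀ x ∈ Set.Icc a b, |v' x| ≤ m' x) :
    ‖∫ x in a..b, Complex.exp (Complex.I * (ψ x : ℂ))‖ ≤ |v a| + |v b| + (m b - m a) := by
  set e : ℝ → ℂ := fun x => Complex.exp (Complex.I * (ψ x : ℂ)) with he
  have hec : Continuous e := by simp only [he]; fun_prop
  have hen : ∀ x, ‖e x‖ = 1 := fun x => norm_expI _
  set E : ℝ → ℂ := fun y => (∫ x in a..y, e x) + Complex.I * ((v y : ℂ) * e y) - Complex.I * ((v a : ℂ) * e a) with hE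
  have hd : ∀ x ∈ Set.Icc a b, HasDerivAt E (Complex.I * ((v' x : ℂ) * e x)) x := by
    intro x hx
    have h1 : HasDerivAt (fun y => ∫ x in a..y, e x) (e x) x :=
      intervalIntegral.integral_hasDerivAt_right (hec.intervalIntegrable _ _)
        (hec.stronglyMeasurableAtFilter _ _) hec.continuousAt
    have h2 : HasDerivAt e (e x * (Complex.I * (ρ x : ℂ))) x :=
      ((hψ x hx).ofReal_comp.const_mul Complex.I).cexp
    have h3 := ((h1.add (((hv x hx).ofReal_comp.mul h2).const_mul Complex.I)).sub_const (Complex.I * ((v a : ℂ) * e a)))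
    refine h3.congr_deriv ?_
    have : (v x : ℂ) * (ρ x : ℂ) = 1 := by exact_mod_cast hvρ x hx
    linear_combination (e x * Complex.I ^ 2) * this + e x * Complex.I_sq
  have key := image_norm_le_of_norm_deriv_right_le_deriv_boundary' (f := E) (f' := fun x => Complex.I * ((v' x : ℂ) * e x))
    (a := a) (b := b) (B := fun y => m y - m a) (B' := m')
    (fun x hx => (hd x hx).continuousAt.continuousWithinAt)
    (fun x hx => (hd x ⟨hx.1, hx.2.le⟩).hasDerivWithinAt) (by simp [hE])
    (fun x hx => ((hm x hx).sub_const _).continuousAt.continuousWithinAt)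
    (fun x hx => ((hm x ⟨hx.1, hx.2.le⟩).sub_const _).hasDerivWithinAt)
    (fun x hx => by
      rw [norm_mul, norm_mul, hen, Complex.norm_I, one_mul, mul_one, Complex.norm_real]
      exact hm' x ⟨hx.1, hx.2.le⟩) (Set.right_mem_Icc.2 hab)
  have : (∫ x in a..b, e x) = E b - Complex.I * ((v b : ℂ) * e b) + Complex.I * ((v a : ℂ) * e a) := by
    simp only [hE]; ring
  rw [this]
  refine (norm_add_le _ _).trans ?_
  have h5 := norm_sub_le (E b) (Complex.I * ((v b : ℂ) * e b))
  simp only [norm_mul, hen, Complex.norm_I, one_mul, mul_one, Complex.norm_real, Real.norm_eq_abs] at h5 ⊢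
  linarith

lemma vdc_triv {ψ : ℝ → ℝ} {a b : ℝ} (hab : a ≤ b) :
    ‖∫ x in a..b, Complex.exp (Complex.I * (ψ x : ℂ))‖ ≤ b - a := by
  have := intervalIntegral.norm_integral_le_of_norm_le_const (a := a) (b := b) (C := 1)
    (f := fun x => Complex.exp (Complex.I * (ψ x : ℂ))) (fun x _ => (norm_expI _).le)
  rwa [one_mul, abs_of_nonneg (by linarith)] at this

noncomputable def psi (β x t η : ℝ) : ℝ := x * η ^ β - t * η ^ 2
noncomputable def rho (β x t η : ℝ) : ℝ := x * (β * η ^ (β - 1)) - t * (2 * η)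
noncomputable def rho' (β x t η : ℝ) : ℝ := x * (β * ((β - 1) * η ^ (β - 1 - 1))) - t * 2

lemma psi_cont {β : ℝ} (hβ : 0 < β) (x t : ℝ) : Continuous (psi β x t) := by
  unfold psi
  have : Continuous fun η : ℝ => η ^ β := Real.continuous_rpow_const hβ.le
  fun_prop

lemma psi_deriv (β x t : ℝ) {η : ℝ} (hη : 0 < η) : HasDerivAt (psi β x t) (rho β x t η) η := by
  unfold psi rho
  have h1 := (Real.hasDerivAt_rpow_const (p := β) (Or.inl hη.ne')).const_mul x
  have h2 := (hasDerivAt_pow 2 η).const_mul t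
  exact (h1.sub h2).congr_deriv (by simp)

lemma rho_deriv (β x t : ℝ) {η : ℝ} (hη : 0 < η) : HasDerivAt (rho β x t) (rho' β x t η) η := by
  unfold rho rho'
  have h1 := ((Real.hasDerivAt_rpow_const (p := β - 1) (Or.inl hη.ne')).const_mul β).const_mul x
  have h2 := ((hasDerivAt_id η).const_mul 2).const_mul t
  exact (h1.sub h2).congr_deriv (by simp)

/-- nonpositive x. -/
lemma vdc_neg {β : ℝ} (hβ0 : 0 < β) (hβ1 : β < 1) {x t : ℝ} (hx : x ≤ 0) {δ : ℝ} (hδ : 0 < δ) (ht : t = (δ ^ 2)⁻¹)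
    {a b : ℝ} (ha : δ ≤ a) (hab : a ≤ b) :
    ‖∫ η in a..b, Complex.exp (Complex.I * (psi β x t η : ℂ))‖ ≤ 2 * δ := by
  have ht0 : 0 < t := by rw [ht]; positivity
  have hρ : ∀ η, 0 < η → rho β x t η ≤ - (2 * t * η) := by
    intro η hη
    unfold rho
    have : 0 ≤ -x * (β * η ^ (β - 1)) := mul_nonneg (by linarith) (by positivity)
    nlinarith
  have hρ' : ∀ η, 0 < η → |rho' β x t η| ≤ - rho β x t η / η := by
    intro η hη
    unfold rho' rho
    have h1 : η ^ (β - 1 - 1) = η ^ (β - 1) / η := Real.rpow_sub_one hη.ne' _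
    rw [h1, abs_le]
    set k := η ^ (β - 1) / η with hk
    have hk0 : 0 ≤ k := by positivity
    have h2 : -(x * (β * η ^ (β - 1)) - t * (2 * η)) / η = -x * β * k + 2 * t := by
      rw [hk]; field_simp; ring
    rw [h2]
    have h3 : 0 ≤ -x * β * k := mul_nonneg (mul_nonneg (by linarith) hβ0.le) hk0
    constructor <;> nlinarith
  have pos : ∀ η ∈ Set.Icc a b, 0 < η := fun η h => lt_of_lt_of_le (hδ.trans_le ha) h.1
  have hne : ∀ η ∈ Set.Icc a b, rho β x t η < 0 := fun η h => by
    have := hρ η (pos η h); have := pos η h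
    have : 0 < 2 * t * η := by positivity
    linarith
  have := vdc1 (ψ := psi β x t) (ρ := rho β x t) (v := fun η => (rho β x t η)⁻¹)
    (v' := fun η => - rho' β x t η / rho β x t η ^ 2) (m := fun η => -(2 * t)⁻¹ * η⁻¹) (m' := fun η => (2 * t)⁻¹ * (η ^ 2)⁻¹) hab
    (fun η h => psi_deriv β x t (pos η h)) (fun η h => (rho_deriv β x t (pos η h)).inv (hne η h).ne)
    (fun η h => inv_mul_cancel₀ (hne η h).ne) (psi_cont hβ0 x t)
    (fun η h => by
      have := (hasDerivAt_inv (pos η h).ne').const_mul (-(2 * t)⁻¹)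
      refine this.congr_deriv ?_; ring)
    (fun η h => by
      have h0 := pos η h
      have h1 := hρ' η h0
      have h2 := hρ η h0
      have h3 := hne η h
      rw [abs_div, abs_neg, abs_of_nonneg (sq_nonneg (rho β x t η))]
      calc _ ≤ (- rho β x t η / η) / rho β x t η ^ 2 := by gcongr
        _ = (- rho β x t η)⁻¹ * η⁻¹ := by field_simp
        _ ≤ (2 * t * η)⁻¹ * η⁻¹ := by gcongr; linarith
        _ = _ := by field_simp)
  refine this.trans ?_
  have hv : ∀ η ∈ Set.Icc a b, |(rho β x t η)⁻¹| ≤ δ / 2 := by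
    intro η h
    have h2 := hρ η (pos η h)
    rw [abs_inv, abs_of_neg (hne η h)]
    have : 2 * t * δ ≤ - rho β x t η := by
      have : δ ≤ η := ha.trans h.1
      have : 2 * t * δ ≤ 2 * t * η := by gcongr
      linarith
    calc _ ≤ (2 * t * δ)⁻¹ := by gcongr
      _ = _ := by rw [ht]; field_simp
  have h1 := hv a (Set.left_mem_Icc.2 hab)
  have h2 := hv b (Set.right_mem_Icc.2 hab)
  have h3 : (2 * t)⁻¹ * a⁻¹ ≤ δ / 2 := by
    calc _ ≤ (2 * t)⁻¹ * δ⁻¹ := by gcongr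
      _ = _ := by rw [ht]; field_simp
  have h4 : 0 ≤ (2 * t)⁻¹ * b⁻¹ := by have := pos b (Set.right_mem_Icc.2 hab); positivity
  linarith

lemma vdc_pos_piece {β : ℝ} (hβ0 : 0 < β) (hβ1 : β < 1) {x t : ℝ} (hx : 0 < x) {δ : ℝ} (hδ : 0 < δ) (ht : t = (δ ^ 2)⁻¹)
    {η1 : ℝ} (hη1 : 0 < η1) (hz : x * (β * η1 ^ (β - 1)) = t * (2 * η1))
    {a b : ℝ} (ha : 0 < a) (hab : a ≤ b) (hfar : b ≤ η1 - δ ∨ η1 + δ ≤ a) :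
    ‖∫ η in a..b, Complex.exp (Complex.I * (psi β x t η : ℂ))‖ ≤ 2 * δ := by
  have ht0 : 0 < t := by rw [ht]; positivity
  have pos : ∀ η ∈ Set.Icc a b, 0 < η := fun η h => lt_of_lt_of_le ha h.1
  have htd : 2 * t * δ = 2 / δ := by rw [ht]; field_simp
  have hρ : ∀ η ∈ Set.Icc a b, 2 / δ ≤ |rho β x t η| := by
    intro η h
    have h0 := pos η h
    rw [← htd]
    rcases hfar with hf | hf
    · have h1 : η ≤ η1 - δ := h.2.trans hf
      have h2 : η1 ^ (β - 1) ≤ η ^ (β - 1) := Real.rpow_le_rpow_of_nonpos h0 (by linarith) (by linarith)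
      have h3 : x * (β * η1 ^ (β - 1)) ≤ x * (β * η ^ (β - 1)) := by gcongr
      refine le_trans ?_ (le_abs_self _)
      unfold rho
      nlinarith
    · have h1 : η1 + δ ≤ η := hf.trans h.1
      have h2 : η ^ (β - 1) ≤ η1 ^ (β - 1) := Real.rpow_le_rpow_of_nonpos hη1 (by linarith) (by linarith)
      have h3 : x * (β * η ^ (β - 1)) ≤ x * (β * η1 ^ (β - 1)) := by gcongr
      refine le_trans ?_ (neg_le_abs _)
      unfold rho
      nlinarith
  have hne : ∀ η ∈ Set.Icc a b, rho β x t η ≠ 0 := fun η h => by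
    have := hρ η h
    have h2 : 0 < 2 / δ := by positivity
    exact abs_pos.1 (h2.trans_le this)
  have hv : ∀ η ∈ Set.Icc a b, |(rho β x t η)⁻¹| ≤ δ / 2 := by
    intro η h
    rw [abs_inv]
    calc _ ≤ (2 / δ)⁻¹ := by gcongr; exact hρ η h
      _ = _ := by field_simp
  have := vdc1 (ψ := psi β x t) (ρ := rho β x t) (v := fun η => (rho β x t η)⁻¹)
    (v' := fun η => - rho' β x t η / rho β x t η ^ 2) (m := fun η => (rho β x t η)⁻¹) (m' := fun η => - rho' β x t η / rho β x t η ^ 2) hab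
    (fun η h => psi_deriv β x t (pos η h)) (fun η h => (rho_deriv β x t (pos η h)).inv (hne η h))
    (fun η h => inv_mul_cancel₀ (hne η h)) (psi_cont hβ0 x t)
    (fun η h => (rho_deriv β x t (pos η h)).inv (hne η h))
    (fun η h => by
      have h0 := pos η h
      refine (abs_of_nonneg ?_).le
      refine div_nonneg ?_ (sq_nonneg _)
      unfold rho'
      have : 0 ≤ x * (β * ((1 - β) * η ^ (β - 1 - 1))) := by
        have : 0 < 1 - β := by linarith
        positivity
      nlinarith)
  refine this.trans ?_
  have h1 := hv a (Set.left_mem_Icc.2 hab)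
  have h2 := hv b (Set.right_mem_Icc.2 hab)
  have h3 := abs_le.1 h1
  have h4 := abs_le.1 h2
  linarith

lemma vdc_psi {β : ℝ} (hβ0 : 0 < β) (hβ1 : β < 1) (x : ℝ) {t δ : ℝ} (hδ : 0 < δ) (ht : t = (δ ^ 2)⁻¹)
    {a b : ℝ} (ha : 0 < a) (hab : a ≤ b) :
    ‖∫ η in a..b, Complex.exp (Complex.I * (psi β x t η : ℂ))‖ ≤ 6 * δ := by
  have hc : Continuous fun η => Complex.exp (Complex.I * (psi β x t η : ℂ)) := by
    have := psi_cont hβ0 x t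
    fun_prop
  have hintg : ∀ u w, IntervalIntegrable (fun η => Complex.exp (Complex.I * (psi β x t η : ℂ))) volume u w :=
    fun u w => hc.intervalIntegrable _ _
  have ht0 : 0 < t := by rw [ht]; positivity
  rcases le_or_gt x 0 with hx | hx
  · rcases le_or_gt δ a with h1 | h1
    · refine (vdc_neg hβ0 hβ1 hx hδ ht h1 hab).trans (by linarith)
    · rcases le_or_gt b δ with h2 | h2
      · exact (vdc_triv hab).trans (by linarith)
      · rw [← intervalIntegral.integral_add_adjacent_intervals (hintg a δ) (hintg δ b)]
        refine (norm_add_le _ _).trans ?_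
        have := vdc_neg hβ0 hβ1 hx hδ ht le_rfl h2.le
        have := vdc_triv (ψ := psi β x t) h1.le
        linarith
  · set η1 := (x * β / (2 * t)) ^ (1 / (2 - β)) with hη1
    have hηpos : 0 < η1 := by positivity
    have hz : x * (β * η1 ^ (β - 1)) = t * (2 * η1) := by
      have h1 : η1 ^ (2 - β) = x * β / (2 * t) := by
        rw [hη1, ← Real.rpow_mul (by positivity), one_div_mul_cancel (by linarith), Real.rpow_one]
      have h2 : η1 ^ (2 - β) * η1 ^ (β - 1) = η1 := by
        rw [← Real.rpow_add hηpos, show 2 - β + (β - 1) = 1 by ring, Real.rpow_one]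
      rw [h1] at h2
      field_simp at h2
      linarith
    set cl : ℝ → ℝ := fun y => max a (min b y) with hcl
    have hcl1 : ∀ y, a ≤ cl y := fun y => le_max_left _ _
    have hcl2 : ∀ y, cl y ≤ b := fun y => max_le hab (min_le_left _ _)
    have hclm : cl (η1 - δ) ≤ cl (η1 + δ) := max_le_max le_rfl (min_le_min le_rfl (by linarith))
    have hcld : cl (η1 + δ) - cl (η1 - δ) ≤ 2 * δ := by
      simp only [hcl]
      rcases le_total b (η1 - δ) with h | h <;> rcases le_total b (η1 + δ) with h' | h' <;>
      simp only [min_eq_left, min_eq_right, h, h'] <;>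
      · rw [sub_le_iff_le_add]
        refine max_le ?_ ?_
        · have := le_max_left a b; have := le_max_left a (η1 - δ); linarith
        · have := le_max_right a b; have := le_max_right a (η1 - δ); linarith
    rw [← intervalIntegral.integral_add_adjacent_intervals (hintg a (cl (η1 - δ))) (hintg _ b),
      ← intervalIntegral.integral_add_adjacent_intervals (hintg (cl (η1 - δ)) (cl (η1 + δ))) (hintg _ b)]
    have e1 : ‖∫ η in a..(cl (η1 - δ)), Complex.exp (Complex.I * (psi β x t η : ℂ))‖ ≤ 2 * δ := by
      rcases (hcl1 (η1 - δ)).eq_or_lt with h | h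
      · rw [← h, intervalIntegral.integral_same, norm_zero]; positivity
      · refine vdc_pos_piece hβ0 hβ1 hx hδ ht hηpos hz ha (hcl1 _) (Or.inl ?_)
        rcases lt_max_iff.1 h with h' | h'
        · exact absurd h' (lt_irrefl _)
        · exact max_le (h'.le.trans (min_le_right _ _)) (min_le_right _ _)
    have e2 := (vdc_triv (ψ := psi β x t) hclm).trans hcld
    have e3 : ‖∫ η in (cl (η1 + δ))..b, Complex.exp (Complex.I * (psi β x t η : ℂ))‖ ≤ 2 * δ := by
      rcases (hcl2 (η1 + δ)).eq_or_lt with h | h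
      · rw [← h, intervalIntegral.integral_same, norm_zero]; positivity
      · refine vdc_pos_piece hβ0 hβ1 hx hδ ht hηpos hz (ha.trans_le (hcl1 _)) (hcl2 _) (Or.inr ?_)
        have h2 := (max_lt_iff.1 h).2
        rcases min_lt_iff.1 h2 with h' | h'
        · exact absurd h' (lt_irrefl _)
        · exact (le_min h'.le le_rfl).trans (le_max_right _ _)
    refine (norm_add_le _ _).trans ?_
    have := norm_add_le (∫ η in (cl (η1 - δ))..(cl (η1 + δ)), Complex.exp (Complex.I * (psi β x t η : ℂ)))
      (∫ η in (cl (η1 + δ))..b, Complex.exp (Complex.I * (psi β x t η : ℂ)))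
    linarith

/-- Dispersive estimate for positive times. -/
lemma disp_pos {α : ℝ} (hα : 0 < α) (x : ℝ) {t : ℝ} (ht : 0 < t) {a b : ℝ} (ha : 0 < a) (hab : a ≤ b) :
    ‖∫ ξ in a..b, Complex.exp (Complex.I * ((x * ξ + t * omegaBO α ξ : ℝ) : ℂ)) * ((|ξ| ^ (α / 2) : ℝ) : ℂ)‖
      ≤ 6 * t ^ (-(1 / 2) : ℝ) := by
  set β := 2 / (2 + α) with hβ
  have hβ0 : 0 < β := by positivity
  have hβ1 : β < 1 := by rw [hβ, div_lt_one (by positivity)]; linarith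
  set δ := t ^ (-(1 / 2) : ℝ) with hδ
  have hδ0 : 0 < δ := by positivity
  have htd : t = (δ ^ 2)⁻¹ := by
    rw [hδ, ← Real.rpow_natCast, ← Real.rpow_mul ht.le]; norm_num
    rw [Real.rpow_neg_one, inv_inv]
  have hb : 0 < b := ha.trans_le hab
  have hmain := vdc_psi hβ0 hβ1 x hδ0 htd (a := a ^ β⁻¹) (b := b ^ β⁻¹) (by positivity)
    (Real.rpow_le_rpow ha.le hab (by positivity))
  have hcs := intervalIntegral.integral_deriv_smul_comp (a := a) (b := b) (f := fun ξ : ℝ => ξ ^ β⁻¹)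
    (f' := fun ξ => β⁻¹ * ξ ^ (β⁻¹ - 1)) (g := fun η => Complex.exp (Complex.I * (psi β x t η : ℂ)))
    (fun ξ hξ => by
      rw [Set.uIcc_of_le hab] at hξ
      exact Real.hasDerivAt_rpow_const (Or.inl (ha.trans_le hξ.1).ne'))
    (by
      refine ContinuousOn.mul continuousOn_const ?_
      refine ContinuousOn.rpow_const continuousOn_id fun ξ hξ => ?_
      rw [Set.uIcc_of_le hab] at hξ
      exact Or.inl (ha.trans_le hξ.1).ne')
    (by have := psi_cont hβ0 x t; fun_prop)
  rw [← hcs] at hmain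
  have heq : ∫ ξ in a..b, (β⁻¹ * ξ ^ (β⁻¹ - 1)) • ((fun η => Complex.exp (Complex.I * (psi β x t η : ℂ))) ∘ fun ξ : ℝ => ξ ^ β⁻¹) ξ
      = (β⁻¹ : ℂ) * ∫ ξ in a..b, Complex.exp (Complex.I * ((x * ξ + t * omegaBO α ξ : ℝ) : ℂ)) * ((|ξ| ^ (α / 2) : ℝ) : ℂ) := by
    rw [← intervalIntegral.integral_const_mul]
    refine intervalIntegral.integral_congr fun ξ hξ => ?_
    rw [Set.uIcc_of_le hab] at hξ
    have hξ0 : 0 < ξ := ha.trans_le hξ.1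
    have h1 : psi β x t (ξ ^ β⁻¹) = x * ξ + t * omegaBO α ξ := by
      unfold psi omegaBO
      rw [← Real.rpow_mul hξ0.le, inv_mul_cancel₀ hβ0.ne', Real.rpow_one, ← Real.rpow_natCast, ← Real.rpow_mul hξ0.le,
        abs_of_pos hξ0, show β⁻¹ * ((2:ℕ):ℝ) = 1 + (1 + α) by rw [hβ]; push_cast; field_simp; ring, Real.rpow_add hξ0, Real.rpow_one]
      ring
    have h2 : β⁻¹ - 1 = α / 2 := by rw [hβ]; field_simp; ring
    simp only [Function.comp, h1, h2, abs_of_pos hξ0, Complex.real_smul]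
    push_cast; ring
  rw [heq, norm_mul] at hmain
  have h3 : 1 ≤ ‖(β⁻¹ : ℂ)‖ := by
    rw [norm_inv, Complex.norm_real, Real.norm_of_nonneg hβ0.le]
    exact (one_le_inv₀ hβ0).2 hβ1.le
  refine le_trans ?_ hmain
  exact le_mul_of_one_le_left (norm_nonneg _) h3

lemma disp {α : ℝ} (hα : 0 < α) (x : ℝ) {t : ℝ} (ht : t ≠ 0) {a b : ℝ} (ha : 0 < a) (hab : a ≤ b) :
    ‖∫ ξ in a..b, Complex.exp (Complex.I * ((x * ξ + t * omegaBO α ξ : ℝ) : ℂ)) * ((|ξ| ^ (α / 2) : ℝ) : ℂ)‖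
      ≤ 6 * |t| ^ (-(1 / 2) : ℝ) := by
  rcases lt_or_gt_of_ne ht with h | h
  · have := disp_pos hα (-x) (t := -t) (by linarith) ha hab
    rw [abs_of_neg h]
    refine le_trans (le_of_eq ?_) this
    rw [← Complex.norm_conj, intervalIntegral, intervalIntegral, Set.Ioc_eq_empty (not_lt.2 hab)]
    simp only [setIntegral_empty, sub_zero]
    rw [← integral_conj]
    congr 1
    refine integral_congr_ae (Filter.Eventually.of_forall fun ξ => ?_)
    simp only [map_mul, Complex.conj_ofReal]
    rw [← Complex.exp_conj]
    simp only [map_mul, Complex.conj_I, Complex.conj_ofReal]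
    congr 2
    push_cast; ring
  · rw [abs_of_pos h]; exact disp_pos hα x h ha hab


lemma TTs {X Z : Type*} [MeasurableSpace X] [MeasurableSpace Z] (μ : Measure X) (ν : Measure Z)
    [IsFiniteMeasure μ] [SFinite ν] {H : Z → X → ℂ} {G : Z → ℂ}
    (hH : Measurable fun w : Z × X => H w.1 w.2) (hGm : Measurable G) (hG : Integrable G ν)
    {B : ℝ} (hB : ∀ᵐ x ∂μ, ∀ z, ‖H z x‖ ≤ B) :
    ∫⁻ x, ‖∫ z, H z x * G z ∂ν‖ₑ ^ 2 ∂μ ≤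
      ∫⁻ z, ∫⁻ z', ‖G z‖ₑ * ‖G z'‖ₑ * ‖∫ x, H z x * (starRingEnd ℂ) (H z' x) ∂μ‖ₑ ∂ν ∂ν := by
  set T : X → Z × Z → ℂ := fun x p => (H p.1 x * G p.1) * (starRingEnd ℂ) (H p.2 x * G p.2) with hT
  have hcm : Measurable (starRingEnd ℂ) := Complex.continuous_conj.measurable
  have hTm : Measurable (Function.uncurry T) := by
    have h1 : Measurable fun w : X × (Z × Z) => H w.2.1 w.1 * G w.2.1 :=
      (hH.comp ((measurable_fst.comp measurable_snd).prodMk measurable_fst)).mul (hGm.comp (measurable_fst.comp measurable_snd))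
    have h2 : Measurable fun w : X × (Z × Z) => H w.2.2 w.1 * G w.2.2 :=
      (hH.comp ((measurable_snd.comp measurable_snd).prodMk measurable_fst)).mul (hGm.comp (measurable_snd.comp measurable_snd))
    exact h1.mul (hcm.comp h2)
  have hgg : Integrable (fun p : Z × Z => ‖G p.1‖ * ‖G p.2‖) (ν.prod ν) := hG.norm.mul_prod hG.norm
  have hTint : Integrable (Function.uncurry T) (μ.prod (ν.prod ν)) := by
    have h1 : Integrable (fun w : X × (Z × Z) => (B ^ 2) * (‖G w.2.1‖ * ‖G w.2.2‖)) (μ.prod (ν.prod ν)) :=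
      (integrable_const (μ := μ) (B ^ 2)).mul_prod hgg
    refine h1.mono' hTm.aestronglyMeasurable ?_
    have hB' : ∀ᵐ w ∂(μ.prod (ν.prod ν)), ∀ z, ‖H z w.1‖ ≤ B := Measure.quasiMeasurePreserving_fst.ae hB
    filter_upwards [hB'] with w hw
    simp only [hT, Function.uncurry, norm_mul, RCLike.norm_conj]
    have hB0 : 0 ≤ B := (norm_nonneg _).trans (hw w.2.1)
    calc _ ≤ (B * ‖G w.2.1‖) * (B * ‖G w.2.2‖) := by
          gcongr
          · exact hw _
          · exact hw _
      _ = _ := by ring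
  have hprod : ∀ x, ∫ p, T x p ∂(ν.prod ν) = ((‖∫ z, H z x * G z ∂ν‖ ^ 2 : ℝ) : ℂ) := by
    intro x
    simp only [hT]
    rw [Complex.ofReal_pow, ← Complex.mul_conj', ← integral_conj]
    erw [← integral_prod_mul]
  have hreal : Integrable (fun x => ‖∫ z, H z x * G z ∂ν‖ ^ 2) μ := by
    have := hTint.integral_prod_left
    simp only [Function.uncurry_apply_pair, hprod] at this
    exact this.re
  have hnn : ∀ x, 0 ≤ ‖∫ z, H z x * G z ∂ν‖ ^ 2 := fun ξ => by positivity
  have e1 : ∫⁻ x, ‖∫ z, H z x * G z ∂ν‖ₑ ^ 2 ∂μ =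
      ENNReal.ofReal (∫ x, ‖∫ z, H z x * G z ∂ν‖ ^ 2 ∂μ) := by
    rw [ofReal_integral_eq_lintegral_ofReal hreal (Filter.Eventually.of_forall hnn)]
    refine lintegral_congr fun ξ => ?_
    rw [ENNReal.ofReal_pow (by positivity), ofReal_norm]
  have e2 : ((∫ x, ‖∫ z, H z x * G z ∂ν‖ ^ 2 ∂μ : ℝ) : ℂ) =
      ∫ p : Z × Z, (G p.1 * (starRingEnd ℂ) (G p.2)) *
        ∫ x, H p.1 x * (starRingEnd ℂ) (H p.2 x) ∂μ ∂(ν.prod ν) := by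
    rw [← integral_complex_ofReal]
    simp_rw [← hprod]
    rw [integral_integral_swap hTint]
    refine integral_congr_ae (Filter.Eventually.of_forall fun p => ?_)
    simp only [hT]
    rw [← integral_const_mul]
    refine integral_congr_ae (Filter.Eventually.of_forall fun p => ?_)
    simp only [map_mul]; ring
  rw [e1]
  have e3 : (∫ x, ‖∫ z, H z x * G z ∂ν‖ ^ 2 ∂μ) = ‖((∫ x, ‖∫ z, H z x * G z ∂ν‖ ^ 2 ∂μ : ℝ) : ℂ)‖ := by
    rw [Complex.norm_real, Real.norm_of_nonneg (integral_nonneg hnn)]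
  rw [e3, ofReal_norm, e2]
  refine (enorm_integral_le_lintegral_enorm _).trans ?_
  have hIm : Measurable fun p : Z × Z => ∫ x, H p.1 x * (starRingEnd ℂ) (H p.2 x) ∂μ := by
    refine (StronglyMeasurable.integral_prod_right' (f := fun w : (Z × Z) × X => H w.1.1 w.2 * (starRingEnd ℂ) (H w.1.2 w.2)) ?_).measurable
    refine Measurable.stronglyMeasurable ?_
    exact (hH.comp ((measurable_fst.comp measurable_fst).prodMk measurable_snd)).mul
      (hcm.comp (hH.comp ((measurable_snd.comp measurable_fst).prodMk measurable_snd)))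
  have hmm := (((hGm.comp measurable_fst).mul (hcm.comp (hGm.comp measurable_snd))).mul hIm).enorm.aemeasurable (μ := ν.prod ν)
  refine (lintegral_prod _ hmm).trans_le ?_
  refine lintegral_mono fun x => lintegral_mono fun y => le_of_eq ?_
  simp only [enorm_mul, Function.comp, Pi.mul_apply]
  rw [show ‖(starRingEnd ℂ) (G y)‖ₑ = ‖G y‖ₑ by rw [← ofReal_norm, RCLike.norm_conj, ofReal_norm]]

lemma KK_mul_conj (α Y t x t' x' ξ : ℝ) : KK α Y t x ξ * (starRingEnd ℂ) (KK α Y t' x' ξ) =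
    Complex.exp (Complex.I * (((x - x') * ξ + (t - t') * omegaBO α ξ : ℝ) : ℂ)) * ((|ξ| ^ (α * Y) * |ξ| ^ (α * Y) : ℝ) : ℂ) := by
  unfold KK
  rw [map_mul, ← Complex.exp_conj]
  simp only [map_mul, Complex.conj_I, Complex.conj_ofReal]
  rw [show Complex.I * (((x - x') * ξ + (t - t') * omegaBO α ξ : ℝ) : ℂ) = Complex.I * ((x * ξ + t * omegaBO α ξ : ℝ) : ℂ)
    + -Complex.I * ((x' * ξ + t' * omegaBO α ξ : ℝ) : ℂ) by push_cast; ring, Complex.exp_add]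
  push_cast; ring

lemma disp_set {α : ℝ} (hα : 0 < α) (x : ℝ) {t : ℝ} (ht : t ≠ 0) {a b : ℝ} (ha : 0 < a) :
    ‖∫ ξ in Set.Icc a b, Complex.exp (Complex.I * ((x * ξ + t * omegaBO α ξ : ℝ) : ℂ)) * ((|ξ| ^ (α / 2) : ℝ) : ℂ)‖
      ≤ 6 * |t| ^ (-(1 / 2) : ℝ) := by
  rcases le_or_gt a b with hab | hab
  · have := disp hα x ht ha hab
    rwa [intervalIntegral.integral_of_le hab, ← integral_Icc_eq_integral_Ioc] at this
  · rw [Set.Icc_eq_empty (not_le.2 hab)]; simp; positivity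

lemma est_A {α : ℝ} (hα : 0 < α) : ∃ M : NNReal, Est α 1 (3 / 4) M := by
  obtain ⟨C, hC⟩ := hls (γ := 1 / 2) (by norm_num) (by norm_num)
  refine ⟨(6 * C) ^ (1 / 2 : ℝ), ?_⟩
  intro N hN f G hf hG
  have hfm := hf.meas
  have hGm := hG.meas
  set I := Set.Icc N⁻¹ N with hI
  have hN' : 0 < N⁻¹ := by positivity
  have hF1 : Fn (2 * (3 / 4) + 1 - 2) f = (∫⁻ ξ, ‖f ξ‖ₑ ^ 2) ^ (1 / 2 : ℝ) := by
    simp only [Fn]; norm_num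
  have hM1 : Mn 1 (3 / 4) G = (∫⁻ t, (∫⁻ x, ‖G (t, x)‖ₑ) ^ (4 / 3 : ℝ)) ^ (3 / 4 : ℝ) := by
    simp only [Mn]; norm_num
  rw [hF1, hM1, pair_eq1 hN hf hG]
  refine (enorm_integral_le_lintegral_enorm _).trans ?_
  simp only [enorm_mul]
  have hSm : Measurable fun ξ => ∫ z : ℝ × ℝ, KK α (1 - 3 / 4) z.1 z.2 ξ * G z := by
    refine (StronglyMeasurable.integral_prod_right' (f := fun w : ℝ × (ℝ × ℝ) => KK α (1 - 3 / 4) w.2.1 w.2.2 w.1 * G w.2) ?_).measurable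
    exact (by fun_prop : Measurable _).stronglyMeasurable
  have h1 : ∫⁻ ξ, ‖f ξ‖ₑ * ‖∫ z : ℝ × ℝ, KK α (1 - 3 / 4) z.1 z.2 ξ * G z‖ₑ =
      ∫⁻ ξ in I, ‖f ξ‖ₑ * ‖∫ z : ℝ × ℝ, KK α (1 - 3 / 4) z.1 z.2 ξ * G z‖ₑ := by
    rw [← lintegral_indicator measurableSet_Icc]
    refine lintegral_congr fun ξ => ?_
    by_cases h : ξ ∈ I
    · rw [Set.indicator_of_mem h]
    · rw [Set.indicator_of_notMem h, hf.supp ξ h]; simp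
  rw [h1]
  refine (cs_lint _ (by fun_prop) hSm.enorm.aemeasurable).trans ?_
  have h2 : ∫⁻ ξ in I, ‖∫ z : ℝ × ℝ, KK α (1 - 3 / 4) z.1 z.2 ξ * G z‖ₑ ^ 2 ≤
      6 * C * (∫⁻ t, (∫⁻ x, ‖G (t, x)‖ₑ) ^ (4 / 3 : ℝ)) ^ (3 / 2 : ℝ) := by
    have hT := TTs (volume.restrict I) (volume : Measure (ℝ × ℝ)) (H := fun z ξ => KK α (1 - 3 / 4) z.1 z.2 ξ) (G := G)
      (by fun_prop) hGm hG.integrable (B := N ^ (α * (1 - 3 / 4)) + N⁻¹ ^ (α * (1 - 3 / 4)))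
      (by
        filter_upwards [ae_restrict_mem measurableSet_Icc] with ξ hξ z
        rw [norm_KK]; exact rpow_bdd hN _ hξ)
    refine hT.trans ?_
    have hGs : ∀ t, ∫⁻ x, ‖G (t, x)‖ₑ ≠ ⊤ := by
      intro t
      obtain ⟨B, hB⟩ := hG.bdd
      have : ∫⁻ x, ‖G (t, x)‖ₑ ≤ ∫⁻ x, (Set.Icc (-N) N).indicator (fun _ => ENNReal.ofReal B) x := by
        refine lintegral_mono fun x => ?_
        by_cases hx : x ∈ Set.Icc (-N) N
        · rw [Set.indicator_of_mem hx, ← ofReal_norm]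
          exact ENNReal.ofReal_le_ofReal (hB _)
        · rw [hG.supp (t, x) (fun h => hx h.2)]; simp
      refine ne_top_of_le_ne_top ?_ this
      rw [lintegral_indicator measurableSet_Icc, lintegral_const]
      simp only [Measure.restrict_apply_univ, Real.volume_Icc]
      finiteness
    set n : ℝ → NNReal := fun t => (∫⁻ x, ‖G (t, x)‖ₑ).toNNReal with hn
    have hnm : Measurable fun t => ∫⁻ x, ‖G (t, x)‖ₑ :=
      Measurable.lintegral_prod_right' (f := fun z : ℝ × ℝ => ‖G z‖ₑ) (by fun_prop)
    have hnc : ∀ t, (n t : ℝ≥0∞) = ∫⁻ x, ‖G (t, x)‖ₑ := fun t => ENNReal.coe_toNNReal (hGs t)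
    have hh := hC n hnm.ennreal_toNNReal
    simp only [hnc] at hh
    norm_num at hh
    rw [mul_assoc]
    refine le_trans ?_ (mul_le_mul_right hh _)
    rw [← lintegral_const_mul' _ _ (by simp)]
    have hne : ∀ a : ℝ, ∀ᵐ ξ : ℝ, ξ ≠ a := fun a => by simp [ae_iff]
    rw [Measure.volume_eq_prod]
    have hker : ∀ z z' : ℝ × ℝ, z.1 ≠ z'.1 → ‖∫ ξ in I, KK α (1 - 3 / 4) z.1 z.2 ξ * (starRingEnd ℂ) (KK α (1 - 3 / 4) z'.1 z'.2 ξ)‖ₑ ≤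
        6 * ENNReal.ofReal (|z.1 - z'.1| ^ (-(1 / 2) : ℝ)) := by
      intro z z' hzz
      simp only [KK_mul_conj]
      have := disp_set hα (z.2 - z'.2) (sub_ne_zero.2 hzz) (b := N) hN'
      rw [← ofReal_norm, show (6 : ℝ≥0∞) = ENNReal.ofReal 6 by simp, ← ENNReal.ofReal_mul (by norm_num)]
      refine ENNReal.ofReal_le_ofReal (le_trans (le_of_eq ?_) this)
      congr 1
      refine setIntegral_congr_fun measurableSet_Icc fun ξ hξ => ?_
      have hξ0 : 0 < |ξ| := abs_pos.2 (hN'.trans_le hξ.1).ne'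
      rw [← Real.rpow_add hξ0]
      congr 4; ring
    refine (lintegral_prod_le _).trans ?_
    refine lintegral_mono fun t => ?_
    simp only
    calc _ ≤ ∫⁻ x : ℝ, ‖G (t, x)‖ₑ * ∫⁻ t' : ℝ, 6 * ENNReal.ofReal (|t - t'| ^ (-(1 / 2) : ℝ)) * ∫⁻ x', ‖G (t', x')‖ₑ := by
          refine lintegral_mono fun x => ?_
          refine (lintegral_prod_le _).trans ?_
          rw [← lintegral_const_mul _ (by fun_prop)]
          refine lintegral_mono_ae ?_
          filter_upwards [hne t] with t' ht'
          rw [← lintegral_const_mul _ (by fun_prop), ← lintegral_const_mul _ (by fun_prop)]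
          refine lintegral_mono fun x' => ?_
          refine (mul_le_mul_right (hker (t, x) (t', x') ht'.symm) _).trans (le_of_eq ?_)
          ring
      _ = _ := by
          rw [lintegral_mul_const _ (by fun_prop), ← lintegral_const_mul _ (by fun_prop),  ← lintegral_const_mul _ (by fun_prop)]
          refine lintegral_congr fun t' => ?_
          simp only [one_div]
          ring
  calc _ ≤ (∫⁻ ξ, ‖f ξ‖ₑ ^ 2) ^ (1 / 2 : ℝ) * (6 * C * (∫⁻ t, (∫⁻ x, ‖G (t, x)‖ₑ) ^ (4 / 3 : ℝ)) ^ (3 / 2 : ℝ)) ^ (1 / 2 : ℝ) := by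
        gcongr
        exact Measure.restrict_le_self
    _ = _ := by
        rw [ENNReal.mul_rpow_of_nonneg _ _ (by norm_num), ← ENNReal.rpow_mul, ENNReal.coe_rpow_of_nonneg _ (by norm_num)]
        norm_num
        ring


lemma NiceG.slice {N : ℝ} {G : ℝ × ℝ → ℂ} (hG : NiceG N G) (t : ℝ) : Integrable fun x => G (t, x) := by
  have hGm := hG.meas
  obtain ⟨B, hB⟩ := hG.bdd
  have : IntegrableOn (fun x => G (t, x)) (Set.Icc (-N) N) :=
    Measure.integrableOn_of_bounded (M := B) (by simp) (by fun_prop : Measurable _).aestronglyMeasurable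
      (Filter.Eventually.of_forall fun x => hB _)
  exact (integrableOn_iff_integrable_of_support_subset (fun x hx => by
      by_contra h'; exact hx (hG.supp (t, x) fun h'' => h' h''.2))).1 this

/-- two-dimensional Fourier integral -/
noncomputable def WW (w : ℝ × ℝ → ℂ) (τ k : ℝ) : ℂ :=
  ∫ z : ℝ × ℝ, Complex.exp (Complex.I * ((z.1 * τ + z.2 * k : ℝ) : ℂ)) * w z

lemma measurable_WW {w : ℝ × ℝ → ℂ} (hw : Measurable w) : Measurable fun p : ℝ × ℝ => WW w p.1 p.2 := by
  unfold WW
  refine (StronglyMeasurable.integral_prod_right' (f := fun q : (ℝ × ℝ) × (ℝ × ℝ) =>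
    Complex.exp (Complex.I * ((q.2.1 * q.1.1 + q.2.2 * q.1.2 : ℝ) : ℂ)) * w q.2) ?_).measurable
  exact (by fun_prop : Measurable _).stronglyMeasurable

lemma measurable_FT2 {w : ℝ × ℝ → ℂ} (hw : Measurable w) : Measurable fun p : ℝ × ℝ => FT (fun x => w (p.1, x)) p.2 := by
  unfold FT
  refine (StronglyMeasurable.integral_prod_right' (f := fun q : (ℝ × ℝ) × ℝ =>
    Complex.exp (Complex.I * ((q.2 * q.1.2 : ℝ) : ℂ)) * w (q.1.1, q.2)) ?_).measurable
  exact (by fun_prop : Measurable _).stronglyMeasurable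

lemma WW_integrable {w : ℝ × ℝ → ℂ} (hwm : Measurable w) (hw : Integrable w) (τ k : ℝ) :
    Integrable fun z : ℝ × ℝ => Complex.exp (Complex.I * ((z.1 * τ + z.2 * k : ℝ) : ℂ)) * w z := by
  refine hw.congr' (by fun_prop : Measurable _).aestronglyMeasurable ?_
  exact Filter.Eventually.of_forall fun z => by rw [norm_mul, norm_expI, one_mul]

lemma WW_eq {w : ℝ × ℝ → ℂ} (hwm : Measurable w) (hw : Integrable w) (τ k : ℝ) :
    WW w τ k = FT (fun t => FT (fun x => w (t, x)) k) τ := by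
  unfold WW FT
  rw [Measure.volume_eq_prod, integral_prod _ (WW_integrable hwm hw τ k)]
  refine integral_congr_ae (Filter.Eventually.of_forall fun t => ?_)
  simp only
  rw [← integral_const_mul]
  refine integral_congr_ae (Filter.Eventually.of_forall fun x => ?_)
  simp only
  rw [Complex.ofReal_add, mul_add, Complex.exp_add]; ring

lemma WW_planch {w : ℝ × ℝ → ℂ} (hwm : Measurable w) (hw : Integrable w) (k : ℝ) :
    ∫⁻ τ, ‖WW w τ k‖ₑ ^ 2 ≤ ENNReal.ofReal (2 * Real.pi) * ∫⁻ t, ‖FT (fun x => w (t, x)) k‖ₑ ^ 2 := by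
  simp only [WW_eq hwm hw]
  refine planch ((measurable_FT2 hwm).comp (measurable_id.prodMk measurable_const)) ?_
  have := (WW_integrable hwm hw 0 k).integral_prod_left
  simpa [FT] using this

lemma omega_deriv {α ξ : ℝ} (hα : 0 < α) (hξ : 0 < ξ) : HasDerivAt (omegaBO α) (-((2 + α) * ξ ^ (1 + α))) ξ := by
  have h1 : HasDerivAt (fun y : ℝ => - (y ^ (2 + α))) (-((2 + α) * ξ ^ (2 + α - 1))) ξ :=
    (Real.hasDerivAt_rpow_const (Or.inl hξ.ne')).neg
  rw [show 2 + α - 1 = 1 + α by ring] at h1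
  refine h1.congr_of_eventuallyEq ?_
  filter_upwards [lt_mem_nhds hξ] with y hy
  unfold omegaBO
  rw [abs_of_pos hy, show 2 + α = 1 + (1 + α) by ring, Real.rpow_add hy 1 (1 + α), Real.rpow_one]; ring

lemma pow_gap {α a b : ℝ} (hα : 0 < α) (hb : 0 < b) (hab : b < a) :
    (a - b) * (a ^ (α / 2) * b ^ (α / 2)) ≤ a ^ (1 + α) - b ^ (1 + α) := by
  have ha : 0 < a := hb.trans hab
  rw [Real.rpow_add ha, Real.rpow_add hb, Real.rpow_one, Real.rpow_one]
  have h1 : b ^ (α / 2) ≤ a ^ (α / 2) := Real.rpow_le_rpow hb.le hab.le (by positivity)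
  have ea : a ^ α = a ^ (α / 2) * a ^ (α / 2) := by rw [← Real.rpow_add ha]; congr 1; ring
  have eb : b ^ α = b ^ (α / 2) * b ^ (α / 2) := by rw [← Real.rpow_add hb]; congr 1; ring
  rw [ea, eb]
  have hb0 : 0 < b ^ (α / 2) := by positivity
  set u := a ^ (α / 2)
  set v := b ^ (α / 2)
  nlinarith [mul_nonneg ha.le (mul_nonneg (hb0.le.trans h1) (sub_nonneg.2 h1)),
    mul_nonneg hb.le (mul_nonneg hb0.le (sub_nonneg.2 h1))]

lemma gap_abs {α a b : ℝ} (hα : 0 < α) (ha : 0 < a) (hb : 0 < b) :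
    |a - b| * (a ^ (α / 2) * b ^ (α / 2)) ≤ |(-((2 + α) * a ^ (1 + α))) - (-((2 + α) * b ^ (1 + α)))| := by
  have key : ∀ a b : ℝ, 0 < b → b < a → |a - b| * (a ^ (α / 2) * b ^ (α / 2)) ≤ |(-((2 + α) * a ^ (1 + α))) - (-((2 + α) * b ^ (1 + α)))| := by
    intro a b hb hab
    have h1 := pow_gap hα hb hab
    have ha : 0 < a := hb.trans hab
    have h0 : 0 ≤ (a - b) * (a ^ (α / 2) * b ^ (α / 2)) := mul_nonneg (by linarith) (by positivity)
    rw [abs_of_pos (by linarith : 0 < a - b)]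
    refine le_trans ?_ (neg_le_abs _)
    nlinarith
  rcases lt_trichotomy a b with h | h | h
  · rw [abs_sub_comm a b, abs_sub_comm (-((2 + α) * a ^ (1 + α))), mul_comm (a ^ (α / 2))]
    exact key b a ha h
  · rw [h]; simp
  · exact key a b hb h

lemma omega_change {α k : ℝ} (hα : 0 < α) (hk : k ≠ 0) {g : ℝ → ℝ≥0∞} :
    ∫⁻ η in Set.Ioi (max 0 k), ENNReal.ofReal (|k| * (η ^ (α / 2) * (η - k) ^ (α / 2))) * g (omegaBO α η - omegaBO α (η - k))
      ≤ ∫⁻ τ, g τ := by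
  set s := Set.Ioi (max 0 k) with hs
  have hp : ∀ η ∈ s, 0 < η ∧ 0 < η - k := by
    intro η hη
    have := max_lt_iff.1 (show max 0 k < η from hη)
    exact ⟨this.1, by linarith [this.2]⟩
  set D : ℝ → ℝ := fun η => (-((2 + α) * η ^ (1 + α))) - (-((2 + α) * (η - k) ^ (1 + α))) with hD
  have hd : ∀ η ∈ s, HasDerivAt (fun η => omegaBO α η - omegaBO α (η - k)) (D η) η := by
    intro η hη
    have h1 := omega_deriv hα (hp η hη).1
    have h2 := (omega_deriv hα (hp η hη).2).comp_sub_const η k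
    exact h1.sub h2
  have hc : ContinuousOn (fun η => omegaBO α η - omegaBO α (η - k)) s := fun η hη => (hd η hη).continuousAt.continuousWithinAt
  have hinj : Set.InjOn (fun η => omegaBO α η - omegaBO α (η - k)) s := by
    rcases lt_or_gt_of_ne hk with h | h
    · refine (strictMonoOn_of_deriv_pos (convex_Ioi _) hc fun η hη => ?_).injOn
      rw [interior_Ioi] at hη
      rw [(hd η hη).deriv]
      have := hp η hη
      have h3 : η ^ (1 + α) < (η - k) ^ (1 + α) := Real.rpow_lt_rpow this.1.le (by linarith) (by linarith)
      simp only [hD]; nlinarith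
    · refine (strictAntiOn_of_deriv_neg (convex_Ioi _) hc fun η hη => ?_).injOn
      rw [interior_Ioi] at hη
      rw [(hd η hη).deriv]
      have := hp η hη
      have h3 : (η - k) ^ (1 + α) < η ^ (1 + α) := Real.rpow_lt_rpow this.2.le (by linarith) (by linarith)
      simp only [hD]; nlinarith
  have := lintegral_image_eq_lintegral_abs_deriv_mul measurableSet_Ioi (fun η hη => (hd η hη).hasDerivWithinAt) hinj g
  calc _ ≤ ∫⁻ η in s, ENNReal.ofReal |D η| * g (omegaBO α η - omegaBO α (η - k)) := by
        refine setLIntegral_mono' measurableSet_Ioi fun η hη => ?_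
        have h1 := gap_abs hα (hp η hη).1 (hp η hη).2
        rw [_root_.sub_sub_cancel] at h1
        exact mul_le_mul_left (ENNReal.ofReal_le_ofReal h1) _
    _ = _ := this.symm
    _ ≤ _ := setLIntegral_le_lintegral _ _

set_option maxHeartbeats 2000000 in
lemma edge_bil {α γ : ℝ} (hα : 0 < α) (hγ0 : 0 < γ) (hγ1 : γ < 1) : ∃ C : NNReal, ∀ N : ℝ, 0 < N →
    ∀ w : ℝ × ℝ → ℂ, NiceG N w →
    ∫⁻ η in Set.Ioi (0:ℝ), ∫⁻ ξ in Set.Ioi (0:ℝ), ENNReal.ofReal (η ^ (α / 2) * ξ ^ (α / 2)) *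
      ‖WW w (omegaBO α η - omegaBO α ξ) (η - ξ)‖ₑ ^ 2 * ENNReal.ofReal (|η - ξ| ^ γ) ≤
      C * ∫⁻ t, (∫⁻ x, ‖w (t, x)‖ₑ ^ (2 / (2 - γ))) ^ (2 - γ) := by
  obtain ⟨C, hC⟩ := pitt hγ0 hγ1
  refine ⟨(2 * Real.pi).toNNReal * C, fun N hN w hw => ?_⟩
  have hwm := hw.meas
  have hwi := hw.integrable
  have hWm := measurable_WW hwm
  have hom := measurable_omegaBO α
  have hFTm := measurable_FT2 hwm
  set Φ : ℝ → ℝ → ℝ≥0∞ := fun η ξ => ENNReal.ofReal (η ^ (α / 2) * ξ ^ (α / 2)) *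
      ‖WW w (omegaBO α η - omegaBO α ξ) (η - ξ)‖ₑ ^ 2 * ENNReal.ofReal (|η - ξ| ^ γ) with hΦ
  have hΦm : Measurable fun p : ℝ × ℝ => Φ p.1 p.2 := by
    have : Measurable fun p : ℝ × ℝ => WW w (omegaBO α p.1 - omegaBO α p.2) (p.1 - p.2) :=
      hWm.comp ((by fun_prop : Measurable fun p : ℝ × ℝ => omegaBO α p.1 - omegaBO α p.2).prodMk (by fun_prop : Measurable fun p : ℝ × ℝ => p.1 - p.2))
    have h1 : Measurable fun p : ℝ × ℝ => ENNReal.ofReal (p.1 ^ (α / 2) * p.2 ^ (α / 2)) := by fun_prop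
    have h2 : Measurable fun p : ℝ × ℝ => ENNReal.ofReal (|p.1 - p.2| ^ γ) := by fun_prop
    exact (h1.mul (this.enorm.pow_const 2)).mul h2
  have hne : ∀ a : ℝ, ∀ᵐ ξ : ℝ, ξ ≠ a := fun a => by simp [ae_iff]
  calc ∫⁻ η in Set.Ioi (0:ℝ), ∫⁻ ξ in Set.Ioi (0:ℝ), Φ η ξ
      = ∫⁻ η, ∫⁻ ξ, (Set.Ioi (0:ℝ)).indicator 1 η * ((Set.Ioi (0:ℝ)).indicator 1 ξ * Φ η ξ) := by
        rw [← lintegral_indicator measurableSet_Ioi]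
        refine lintegral_congr fun η => ?_
        by_cases h : η ∈ Set.Ioi (0:ℝ)
        · simp only [Set.indicator_of_mem h, Pi.one_apply, one_mul]
          rw [← lintegral_indicator measurableSet_Ioi]
          refine lintegral_congr fun ξ => ?_
          by_cases h : ξ ∈ Set.Ioi (0:ℝ)
          · simp only [Set.indicator_of_mem h, Pi.one_apply, one_mul]
          · simp only [Set.indicator_of_notMem h, zero_mul]
        · simp only [Set.indicator_of_notMem h, zero_mul, lintegral_zero]
    _ = ∫⁻ η, ∫⁻ k, (Set.Ioi (0:ℝ)).indicator 1 η * ((Set.Ioi (0:ℝ)).indicator 1 (η - k) * Φ η (η - k)) := by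
        refine lintegral_congr fun η => ?_
        rw [lintegral_sub_left_eq_self (μ := (volume : Measure ℝ)) (fun ξ => (Set.Ioi (0:ℝ)).indicator 1 η * ((Set.Ioi (0:ℝ)).indicator 1 ξ * Φ η ξ)) η]
    _ = ∫⁻ k, ∫⁻ η, (Set.Ioi (0:ℝ)).indicator 1 η * ((Set.Ioi (0:ℝ)).indicator 1 (η - k) * Φ η (η - k)) := by
        refine lintegral_lintegral_swap ?_
        simp only [Function.uncurry_def]
        have h1 : Measurable ((Set.Ioi (0:ℝ)).indicator (1 : ℝ → ℝ≥0∞)) := measurable_one.indicator measurableSet_Ioi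
        have h2 : Measurable fun p : ℝ × ℝ => Φ p.1 (p.1 - p.2) :=
          hΦm.comp (measurable_fst.prodMk (measurable_fst.sub measurable_snd))
        exact ((h1.comp measurable_fst).mul ((h1.comp (measurable_fst.sub measurable_snd)).mul h2)).aemeasurable
    _ = ∫⁻ k, ∫⁻ η in Set.Ioi (max 0 k), Φ η (η - k) := by
        refine lintegral_congr fun k => ?_
        rw [← lintegral_indicator measurableSet_Ioi]
        refine lintegral_congr fun η => ?_
        by_cases h : η ∈ Set.Ioi (max 0 k)
        · have := max_lt_iff.1 (show max 0 k < η from h)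
          rw [Set.indicator_of_mem h, Set.indicator_of_mem (show η ∈ Set.Ioi (0:ℝ) from this.1),
            Set.indicator_of_mem (show η - k ∈ Set.Ioi (0:ℝ) from sub_pos.2 this.2)]
          simp
        · rw [Set.indicator_of_notMem h]
          by_cases h1 : η ∈ Set.Ioi (0:ℝ)
          · have h2 : η - k ∉ Set.Ioi (0:ℝ) := fun h2 => h (show max 0 k < η from max_lt h1 (sub_pos.1 h2))
            rw [Set.indicator_of_notMem h2]; simp
          · rw [Set.indicator_of_notMem h1]; simp
    _ ≤ ∫⁻ k, ENNReal.ofReal (|k| ^ (γ - 1)) * ∫⁻ τ, ‖WW w τ k‖ₑ ^ 2 := by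
        refine lintegral_mono_ae ?_
        filter_upwards [hne 0] with k hk
        have hk0 : 0 < |k| := abs_pos.2 hk
        refine le_trans ?_ (mul_le_mul_right (omega_change (α := α) hα hk (g := fun τ => ‖WW w τ k‖ₑ ^ 2)) _)
        rw [← lintegral_const_mul' _ _ ENNReal.ofReal_ne_top]
        refine setLIntegral_mono' measurableSet_Ioi fun η hη => le_of_eq ?_
        have := max_lt_iff.1 (show max 0 k < η from hη)
        have h1 : 0 < η := this.1
        have h2 : 0 < η - k := sub_pos.2 this.2
        simp only [hΦ, _root_.sub_sub_cancel]
        rw [← mul_assoc, ← ENNReal.ofReal_mul (by positivity), mul_right_comm, ← ENNReal.ofReal_mul (by positivity)]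
        congr 2
        rw [Real.rpow_sub_one hk0.ne']; field_simp
    _ ≤ ∫⁻ k, ENNReal.ofReal (|k| ^ (γ - 1)) * (ENNReal.ofReal (2 * Real.pi) * ∫⁻ t, ‖FT (fun x => w (t, x)) k‖ₑ ^ 2) := by
        refine lintegral_mono fun k => ?_
        exact mul_le_mul_right (WW_planch hwm hwi k) _
    _ = ENNReal.ofReal (2 * Real.pi) * ∫⁻ t, ∫⁻ k, ‖FT (fun x => w (t, x)) k‖ₑ ^ 2 * ENNReal.ofReal (|k| ^ (γ - 1)) := by
        rw [lintegral_lintegral_swap (by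
          simp only [Function.uncurry_def]
          fun_prop), ← lintegral_const_mul' _ _ ENNReal.ofReal_ne_top]
        refine lintegral_congr fun k => ?_
        have : Measurable fun t => FT (fun x => w (t, x)) k := hFTm.comp (measurable_id.prodMk measurable_const)
        rw [lintegral_mul_const _ (by fun_prop)]; ring
    _ ≤ ENNReal.ofReal (2 * Real.pi) * ∫⁻ t, C * (∫⁻ x, ‖w (t, x)‖ₑ ^ (2 / (2 - γ))) ^ (2 - γ) := by
        refine mul_le_mul_right (lintegral_mono fun t => ?_) _
        exact hC _ (by fun_prop) (hw.slice t)
    _ = _ := by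
        rw [lintegral_const_mul' _ _ (by simp), ← mul_assoc]; push_cast; rfl


lemma setLIntegral_eq_of_zero {X : Type*} [MeasurableSpace X] {μ : Measure X} {s : Set X} (hs : MeasurableSet s)
    {F : X → ℝ≥0∞} (h : ∀ x, x ∉ s → F x = 0) : ∫⁻ x in s, F x ∂μ = ∫⁻ x, F x ∂μ := by
  rw [← lintegral_indicator hs]
  refine lintegral_congr fun x => ?_
  by_cases hx : x ∈ s
  · rw [Set.indicator_of_mem hx]
  · rw [Set.indicator_of_notMem hx, h x hx]

set_option maxHeartbeats 1000000 in
lemma edge_sq {α γ : ℝ} (hα : 0 < α) (hγ0 : 0 < γ) (hγ1 : γ < 1) : ∃ C : NNReal, ∀ N : ℝ, 0 < N →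
    ∀ (f : ℝ → ℂ) (w : ℝ × ℝ → ℝ), NiceF N f → (∀ z, 0 ≤ w z) → Measurable w → NiceG N (fun z => (w z : ℂ)) →
    ∫⁻ z : ℝ × ℝ, ‖∫ ξ, KK α (1 / 4) z.1 z.2 ξ * f ξ‖ₑ ^ 2 * ‖(w z : ℂ)‖ₑ ≤
      C * Fn ((2 - γ) / 4) f ^ 2 * (∫⁻ t, (∫⁻ x, ‖(w (t, x) : ℂ)‖ₑ ^ (2 / (2 - γ))) ^ (2 - γ)) ^ (1 / 2 : ℝ) := by
  obtain ⟨C1, hC1⟩ := hls hγ0 hγ1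
  obtain ⟨C2, hC2⟩ := edge_bil hα hγ0 hγ1
  refine ⟨C1 ^ (1 / 2 : ℝ) * C2 ^ (1 / 2 : ℝ), fun N hN f w hf hw0 hwm hw => ?_⟩
  have hfm := hf.meas
  have hom := measurable_omegaBO α
  have hN' : 0 < N⁻¹ := by positivity
  set S : Set (ℝ × ℝ) := Set.Icc (-N) N ×ˢ Set.Icc (-N) N with hS
  have hSm : MeasurableSet S := measurableSet_Icc.prod measurableSet_Icc
  have hSf : volume S < ⊤ := by
    rw [hS, Measure.volume_eq_prod, Measure.prod_prod, Real.volume_Icc]; finiteness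
  set g : ℝ → ℂ := fun ξ => ((|ξ| ^ (α * (1 / 4)) : ℝ) : ℂ) * f ξ with hg
  have hgN : NiceF N g := hf.weight hN _
  have hgm := hgN.meas
  set H : ℝ → ℝ × ℝ → ℂ := fun ξ z => ((Real.sqrt (w z) : ℝ) : ℂ) * KK α 0 z.1 z.2 ξ with hH
  obtain ⟨B, hB⟩ := hw.bdd
  have hwz : ∀ z, z ∉ S → w z = 0 := fun z hz => by exact_mod_cast hw.supp z hz
  have hWm := measurable_WW hw.meas
  set W : ℝ × ℝ → ℝ≥0∞ := fun p => ‖WW (fun z => (w z : ℂ)) (omegaBO α p.1 - omegaBO α p.2) (p.1 - p.2)‖ₑ with hW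
  have hWWm : Measurable W := by
    exact (hWm.comp ((by fun_prop : Measurable fun p : ℝ × ℝ => omegaBO α p.1 - omegaBO α p.2).prodMk (by fun_prop : Measurable fun p : ℝ × ℝ => p.1 - p.2))).enorm
  haveI : IsFiniteMeasure (volume.restrict S) := ⟨by simpa using hSf⟩
  have hT := TTs (volume.restrict S) (volume : Measure ℝ) (H := H) (G := g)
    (by simp only [hH]; fun_prop) hgm hgN.integrable (B := Real.sqrt B)
    (Filter.Eventually.of_forall fun z ξ => by
      simp only [hH]
      rw [norm_mul, norm_KK, mul_zero, Real.rpow_zero, mul_one, Complex.norm_real, Real.norm_of_nonneg (Real.sqrt_nonneg _)]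
      refine Real.sqrt_le_sqrt ?_
      have := hB z
      simp only [Complex.norm_real] at this
      exact (le_abs_self _).trans this)
  have e1 : ∫⁻ z : ℝ × ℝ, ‖∫ ξ, KK α (1 / 4) z.1 z.2 ξ * f ξ‖ₑ ^ 2 * ‖(w z : ℂ)‖ₑ =
      ∫⁻ z in S, ‖∫ ξ, H ξ z * g ξ‖ₑ ^ 2 := by
    rw [setLIntegral_eq_of_zero hSm]
    · refine lintegral_congr fun z => ?_
      have : ∀ ξ, H ξ z * g ξ = ((Real.sqrt (w z) : ℝ) : ℂ) * (KK α (1 / 4) z.1 z.2 ξ * f ξ) := by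
        intro ξ
        simp only [hH, hg, KK, mul_zero, Real.rpow_zero, Complex.ofReal_one, mul_one]; ring
      simp only [this]
      rw [integral_const_mul, enorm_mul, mul_pow, mul_comm]
      congr 1
      rw [← enorm_pow, ← Complex.ofReal_pow, Real.sq_sqrt (hw0 z)]
    · intro z hz
      simp [hH, hwz z hz]
  rw [e1]
  refine hT.trans ?_
  have e2 : ∀ ξ ξ', ‖∫ z in S, H ξ z * (starRingEnd ℂ) (H ξ' z)‖ₑ = W (ξ, ξ') := by
    intro ξ ξ'
    simp only [hW, WW]
    rw [setIntegral_eq_integral_of_forall_compl_eq_zero (fun z hz => by simp [hH, hwz z hz])]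
    congr 2
    funext z
    simp only [hH, KK, mul_zero, Real.rpow_zero, Complex.ofReal_one, mul_one]
    rw [map_mul, ← Complex.exp_conj]
    simp only [map_mul, Complex.conj_I, Complex.conj_ofReal]
    rw [show Complex.I * ((z.1 * (omegaBO α ξ - omegaBO α ξ') + z.2 * (ξ - ξ') : ℝ) : ℂ) = Complex.I * ((z.2 * ξ + z.1 * omegaBO α ξ : ℝ) : ℂ)
      + -Complex.I * ((z.2 * ξ' + z.1 * omegaBO α ξ' : ℝ) : ℂ) by push_cast; ring, Complex.exp_add]
    have : ((w z : ℝ) : ℂ) = ((Real.sqrt (w z) : ℝ) : ℂ) * ((Real.sqrt (w z) : ℝ) : ℂ) := by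
      rw [← Complex.ofReal_mul, Real.mul_self_sqrt (hw0 z)]
    rw [this]; ring
  simp only [e2]
  set I := Set.Ioi (0:ℝ) with hI
  have hIm : MeasurableSet I := measurableSet_Ioi
  have hgz : ∀ ξ, ξ ∉ I → g ξ = 0 := fun ξ hξ => hgN.supp ξ fun h => hξ (lt_of_lt_of_le hN' h.1)
  set U : ℝ × ℝ → ℝ≥0∞ := fun p => ‖f p.1‖ₑ * ‖f p.2‖ₑ * ENNReal.ofReal (|p.1 - p.2| ^ (-γ / 2)) with hU
  set V : ℝ × ℝ → ℝ≥0∞ := fun p => ENNReal.ofReal (p.1 ^ (α / 4) * p.2 ^ (α / 4)) * W p * ENNReal.ofReal (|p.1 - p.2| ^ (γ / 2)) with hV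
  have hUm : Measurable U := by simp only [hU]; fun_prop
  have hVm : Measurable V := by simp only [hV]; fun_prop
  have hne : ∀ a : ℝ, ∀ᵐ ξ : ℝ, ξ ≠ a := fun a => by simp [ae_iff]
  calc ∫⁻ ξ, ∫⁻ ξ', ‖g ξ‖ₑ * ‖g ξ'‖ₑ * W (ξ, ξ')
      = ∫⁻ ξ in I, ∫⁻ ξ' in I, ‖g ξ‖ₑ * ‖g ξ'‖ₑ * W (ξ, ξ') := by
        rw [setLIntegral_eq_of_zero hIm (fun ξ hξ => by simp [hgz ξ hξ])]
        refine lintegral_congr fun ξ => ?_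
        rw [setLIntegral_eq_of_zero hIm (fun ξ hξ => by simp [hgz ξ hξ])]
    _ ≤ ∫⁻ ξ in I, ∫⁻ ξ' in I, U (ξ, ξ') * V (ξ, ξ') := by
        refine setLIntegral_mono' hIm fun ξ hξ => ?_
        refine lintegral_mono_ae ?_
        filter_upwards [ae_restrict_mem hIm, ae_restrict_of_ae (hne ξ)] with ξ' hξ' hne'
        have h0 : 0 < ξ := hξ
        have h0' : 0 < ξ' := hξ'
        have h1 : 0 < |ξ - ξ'| := abs_pos.2 (sub_ne_zero.2 hne'.symm)
        have h2 : ENNReal.ofReal (|ξ - ξ'| ^ (-γ / 2)) * ENNReal.ofReal (|ξ - ξ'| ^ (γ / 2)) = 1 := by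
          rw [← ENNReal.ofReal_mul (by positivity), ← Real.rpow_add h1]
          rw [show -γ / 2 + γ / 2 = 0 by ring]; simp
        have h3 : ∀ ξ : ℝ, 0 < ξ → ‖g ξ‖ₑ = ENNReal.ofReal (ξ ^ (α / 4)) * ‖f ξ‖ₑ := by
          intro ξ h
          simp only [hg]
          rw [enorm_mul, ← ofReal_norm, Complex.norm_real, Real.norm_of_nonneg (by positivity), abs_of_pos h]
          congr 4; ring
        simp only [hU, hV]
        rw [h3 ξ h0, h3 ξ' h0', ENNReal.ofReal_mul (by positivity)]
        refine le_of_eq ?_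
        calc _ = (ENNReal.ofReal (ξ ^ (α / 4)) * ‖f ξ‖ₑ * (ENNReal.ofReal (ξ' ^ (α / 4)) * ‖f ξ'‖ₑ) * W (ξ, ξ')) * 1 := by ring
          _ = _ := by rw [← h2]; ring
    _ = ∫⁻ p, U p * V p ∂((volume.restrict I).prod (volume.restrict I)) := by
        rw [lintegral_prod _ (by fun_prop)]
    _ ≤ (∫⁻ p, U p ^ 2 ∂((volume.restrict I).prod (volume.restrict I))) ^ (1 / 2 : ℝ) *
        (∫⁻ p, V p ^ 2 ∂((volume.restrict I).prod (volume.restrict I))) ^ (1 / 2 : ℝ) := cs_lint _ hUm.aemeasurable hVm.aemeasurable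
    _ ≤ (C1 * Fn ((2 - γ) / 4) f ^ (4:ℝ)) ^ (1 / 2 : ℝ) * (C2 * ∫⁻ t, (∫⁻ x, ‖(w (t, x) : ℂ)‖ₑ ^ (2 / (2 - γ))) ^ (2 - γ)) ^ (1 / 2 : ℝ) := by
        gcongr
        · rw [lintegral_prod _ (by fun_prop)]
          have hh := hC1 (fun ξ => ‖f ξ‖₊ ^ 2) (by fun_prop)
          have h5 : (∫⁻ y, ((‖f y‖₊ ^ 2 : NNReal) : ℝ≥0∞) ^ (2 / (2 - γ))) ^ (2 - γ) = Fn ((2 - γ) / 4) f ^ (4:ℝ) := by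
            unfold Fn
            rw [← ENNReal.rpow_mul]
            congr 1
            · refine lintegral_congr fun ξ => ?_
              rw [ENNReal.coe_pow, ← ENNReal.rpow_natCast, ← ENNReal.rpow_mul]
              congr 1
              have : 2 - γ ≠ 0 := by linarith
              push_cast; field_simp; norm_num
            · ring
          rw [h5] at hh
          refine le_trans ?_ hh
          refine (setLIntegral_le_lintegral _ _).trans (lintegral_mono fun ξ => ?_)
          refine (setLIntegral_le_lintegral _ _).trans (lintegral_mono fun ξ' => ?_)
          simp only [hU]
          rw [mul_pow, mul_pow, ← ENNReal.ofReal_pow (by positivity), ← Real.rpow_natCast, ← Real.rpow_mul (abs_nonneg _)]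
          rw [show -γ / 2 * ((2:ℕ):ℝ) = -γ by push_cast; ring]
          simp only [ENNReal.coe_pow]
          exact le_rfl
        · rw [lintegral_prod _ (by fun_prop)]
          refine le_trans (le_of_eq ?_) (hC2 N hN _ hw)
          refine setLIntegral_congr_fun hIm fun ξ hξ => ?_
          refine setLIntegral_congr_fun hIm fun ξ' hξ' => ?_
          have h0 : 0 < ξ := hξ
          have h0' : 0 < ξ' := hξ'
          simp only [hV, hW]
          rw [mul_pow, mul_pow, ← ENNReal.ofReal_pow (by positivity), ← ENNReal.ofReal_pow (by positivity), mul_pow,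
            ← Real.rpow_mul_natCast (by positivity), ← Real.rpow_mul_natCast (by positivity), ← Real.rpow_mul_natCast (by positivity)]
          rw [show α / 4 * ((2:ℕ):ℝ) = α / 2 by push_cast; ring, show γ / 2 * ((2:ℕ):ℝ) = γ by push_cast; ring]
    _ = _ := by
        rw [ENNReal.mul_rpow_of_nonneg _ _ (by norm_num), ENNReal.mul_rpow_of_nonneg _ _ (by norm_num), ← ENNReal.rpow_mul,
          ENNReal.coe_mul, ENNReal.coe_rpow_of_nonneg _ (by norm_num), ENNReal.coe_rpow_of_nonneg _ (by norm_num), ← ENNReal.rpow_natCast]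
        norm_num; ring


lemma eps_lim {X a b k1 k2 : ℝ≥0∞} {M : NNReal} (ha : a ≠ ⊤) (hb : b ≠ ⊤) (h1 : k1 ≠ ⊤) (h2 : k2 ≠ ⊤)
    (h : ∀ ε : ℝ, 0 < ε → X ≤ M * (a + ENNReal.ofReal ε * k1) * (b + ENNReal.ofReal ε * k2)) : X ≤ M * a * b := by
  lift a to NNReal using ha
  lift b to NNReal using hb
  lift k1 to NNReal using h1
  lift k2 to NNReal using h2
  have hX : X ≠ ⊤ := ne_top_of_le_ne_top (by finiteness) (h 1 one_pos)
  lift X to NNReal using hX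
  have hc : Filter.Tendsto (fun ε : ℝ => M * (a + ε.toNNReal * k1) * (b + ε.toNNReal * k2)) (nhdsWithin 0 (Set.Ioi 0)) (nhds (M * (a + (0:ℝ).toNNReal * k1) * (b + (0:ℝ).toNNReal * k2))) := by
    refine Filter.Tendsto.mono_left (Continuous.tendsto ?_ 0) nhdsWithin_le_nhds
    fun_prop
  have := ge_of_tendsto hc (b := X) (by
    filter_upwards [self_mem_nhdsWithin] with ε hε
    have := h ε hε
    simp only [ENNReal.ofReal] at this
    exact_mod_cast this)
  simp at this
  exact_mod_cast this

lemma NiceG.slice_top {N : ℝ} {G : ℝ × ℝ → ℂ} (hG : NiceG N G) {s : ℝ} (hs : 0 < s) (t : ℝ) : ∫⁻ x, ‖G (t, x)‖ₑ ^ s ≠ ⊤ := by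
  obtain ⟨B, hB⟩ := hG.bdd
  have : ∫⁻ x, ‖G (t, x)‖ₑ ^ s ≤ ∫⁻ x, (Set.Icc (-N) N).indicator (fun _ => ENNReal.ofReal B ^ s) x := by
    refine lintegral_mono fun x => ?_
    by_cases hx : x ∈ Set.Icc (-N) N
    · rw [Set.indicator_of_mem hx, ← ofReal_norm]
      exact ENNReal.rpow_le_rpow (ENNReal.ofReal_le_ofReal (hB _)) hs.le
    · rw [hG.supp (t, x) (fun h => hx h.2)]; simp [hs]
  refine ne_top_of_le_ne_top ?_ this
  rw [lintegral_indicator measurableSet_Icc, lintegral_const]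
  simp only [Measure.restrict_apply_univ, Real.volume_Icc]
  have := hs.le
  finiteness

lemma NiceG.slice_bdd {N : ℝ} {G : ℝ × ℝ → ℂ} (hG : NiceG N G) {s : ℝ} (hs : 0 < s) : ∃ B : NNReal, ∀ t, ∫⁻ x, ‖G (t, x)‖ₑ ^ s ≤ B := by
  obtain ⟨B, hB⟩ := hG.bdd
  have h : ∀ t, ∫⁻ x, ‖G (t, x)‖ₑ ^ s ≤ ENNReal.ofReal B ^ s * ENNReal.ofReal (N - -N) := by
    intro t
    rw [← setLIntegral_eq_of_zero (s := Set.Icc (-N) N) measurableSet_Icc]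
    · calc _ ≤ ∫⁻ x in Set.Icc (-N) N, ENNReal.ofReal B ^ s := by
            refine lintegral_mono fun x => ?_
            simp only
            rw [← ofReal_norm]
            exact ENNReal.rpow_le_rpow (ENNReal.ofReal_le_ofReal (hB _)) hs.le
        _ = _ := by simp
    · intro x hx
      rw [hG.supp (t, x) (fun h => hx h.2)]; simp [hs]
  refine ⟨(ENNReal.ofReal B ^ s * ENNReal.ofReal (N - -N)).toNNReal, fun t => ?_⟩
  rw [ENNReal.coe_toNNReal (by have := hs.le; finiteness)]
  exact h t

lemma NiceG.Mn_top {N : ℝ} {G : ℝ × ℝ → ℂ} (hG : NiceG N G) {P Q : ℝ} (hP : 0 < P) (hQ : 0 < Q) : Mn P Q G ≠ ⊤ := by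
  unfold Mn
  obtain ⟨B, hB⟩ := hG.slice_bdd (s := 1 / P) (by positivity)
  have h0 : 0 ≤ P / Q := by positivity
  refine ENNReal.rpow_ne_top_of_nonneg hQ.le ?_
  rw [← setLIntegral_eq_of_zero (s := Set.Icc (-N) N) measurableSet_Icc]
  · refine ne_top_of_le_ne_top (b := ∫⁻ t in Set.Icc (-N) N, (B : ℝ≥0∞) ^ (P / Q)) ?_ ?_
    · simp only [lintegral_const, Measure.restrict_apply_univ, Real.volume_Icc]
      finiteness
    · exact lintegral_mono fun t => ENNReal.rpow_le_rpow (hB t) h0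
  · intro t ht
    have : ∀ x, G (t, x) = 0 := fun x => hG.supp _ fun h => ht h.1
    simp [this, hP, hQ]

lemma NiceF.Fn_top {N : ℝ} {f : ℝ → ℂ} (hf : NiceF N f) {A : ℝ} (hA : 0 < A) : Fn A f ≠ ⊤ := by
  unfold Fn
  obtain ⟨B, hB⟩ := hf.bdd
  have h0 : 0 ≤ 1 / A := by positivity
  refine ENNReal.rpow_ne_top_of_nonneg hA.le ?_
  rw [← setLIntegral_eq_of_zero (s := Set.Icc N⁻¹ N) measurableSet_Icc]
  · refine ne_top_of_le_ne_top (b := ∫⁻ t in Set.Icc N⁻¹ N, (ENNReal.ofReal B) ^ (1 / A)) ?_ ?_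
    · simp only [lintegral_const, Measure.restrict_apply_univ, Real.volume_Icc]
      finiteness
    · refine lintegral_mono fun t => ?_
      simp only
      rw [← ofReal_norm]
      exact ENNReal.rpow_le_rpow (ENNReal.ofReal_le_ofReal (hB _)) h0
  · intro t ht
    rw [hf.supp t ht]; simp [hA]

set_option maxHeartbeats 1000000 in
lemma est_edge {α P : ℝ} (hα : 0 < α) (hP0 : 3 / 4 < P) (hP1 : P < 1) : ∃ M : NNReal, Est α P (3 / 4) M := by
  obtain ⟨C, hC⟩ := edge_sq (γ := 4 * (1 - P)) hα (by linarith) (by linarith)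
  refine ⟨C ^ (1 / 2 : ℝ), ?_⟩
  intro N hN f G hf hG
  have hfm := hf.meas
  have hGm := hG.meas
  have hPp : 0 < P := by linarith
  set s := 1 / P with hs
  have hs0 : 0 < s := by positivity
  have hsP : s * P = 1 := by rw [hs]; field_simp
  have hs1 : s < 4 / 3 := by rw [hs, div_lt_iff₀ hPp]; linarith
  rw [show (1 - 3 / 4 : ℝ) = 1 / 4 by norm_num, show 2 * (3 / 4) + P - 2 = (2 - 4 * (1 - P)) / 4 by ring]
  set A := (2 - 4 * (1 - P)) / 4 with hA
  have hA0 : 0 < A := by rw [hA]; linarith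
  rw [← mul_one (C ^ (1 / 2 : ℝ))]
  set n : ℝ → ℝ≥0∞ := fun t => ∫⁻ x, ‖G (t, x)‖ₑ ^ s with hn
  have hnm : Measurable n := Measurable.lintegral_prod_right' (f := fun z : ℝ × ℝ => ‖G z‖ₑ ^ s) (by fun_prop)
  have hnt : ∀ t, n t ≠ ⊤ := hG.slice_top hs0
  have hFm : Measurable fun z : ℝ × ℝ => ∫ ξ, KK α (1 / 4) z.1 z.2 ξ * f ξ := by
    refine (StronglyMeasurable.integral_prod_right' (f := fun w : (ℝ × ℝ) × ℝ => KK α (1 / 4) w.1.1 w.1.2 w.2 * f w.2) ?_).measurable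
    exact (by fun_prop : Measurable _).stronglyMeasurable
  rw [mul_one]
  refine eps_lim (k1 := 0) (k2 := ENNReal.ofReal (N - -N) ^ (3 / 4 : ℝ)) (hf.Fn_top hA0) (hG.Mn_top hPp (by norm_num)) (by simp)
    (by finiteness) fun ε hε => ?_
  rw [mul_zero, add_zero]
  set a : ℝ → ℝ := fun t => (n t ^ P).toReal + ε with ha
  have ham : Measurable a := by simp only [ha]; fun_prop
  have ha0 : ∀ t, ε ≤ a t := fun t => by simp only [ha]; linarith [ENNReal.toReal_nonneg (a := n t ^ P)]
  have hap : ∀ t, 0 < a t := fun t => hε.trans_le (ha0 t)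
  have hae : ∀ t, ENNReal.ofReal (a t) = n t ^ P + ENNReal.ofReal ε := fun t => by
    simp only [ha]
    rw [ENNReal.ofReal_add ENNReal.toReal_nonneg hε.le, ENNReal.ofReal_toReal (ENNReal.rpow_ne_top_of_nonneg hPp.le (hnt t))]
  set E : ℝ → ℝ≥0∞ := fun t => ENNReal.ofReal (a t) with hE
  have hEm : Measurable E := by simp only [hE]; fun_prop
  have hE0 : ∀ t, E t ≠ 0 := fun t => by simp [hE, hap t]
  have hEt : ∀ t, E t ≠ ⊤ := fun t => by simp [hE]
  have hnE : ∀ t, n t ^ P ≤ E t := fun t => by rw [hE]; simp only; rw [hae t]; exact le_self_add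
  have hnE1 : ∀ t, n t ≤ E t ^ s := fun t => by
    have := ENNReal.rpow_le_rpow (hnE t) hs0.le
    rwa [← ENNReal.rpow_mul, mul_comm P s, hsP, ENNReal.rpow_one] at this
  set w : ℝ × ℝ → ℝ := fun z => a z.1 ^ (s - 4 / 3) * ‖G z‖ ^ (2 - s) with hw
  have hw0 : ∀ z, 0 ≤ w z := fun z => mul_nonneg (Real.rpow_nonneg (hap _).le _) (by positivity)
  have hwm : Measurable w := by simp only [hw]; fun_prop
  have hwN : NiceG N (fun z => (w z : ℂ)) := by
    obtain ⟨B, hB⟩ := hG.bdd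
    refine ⟨by fun_prop, ⟨ε ^ (s - 4 / 3) * B ^ (2 - s), fun z => ?_⟩, fun z hz => ?_⟩
    · rw [Complex.norm_real, Real.norm_of_nonneg (hw0 z)]
      simp only [hw]
      exact mul_le_mul (Real.rpow_le_rpow_of_nonpos hε (ha0 _) (by linarith))
        (Real.rpow_le_rpow (norm_nonneg _) (hB z) (by linarith)) (by positivity) (by positivity)
    · simp only [hw, hG.supp z hz, norm_zero]
      rw [Real.zero_rpow (by linarith)]; simp
  have hwe : ∀ z, ‖(w z : ℂ)‖ₑ = E z.1 ^ (s - 4 / 3) * ‖G z‖ₑ ^ (2 - s) := by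
    intro z
    rw [← ofReal_norm, Complex.norm_real, Real.norm_of_nonneg (hw0 z)]
    simp only [hw]
    rw [ENNReal.ofReal_mul (Real.rpow_nonneg (hap _).le _), ← ENNReal.ofReal_rpow_of_pos (hap _),
      ← ENNReal.ofReal_rpow_of_nonneg (norm_nonneg _) (by linarith), ofReal_norm]
  set I := Set.Icc (-N) N with hI
  set J := ∫⁻ t in I, E t ^ (4 / 3 : ℝ) with hJ
  -- weight bound
  have hb1 : ∫⁻ t, (∫⁻ x, ‖(w (t, x) : ℂ)‖ₑ ^ (2 / (2 - 4 * (1 - P)))) ^ (2 - 4 * (1 - P)) ≤ J := by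
    have hd : 2 - 4 * (1 - P) ≠ 0 := by linarith
    have hd0 : 0 < 2 - 4 * (1 - P) := by linarith
    have key : ∀ t, ∫⁻ x, ‖(w (t, x) : ℂ)‖ₑ ^ (2 / (2 - 4 * (1 - P))) = E t ^ ((s - 4 / 3) * (2 / (2 - 4 * (1 - P)))) * n t := by
      intro t
      have hpm : Measurable fun x => ‖G (t, x)‖ₑ ^ s := by fun_prop
      simp only [hn]
      rw [← lintegral_const_mul _ hpm]
      refine lintegral_congr fun x => ?_
      rw [hwe, ENNReal.mul_rpow_of_nonneg _ _ (by positivity), ← ENNReal.rpow_mul, ← ENNReal.rpow_mul]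
      congr 2
      rw [hs]
      have : 2 * P - 1 ≠ 0 := by linarith
      rw [show 2 - 4 * (1 - P) = 2 * (2 * P - 1) by ring]
      field_simp
    rw [← setLIntegral_eq_of_zero (s := I) measurableSet_Icc]
    · refine lintegral_mono fun t => ?_
      simp only
      rw [key t]
      calc _ ≤ (E t ^ ((s - 4 / 3) * (2 / (2 - 4 * (1 - P)))) * E t ^ s) ^ (2 - 4 * (1 - P)) := by
            gcongr; exact hnE1 t
        _ = _ := by
            rw [← ENNReal.rpow_add _ _ (hE0 t) (hEt t), ← ENNReal.rpow_mul]
            congr 1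
            rw [hs]; field_simp; ring
    · intro t ht
      have : ∀ x, G (t, x) = 0 := fun x => hG.supp _ fun h => ht h.1
      rw [key t]
      simp [hn, this, hs0, hd0]
  have hq := hC N hN f w hf hw0 hwm hwN
  set v : ℝ × ℝ → ℝ≥0∞ := fun z => E z.1 ^ ((4 / 3 - s) / 2) * ‖G z‖ₑ ^ (s / 2) with hv
  have hb2 : ∫⁻ z, v z ^ 2 ≤ J := by
    have e : ∀ z, v z ^ 2 = E z.1 ^ (4 / 3 - s) * ‖G z‖ₑ ^ s := by
      intro z
      simp only [hv]
      rw [mul_pow, ← ENNReal.rpow_mul_natCast, ← ENNReal.rpow_mul_natCast]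
      congr 2 <;> push_cast <;> ring
    simp only [e]
    rw [Measure.volume_eq_prod, lintegral_prod _ (by fun_prop)]
    have key : ∀ t, ∫⁻ x, E t ^ (4 / 3 - s) * ‖G (t, x)‖ₑ ^ s = E t ^ (4 / 3 - s) * n t := fun t => by
      simp only [hn]; rw [lintegral_const_mul _ (by fun_prop)]
    rw [← setLIntegral_eq_of_zero (s := I) measurableSet_Icc]
    · refine lintegral_mono fun t => ?_
      simp only
      rw [key]
      calc _ ≤ E t ^ (4 / 3 - s) * E t ^ s := by gcongr; exact hnE1 t
        _ = _ := by
          rw [← ENNReal.rpow_add _ _ (hE0 t) (hEt t)]; congr 1; ring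
    · intro t ht
      have : ∀ x, G (t, x) = 0 := fun x => hG.supp _ fun h => ht h.1
      simp [this, hs0]
  have hJ2 : J ^ (3 / 4 : ℝ) ≤ Mn P (3 / 4) G + ENNReal.ofReal ε * ENNReal.ofReal (N - -N) ^ (3 / 4 : ℝ) := by
    have := ENNReal.lintegral_Lp_add_le (μ := volume.restrict I) (p := 4 / 3) (f := fun t => n t ^ P) (g := fun _ => ENNReal.ofReal ε)
      (by fun_prop) (by fun_prop) (by norm_num)
    simp only [Pi.add_apply, ← hae] at this
    norm_num at this
    rw [hJ]
    refine this.trans ?_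
    gcongr
    · unfold Mn
      refine ENNReal.rpow_le_rpow ?_ (by norm_num)
      refine (setLIntegral_le_lintegral _ _).trans (le_of_eq ?_)
      refine lintegral_congr fun t => ?_
      simp only [hn]
      rw [← ENNReal.rpow_mul]; congr 1; ring
    · rw [ENNReal.mul_rpow_of_nonneg _ _ (by norm_num), ← ENNReal.rpow_mul]
      norm_num [hI]
  rw [pair_eq2 hN hf hG]
  calc _ ≤ ∫⁻ z : ℝ × ℝ, ‖(∫ ξ, KK α (1 / 4) z.1 z.2 ξ * f ξ) * G z‖ₑ := enorm_integral_le_lintegral_enorm _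
    _ = ∫⁻ z : ℝ × ℝ, (‖(∫ ξ, KK α (1 / 4) z.1 z.2 ξ * f ξ)‖ₑ * ‖(w z : ℂ)‖ₑ ^ (1 / 2 : ℝ)) * v z := by
        refine lintegral_congr fun z => ?_
        rw [enorm_mul, mul_assoc]
        congr 1
        rw [hwe]
        simp only [hv]
        rw [ENNReal.mul_rpow_of_nonneg _ _ (by norm_num), ← ENNReal.rpow_mul, ← ENNReal.rpow_mul]
        have e1 : E z.1 ^ ((s - 4 / 3) * (1 / 2)) * E z.1 ^ ((4 / 3 - s) / 2) = 1 := by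
          rw [← ENNReal.rpow_add _ _ (hE0 _) (hEt _), show (s - 4 / 3) * (1 / 2) + (4 / 3 - s) / 2 = 0 by ring, ENNReal.rpow_zero]
        have e2 : ‖G z‖ₑ ^ ((2 - s) * (1 / 2)) * ‖G z‖ₑ ^ (s / 2) = ‖G z‖ₑ := by
          rw [← ENNReal.rpow_add_of_nonneg _ _ (by linarith) (by linarith), show (2 - s) * (1 / 2) + s / 2 = 1 by ring, ENNReal.rpow_one]
        calc ‖G z‖ₑ = 1 * ‖G z‖ₑ := (one_mul _).symm
          _ = (E z.1 ^ ((s - 4 / 3) * (1 / 2)) * E z.1 ^ ((4 / 3 - s) / 2)) * (‖G z‖ₑ ^ ((2 - s) * (1 / 2)) * ‖G z‖ₑ ^ (s / 2)) := by rw [e1, e2]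
          _ = _ := by ring
    _ ≤ (∫⁻ z : ℝ × ℝ, (‖(∫ ξ, KK α (1 / 4) z.1 z.2 ξ * f ξ)‖ₑ * ‖(w z : ℂ)‖ₑ ^ (1 / 2 : ℝ)) ^ 2) ^ (1 / 2 : ℝ) * (∫⁻ z, v z ^ 2) ^ (1 / 2 : ℝ) :=
        cs_lint _ ((hFm.enorm.mul (by fun_prop)).aemeasurable) (by simp only [hv]; fun_prop)
    _ ≤ (C * Fn A f ^ 2 * J ^ (1 / 2 : ℝ)) ^ (1 / 2 : ℝ) * J ^ (1 / 2 : ℝ) := by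
        gcongr
        refine le_trans (le_of_eq ?_) (hq.trans (by gcongr))
        refine lintegral_congr fun z => ?_
        rw [mul_pow, ← ENNReal.rpow_mul_natCast]; norm_num
    _ = (C ^ (1 / 2 : ℝ) : NNReal) * Fn A f * J ^ (3 / 4 : ℝ) := by
        rw [ENNReal.mul_rpow_of_nonneg _ _ (by norm_num), ENNReal.mul_rpow_of_nonneg _ _ (by norm_num),
          ENNReal.coe_rpow_of_nonneg _ (by norm_num), ← ENNReal.rpow_natCast, ← ENNReal.rpow_mul, ← ENNReal.rpow_mul]
        rw [show ((2:ℕ):ℝ) * (1 / 2) = 1 by norm_num, ENNReal.rpow_one, show (3 / 4 : ℝ) = 1 / 2 * (1 / 2) + 1 / 2 by norm_num,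
          ENNReal.rpow_add_of_nonneg _ _ (by norm_num) (by norm_num)]
        ring
    _ ≤ _ := by gcongr


lemma stein {X : Type*} [MeasurableSpace X] {μ : Measure X} {h : X → ℂ} (hh : Integrable h μ)
    {e0 e1 : X → ℝ} (he0 : Measurable e0) (he1 : Measurable e1) {B : ℝ}
    (hB : ∀ x, h x ≠ 0 → |e0 x| ≤ B ∧ |e1 x| ≤ B) {K0 K1 : ℝ}
    (h0 : ∀ y : ℝ, ‖∫ x, h x * Complex.exp (e0 x + (y * Complex.I) * e1 x) ∂μ‖ ≤ K0)
    (h1 : ∀ y : ℝ, ‖∫ x, h x * Complex.exp (e0 x + (1 + y * Complex.I) * e1 x) ∂μ‖ ≤ K1)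
    {θ : ℝ} (hθ0 : 0 ≤ θ) (hθ1 : θ ≤ 1) :
    ‖∫ x, h x * Complex.exp (e0 x + θ * e1 x) ∂μ‖ ≤ K0 ^ (1 - θ) * K1 ^ θ := by
  set Φ : ℂ → ℂ := fun z => ∫ x, h x * Complex.exp (e0 x + z * e1 x) ∂μ with hΦ
  have hbound : ∀ (z : ℂ) (R : ℝ), |z.re| ≤ R → ∀ x, ‖h x * Complex.exp (e0 x + z * e1 x)‖ ≤ ‖h x‖ * Real.exp (B + R * B) := by
    intro z R hz x
    by_cases hx : h x = 0
    · simp [hx]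
    obtain ⟨b0, b1⟩ := hB x hx
    rw [norm_mul, Complex.norm_exp]
    gcongr
    simp only [Complex.add_re, Complex.ofReal_re, Complex.mul_re, Complex.ofReal_im, mul_zero, sub_zero]
    have : z.re * e1 x ≤ R * B := by
      refine (le_abs_self _).trans ?_
      rw [abs_mul]
      exact mul_le_mul hz b1 (abs_nonneg _) ((abs_nonneg _).trans hz)
    linarith [(le_abs_self _).trans b0]
  have hm : ∀ z : ℂ, AEStronglyMeasurable (fun x => h x * Complex.exp (e0 x + z * e1 x)) μ := fun z =>
    hh.1.mul (by fun_prop : Measurable fun x => Complex.exp (e0 x + z * e1 x)).aestronglyMeasurable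
  have hi : ∀ z : ℂ, Integrable (fun x => h x * Complex.exp (e0 x + z * e1 x)) μ := fun z =>
    (hh.norm.mul_const (Real.exp (B + |z.re| * B))).mono' (hm z) (Filter.Eventually.of_forall fun x => hbound z _ le_rfl x)
  have hd : Differentiable ℂ Φ := by
    intro z
    have := hasDerivAt_integral_of_dominated_loc_of_deriv_le (μ := μ) (𝕜 := ℂ) (s := Metric.ball z 1) (x₀ := z)
      (F := fun z x => h x * Complex.exp (e0 x + z * e1 x))
      (F' := fun z x => (h x * Complex.exp (e0 x + z * e1 x)) * e1 x)
      (bound := fun x => ‖h x‖ * Real.exp (B + (|z.re| + 1) * B) * B)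
      (Metric.ball_mem_nhds z one_pos) (Filter.Eventually.of_forall hm) (hi z)
      ((hm z).mul (by fun_prop : Measurable fun x => (e1 x : ℂ)).aestronglyMeasurable)
      (Filter.Eventually.of_forall fun x w hw => by
        by_cases hx : h x = 0
        · simp [hx]
        rw [norm_mul, Complex.norm_real]
        refine mul_le_mul (hbound w _ ?_ x) (hB x hx).2 (norm_nonneg _) (by positivity)
        have h1 : |w.re - z.re| ≤ ‖w - z‖ := by rw [← Complex.sub_re]; exact Complex.abs_re_le_norm _
        have h2 : ‖w - z‖ < 1 := by rwa [Metric.mem_ball, dist_eq_norm] at hw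
        have h3 := abs_sub_abs_le_abs_sub w.re z.re
        linarith)
      ((hh.norm.mul_const _).mul_const _)
      (Filter.Eventually.of_forall fun x w hw => by
        have h1 : HasDerivAt (fun z : ℂ => (e0 x : ℂ) + z * e1 x) (e1 x) w := by
          simpa using ((hasDerivAt_id w).mul_const (e1 x : ℂ)).const_add (e0 x : ℂ)
        have := (h1.cexp).const_mul (h x)
        exact this.congr_deriv (by ring))
    exact this.2.differentiableAt
  have hB' : BddAbove (Set.image (norm ∘ Φ) (Complex.HadamardThreeLines.verticalClosedStrip 0 1)) := by
    refine ⟨∫ x, ‖h x‖ * Real.exp (B + 1 * B) ∂μ, ?_⟩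
    rintro _ ⟨z, hz, rfl⟩
    have hz' : 0 ≤ z.re ∧ z.re ≤ 1 := hz
    refine norm_integral_le_of_norm_le (hh.norm.mul_const _) (Filter.Eventually.of_forall fun x => hbound z 1 ?_ x)
    rw [abs_of_nonneg hz'.1]; exact hz'.2
  have := Complex.HadamardThreeLines.norm_le_interp_of_mem_verticalClosedStrip₀₁' Φ (z := (θ : ℂ)) (a := K0) (b := K1)
    (by constructor <;> simpa) hd.diffContOnCl hB'
    (fun z hz => by
      have hz0 : z.re = 0 := hz
      have e : z = z.im * Complex.I := by apply Complex.ext <;> simp [hz0]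
      rw [e]; exact h0 _)
    (fun z hz => by
      have hz0 : z.re = 1 := hz
      have e : z = 1 + z.im * Complex.I := by apply Complex.ext <;> simp [hz0]
      rw [e]; exact h1 _)
  simpa [hΦ] using this


lemma rpow_bdd2 {ε B x : ℝ} (hε : 0 < ε) (h1 : ε ≤ x) (h2 : x ≤ B) (e : ℝ) : x ^ e ≤ ε ^ e + B ^ e := by
  have hx : 0 < x := hε.trans_le h1
  have hB : 0 < B := hx.trans_le h2
  rcases le_total 0 e with he | he
  · have := Real.rpow_le_rpow hx.le h2 he
    have : 0 ≤ ε ^ e := by positivity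
    linarith
  · have := Real.rpow_le_rpow_of_nonpos hε h1 he
    have : 0 ≤ B ^ e := by positivity
    linarith

lemma interpF {N : ℝ} {f φ : ℝ → ℂ} {b : ℝ → ℝ} {ε B A A' : ℝ} (hf : NiceF N f) (hbm : Measurable b) (hε : 0 < ε)
    (hb1 : ∀ ξ, ε ≤ b ξ) (hb2 : ∀ ξ, b ξ ≤ B) (hfb : ∀ ξ, ‖f ξ‖ ≤ b ξ) (hA' : 0 < A')
    (hφm : Measurable φ) (hφ : ∀ ξ, ‖φ ξ‖ = 1) :
    NiceF N (fun ξ => (φ ξ * ((b ξ ^ (A' / A - 1) : ℝ) : ℂ)) * f ξ) ∧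
    Fn A' (fun ξ => (φ ξ * ((b ξ ^ (A' / A - 1) : ℝ) : ℂ)) * f ξ) ≤ (∫⁻ ξ in Set.Icc N⁻¹ N, ENNReal.ofReal (b ξ) ^ (1 / A)) ^ A' := by
  have hbp : ∀ ξ, 0 < b ξ := fun ξ => hε.trans_le (hb1 ξ)
  have hn : ∀ ξ, ‖φ ξ * ((b ξ ^ (A' / A - 1) : ℝ) : ℂ)‖ = b ξ ^ (A' / A - 1) := by
    intro ξ
    rw [norm_mul, hφ, one_mul, Complex.norm_real, Real.norm_of_nonneg (Real.rpow_nonneg (hbp ξ).le _)]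
  constructor
  · refine hf.mul (by fun_prop) (B := ε ^ (A' / A - 1) + B ^ (A' / A - 1)) fun ξ hξ => ?_
    rw [hn]
    exact rpow_bdd2 hε (hb1 ξ) (hb2 ξ) _
  · unfold Fn
    refine ENNReal.rpow_le_rpow ?_ hA'.le
    rw [← setLIntegral_eq_of_zero (s := Set.Icc N⁻¹ N) measurableSet_Icc (fun ξ hξ => by simp [hf.supp ξ hξ, hA'])]
    refine lintegral_mono fun ξ => ?_
    simp only
    rw [← ofReal_norm, norm_mul, hn]
    have h0 : 0 ≤ 1 / A' := by positivity
    calc _ ≤ ENNReal.ofReal (b ξ ^ (A' / A - 1) * b ξ) ^ (1 / A') := by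
          have := hfb ξ
          have := (hbp ξ).le
          gcongr
      _ = _ := by
          rw [← Real.rpow_add_one (hbp ξ).ne', sub_add_cancel, ← ENNReal.ofReal_rpow_of_pos (hbp ξ), ← ENNReal.rpow_mul]
          congr 1
          field_simp

lemma interpG {N : ℝ} {G ψ : ℝ × ℝ → ℂ} {g : ℝ × ℝ → ℝ} {a : ℝ → ℝ} {ε B P Q P' Q' : ℝ} (hG : NiceG N G)
    (hgm : Measurable g) (ham : Measurable a) (hε : 0 < ε)
    (hg1 : ∀ z, ε ≤ g z) (hg2 : ∀ z, g z ≤ B) (hGg : ∀ z, ‖G z‖ ≤ g z) (ha1 : ∀ t, ε ≤ a t) (ha2 : ∀ t, a t ≤ B)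
    (hga : ∀ t, ∫⁻ x in Set.Icc (-N) N, ENNReal.ofReal (g (t, x)) ^ (1 / P) ≤ ENNReal.ofReal (a t) ^ (1 / P))
    (hP : 0 < P) (hQ : 0 < Q) (hP' : 0 < P') (hQ' : 0 < Q')
    (hψm : Measurable ψ) (hψ : ∀ ξ, ‖ψ ξ‖ = 1) :
    NiceG N (fun z => (ψ z * ((g z ^ (P' / P - 1) * a z.1 ^ (Q' / Q - P' / P) : ℝ) : ℂ)) * G z) ∧
    Mn P' Q' (fun z => (ψ z * ((g z ^ (P' / P - 1) * a z.1 ^ (Q' / Q - P' / P) : ℝ) : ℂ)) * G z) ≤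
      (∫⁻ t in Set.Icc (-N) N, ENNReal.ofReal (a t) ^ (1 / Q)) ^ Q' := by
  have hgp : ∀ z, 0 < g z := fun z => hε.trans_le (hg1 z)
  have hap : ∀ z, 0 < a z := fun z => hε.trans_le (ha1 z)
  have hn : ∀ z, ‖ψ z * ((g z ^ (P' / P - 1) * a z.1 ^ (Q' / Q - P' / P) : ℝ) : ℂ)‖ = g z ^ (P' / P - 1) * a z.1 ^ (Q' / Q - P' / P) := by
    intro z
    rw [norm_mul, hψ, one_mul, Complex.norm_real, Real.norm_of_nonneg (mul_nonneg (Real.rpow_nonneg (hgp z).le _) (Real.rpow_nonneg (hap _).le _))]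
  constructor
  · refine hG.mul (by fun_prop) (B := (ε ^ (P' / P - 1) + B ^ (P' / P - 1)) * (ε ^ (Q' / Q - P' / P) + B ^ (Q' / Q - P' / P))) fun z hz => ?_
    rw [hn]
    have h1 := rpow_bdd2 hε (hg1 z) (hg2 z) (P' / P - 1)
    exact mul_le_mul h1 (rpow_bdd2 hε (ha1 _) (ha2 _) _) (Real.rpow_nonneg (hap _).le _) ((Real.rpow_nonneg (hgp z).le _).trans h1)
  · unfold Mn
    refine ENNReal.rpow_le_rpow ?_ hQ'.le
    rw [← setLIntegral_eq_of_zero (s := Set.Icc (-N) N) measurableSet_Icc (fun t ht => by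
      have : ∀ x, G (t, x) = 0 := fun x => hG.supp _ fun h => ht h.1
      simp [this, hP', hQ'])]
    refine lintegral_mono fun t => ?_
    simp only
    have hPQ : 0 ≤ P' / Q' := by positivity
    have e0 : ENNReal.ofReal (a t) ≠ 0 := by simp [hap t]
    calc _ ≤ (ENNReal.ofReal (a t) ^ ((Q' / Q - P' / P) * (1 / P')) * ENNReal.ofReal (a t) ^ (1 / P)) ^ (P' / Q') := by
          refine ENNReal.rpow_le_rpow ?_ hPQ
          refine le_trans ?_ (mul_le_mul_right (hga t) _)
          rw [← lintegral_const_mul _ (by fun_prop)]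
          rw [← setLIntegral_eq_of_zero (s := Set.Icc (-N) N) measurableSet_Icc (fun x hx => by
            have : G (t, x) = 0 := hG.supp _ fun h => hx h.2
            simp [this, hP'])]
          refine lintegral_mono fun x => ?_
          simp only
          rw [← ofReal_norm, norm_mul, hn]
          simp only
          have h0 : 0 ≤ 1 / P' := by positivity
          calc _ ≤ ENNReal.ofReal (g (t, x) ^ (P' / P - 1) * a t ^ (Q' / Q - P' / P) * g (t, x)) ^ (1 / P') := by
                have := hGg (t, x)
                have := (hgp (t, x)).le
                have := (hap t).le
                gcongr
            _ = ENNReal.ofReal (a t ^ (Q' / Q - P' / P) * g (t, x) ^ (P' / P)) ^ (1 / P') := by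
                rw [mul_comm (g (t, x) ^ _), mul_assoc, ← Real.rpow_add_one (hgp _).ne', sub_add_cancel]
            _ = _ := by
                rw [ENNReal.ofReal_mul (Real.rpow_nonneg (hap t).le _), ← ENNReal.ofReal_rpow_of_pos (hgp _), ← ENNReal.ofReal_rpow_of_pos (hap _),
                  ENNReal.mul_rpow_of_nonneg _ _ h0, ← ENNReal.rpow_mul, ← ENNReal.rpow_mul]
                congr 2; field_simp
      _ = _ := by
          rw [← ENNReal.rpow_add _ _ e0 ENNReal.ofReal_ne_top, ← ENNReal.rpow_mul]
          congr 1
          field_simp; ring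

lemma bdd_log {ε B x : ℝ} (hε : 0 < ε) (h1 : ε ≤ x) (h2 : x ≤ B) : |Real.log x| ≤ |Real.log ε| + |Real.log B| := by
  have hx : 0 < x := hε.trans_le h1
  have l1 := Real.log_le_log hε h1
  have l2 := Real.log_le_log hx h2
  rw [abs_le]
  constructor
  · linarith [neg_abs_le (Real.log ε), abs_nonneg (Real.log B)]
  · linarith [le_abs_self (Real.log B), abs_nonneg (Real.log ε)]

set_option maxHeartbeats 1000000 in
/-- interpolation, before removing the regularisation -/
lemma interp_core {α P0 Q0 P1 Q1 A0 A1 P Q A θ : ℝ} {M : NNReal} (h0 : Est α P0 Q0 M) (h1 : Est α P1 Q1 M)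
    (hP0 : 0 < P0) (hQ0 : 0 < Q0) (hP1 : 0 < P1) (hQ1 : 0 < Q1) (hA0 : 0 < A0) (hA1 : 0 < A1)
    (eA0 : A0 = 2 * Q0 + P0 - 2) (eA1 : A1 = 2 * Q1 + P1 - 2)
    (hθ0 : 0 ≤ θ) (hθ1 : θ ≤ 1) (eP : P = P0 + θ * (P1 - P0)) (eQ : Q = Q0 + θ * (Q1 - Q0)) (eA : A = A0 + θ * (A1 - A0))
    (hP : 0 < P) (hQ : 0 < Q) (hA : 0 < A)
    {N : ℝ} (hN : 0 < N) {f : ℝ → ℂ} {G : ℝ × ℝ → ℂ} (hf : NiceF N f) (hG : NiceG N G)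
    {b : ℝ → ℝ} {g : ℝ × ℝ → ℝ} {a : ℝ → ℝ} {ε B : ℝ} (hε : 0 < ε)
    (hbm : Measurable b) (hb1 : ∀ ξ, ε ≤ b ξ) (hb2 : ∀ ξ, b ξ ≤ B) (hfb : ∀ ξ, ‖f ξ‖ ≤ b ξ)
    (hgm : Measurable g) (ham : Measurable a)
    (hg1 : ∀ z, ε ≤ g z) (hg2 : ∀ z, g z ≤ B) (hGg : ∀ z, ‖G z‖ ≤ g z) (ha1 : ∀ t, ε ≤ a t) (ha2 : ∀ t, a t ≤ B)
    (hga : ∀ t, ∫⁻ x in Set.Icc (-N) N, ENNReal.ofReal (g (t, x)) ^ (1 / P) ≤ ENNReal.ofReal (a t) ^ (1 / P)) :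
    ‖pair α (1 - Q) f G‖ₑ ≤ M * (∫⁻ ξ in Set.Icc N⁻¹ N, ENNReal.ofReal (b ξ) ^ (1 / A)) ^ A *
      (∫⁻ t in Set.Icc (-N) N, ENNReal.ofReal (a t) ^ (1 / Q)) ^ Q := by
  have hbp : ∀ ξ, 0 < b ξ := fun ξ => hε.trans_le (hb1 ξ)
  have hgp : ∀ z, 0 < g z := fun z => hε.trans_le (hg1 z)
  have hap : ∀ z, 0 < a z := fun z => hε.trans_le (ha1 z)
  have hN' : 0 < N⁻¹ := by positivity
  set F := ∫⁻ ξ in Set.Icc N⁻¹ N, ENNReal.ofReal (b ξ) ^ (1 / A) with hF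
  set m := ∫⁻ t in Set.Icc (-N) N, ENNReal.ofReal (a t) ^ (1 / Q) with hm
  have hFt : F ≠ ⊤ := by
    refine ne_top_of_le_ne_top (b := ∫⁻ ξ in Set.Icc N⁻¹ N, ENNReal.ofReal B ^ (1 / A)) ?_ (lintegral_mono fun ξ => ?_)
    · have : 0 ≤ 1 / A := by positivity
      simp only [lintegral_const, Measure.restrict_apply_univ, Real.volume_Icc]; finiteness
    · exact ENNReal.rpow_le_rpow (ENNReal.ofReal_le_ofReal (hb2 ξ)) (by positivity)
  have hmt : m ≠ ⊤ := by
    refine ne_top_of_le_ne_top (b := ∫⁻ ξ in Set.Icc (-N) N, ENNReal.ofReal B ^ (1 / Q)) ?_ (lintegral_mono fun ξ => ?_)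
    · have : 0 ≤ 1 / Q := by positivity
      simp only [lintegral_const, Measure.restrict_apply_univ, Real.volume_Icc]; finiteness
    · exact ENNReal.rpow_le_rpow (ENNReal.ofReal_le_ofReal (ha2 ξ)) (by positivity)
  set lf : ℝ → ℝ := fun ξ => (A1 - A0) / A * Real.log (b ξ) - α * (Q1 - Q0) * Real.log ξ with hlf
  set lG : ℝ × ℝ → ℝ := fun z => (P1 - P0) / P * Real.log (g z) + ((Q1 - Q0) / Q - (P1 - P0) / P) * Real.log (a z.1) with hlG
  set e0 : (ℝ × ℝ) × ℝ → ℝ := fun w => ((A0 / A - 1) * Real.log (b w.2) + α * (1 - Q0) * Real.log w.2) +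
    ((P0 / P - 1) * Real.log (g w.1) + (Q0 / Q - P0 / P) * Real.log (a w.1.1)) with he0
  set e1 : (ℝ × ℝ) × ℝ → ℝ := fun w => lf w.2 + lG w.1 with he1
  have key : ∀ (σ y As Ps Qs : ℝ), As = A0 + σ * (A1 - A0) → Ps = P0 + σ * (P1 - P0) → Qs = Q0 + σ * (Q1 - Q0) →
      ∀ w : (ℝ × ℝ) × ℝ, (KK α 0 w.1.1 w.1.2 w.2 * f w.2 * G w.1) * Complex.exp (e0 w + (σ + y * Complex.I) * e1 w) =
      KK α (1 - Qs) w.1.1 w.1.2 w.2 * ((Complex.exp (Complex.I * ((y * lf w.2 : ℝ) : ℂ)) * ((b w.2 ^ (As / A - 1) : ℝ) : ℂ)) * f w.2) *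
        ((Complex.exp (Complex.I * ((y * lG w.1 : ℝ) : ℂ)) * ((g w.1 ^ (Ps / P - 1) * a w.1.1 ^ (Qs / Q - Ps / P) : ℝ) : ℂ)) * G w.1) := by
    intro σ y As Ps Qs hAs hPs hQs w
    by_cases hw : w.2 ∈ Set.Icc N⁻¹ N
    · have hξ : 0 < w.2 := hN'.trans_le hw.1
      have E : Real.exp (e0 w + σ * e1 w) = w.2 ^ (α * (1 - Qs)) * b w.2 ^ (As / A - 1) * (g w.1 ^ (Ps / P - 1) * a w.1.1 ^ (Qs / Q - Ps / P)) := by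
        rw [Real.rpow_def_of_pos hξ, Real.rpow_def_of_pos (hbp _), Real.rpow_def_of_pos (hgp _), Real.rpow_def_of_pos (hap _),
          ← Real.exp_add, ← Real.exp_add, ← Real.exp_add]
        congr 1
        simp only [he0, he1, hlf, hlG, hAs, hPs, hQs]
        field_simp; ring
      have E2 : Complex.exp (e0 w + (σ + y * Complex.I) * e1 w) = ((Real.exp (e0 w + σ * e1 w) : ℝ) : ℂ) *
          Complex.exp (Complex.I * ((y * lf w.2 : ℝ) : ℂ)) * Complex.exp (Complex.I * ((y * lG w.1 : ℝ) : ℂ)) := by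
        rw [Complex.ofReal_exp, ← Complex.exp_add, ← Complex.exp_add]
        congr 1
        simp only [he1]; push_cast; ring
      rw [E2, E]
      unfold KK
      rw [abs_of_pos hξ, mul_zero, Real.rpow_zero]
      push_cast; ring
    · rw [hf.supp _ hw]; simp
  have hpair : ∀ (σ y As Ps Qs : ℝ), As = A0 + σ * (A1 - A0) → Ps = P0 + σ * (P1 - P0) → Qs = Q0 + σ * (Q1 - Q0) →
      0 < As → 0 < Ps → 0 < Qs → As = 2 * Qs + Ps - 2 → Est α Ps Qs M →
      ‖∫ w : (ℝ × ℝ) × ℝ, (KK α 0 w.1.1 w.1.2 w.2 * f w.2 * G w.1) * Complex.exp (e0 w + (σ + y * Complex.I) * e1 w)‖ ≤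
        (M : ℝ) * F.toReal ^ As * m.toReal ^ Qs := by
    intro σ y As Ps Qs hAs hPs hQs hAs0 hPs0 hQs0 hAe hE
    simp only [key σ y As Ps Qs hAs hPs hQs]
    obtain ⟨f1, f2⟩ := interpF (A := A) (A' := As) (φ := fun ξ => Complex.exp (Complex.I * ((y * lf ξ : ℝ) : ℂ))) hf hbm hε hb1 hb2 hfb hAs0
      (by simp only [hlf]; fun_prop) (fun ξ => norm_expI _)
    obtain ⟨g1, g2⟩ := interpG (P' := Ps) (Q' := Qs) (ψ := fun ξ => Complex.exp (Complex.I * ((y * lG ξ : ℝ) : ℂ))) hG hgm ham hε hg1 hg2 hGg ha1 ha2 hga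
      hP hQ hPs0 hQs0
      (by simp only [hlG]; fun_prop) (fun ξ => norm_expI _)
    have := hE N hN _ _ f1 g1
    rw [← hAe] at this
    have h2 := this.trans (mul_le_mul' (mul_le_mul' le_rfl f2) g2)
    rw [← toReal_enorm]
    refine (ENNReal.toReal_mono (by finiteness) h2).trans (le_of_eq ?_)
    rw [ENNReal.toReal_mul, ENNReal.toReal_mul, ← ENNReal.toReal_rpow, ← ENNReal.toReal_rpow]; rfl
  have hlogf : ∃ L, 0 ≤ L ∧ (∀ ξ, |Real.log (b ξ)| ≤ L) ∧ (∀ z, |Real.log (g z)| ≤ L) ∧ (∀ z, |Real.log (a z)| ≤ L) ∧ ∀ ξ ∈ Set.Icc N⁻¹ N, |Real.log ξ| ≤ L := by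
    refine ⟨(|Real.log ε| + |Real.log B|) + (|Real.log N⁻¹| + |Real.log N|), by positivity, fun ξ => ?_, fun ξ => ?_, fun ξ => ?_, fun ξ hξ => ?_⟩
    · exact (bdd_log hε (hb1 ξ) (hb2 ξ)).trans (le_add_of_nonneg_right (by positivity))
    · exact (bdd_log hε (hg1 ξ) (hg2 ξ)).trans (le_add_of_nonneg_right (by positivity))
    · exact (bdd_log hε (ha1 ξ) (ha2 ξ)).trans (le_add_of_nonneg_right (by positivity))
    · exact (bdd_log hN' hξ.1 hξ.2).trans (le_add_of_nonneg_left (by positivity))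
  obtain ⟨L, hL0, Lb, Lg, La, Lξ⟩ := hlogf
  have lin : ∀ c1 c2 c3 c4 x1 x2 x3 x4 : ℝ, |x1| ≤ L → |x2| ≤ L → |x3| ≤ L → |x4| ≤ L →
      |(c1 * x1 + c2 * x2) + (c3 * x3 + c4 * x4)| ≤ (|c1| + |c2| + |c3| + |c4|) * L := by
    intro c1 c2 c3 c4 x1 x2 x3 x4 h1 h2 h3 h4
    have t : ∀ c x : ℝ, |x| ≤ L → |c * x| ≤ |c| * L := fun c x h => by rw [abs_mul]; gcongr
    calc _ ≤ |c1 * x1| + |c2 * x2| + (|c3 * x3| + |c4 * x4|) := (abs_add_le _ _).trans (add_le_add (abs_add_le _ _) (abs_add_le _ _))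
      _ ≤ _ := by linarith [t c1 x1 h1, t c2 x2 h2, t c3 x3 h3, t c4 x4 h4]
  set B0 := (|A0 / A - 1| + |α * (1 - Q0)| + |P0 / P - 1| + |Q0 / Q - P0 / P|) * L
  set B1 := (|(A1 - A0) / A| + |-(α * (Q1 - Q0))| + |(P1 - P0) / P| + |(Q1 - Q0) / Q - (P1 - P0) / P|) * L
  have st := stein (μ := volume) (h := fun w : (ℝ × ℝ) × ℝ => KK α 0 w.1.1 w.1.2 w.2 * f w.2 * G w.1) (e0 := e0) (e1 := e1)
    (B := max B0 B1) (K0 := (M : ℝ) * F.toReal ^ A0 * m.toReal ^ Q0) (K1 := (M : ℝ) * F.toReal ^ A1 * m.toReal ^ Q1)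
    (θ := θ) (integrable_nice hN hf hG)
    (by simp only [he0]; fun_prop) (by simp only [he1, hlf, hlG]; fun_prop)
    (by
      intro w hw
      have hw2 : w.2 ∈ Set.Icc N⁻¹ N := by
        by_contra h
        exact hw (by rw [hf.supp _ h]; simp)
      constructor
      · exact (lin _ _ _ _ _ _ _ _ (Lb _) (Lξ _ hw2) (Lg _) (La _)).trans (le_max_left _ _)
      · refine le_trans (le_of_eq ?_) ((lin _ _ _ _ _ _ _ _ (Lb w.2) (Lξ _ hw2) (Lg w.1) (La w.1.1)).trans (le_max_right _ _))
        congr 1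
        simp only [he1, hlf, hlG]; ring)
    (fun y => by
      have := hpair 0 y A0 P0 Q0 (by ring) (by ring) (by ring) hA0 hP0 hQ0 eA0 h0
      simpa only [Complex.ofReal_zero, zero_add] using this)
    (fun y => by
      have := hpair 1 y A1 P1 Q1 (by ring) (by ring) (by ring) hA1 hP1 hQ1 eA1 h1
      simpa only [Complex.ofReal_one] using this)
    hθ0 hθ1
  have e3 : (∫ w : (ℝ × ℝ) × ℝ, KK α 0 w.1.1 w.1.2 w.2 * f w.2 * G w.1 * Complex.exp (e0 w + θ * e1 w)) = pair α (1 - Q) f G := by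
    unfold pair
    refine integral_congr_ae (Filter.Eventually.of_forall fun w => ?_)
    have := key θ 0 A P Q eA eP eQ w
    simp only [div_self hA.ne', div_self hP.ne', div_self hQ.ne', sub_self, Real.rpow_zero, zero_mul, Complex.ofReal_zero, mul_zero,
      Complex.exp_zero, one_mul, Complex.ofReal_one, add_zero] at this
    simpa using this
  rw [e3] at st
  have e4 : ((M : ℝ) * F.toReal ^ A0 * m.toReal ^ Q0) ^ (1 - θ) * ((M : ℝ) * F.toReal ^ A1 * m.toReal ^ Q1) ^ θ =
      (M : ℝ) * F.toReal ^ A * m.toReal ^ Q := by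
    have hF0 : 0 ≤ F.toReal := ENNReal.toReal_nonneg
    have hm0 : 0 ≤ m.toReal := ENNReal.toReal_nonneg
    have hM0 : (0:ℝ) ≤ M := M.2
    have h1θ : 0 ≤ 1 - θ := by linarith
    rw [Real.mul_rpow (by positivity) (by positivity), Real.mul_rpow (by positivity) (by positivity),
      Real.mul_rpow (by positivity) (by positivity), Real.mul_rpow (by positivity) (by positivity),
      ← Real.rpow_mul hF0, ← Real.rpow_mul hF0, ← Real.rpow_mul hm0, ← Real.rpow_mul hm0]
    have m1 : (M : ℝ) ^ (1 - θ) * (M : ℝ) ^ θ = M := by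
      rw [← Real.rpow_add_of_nonneg hM0 h1θ hθ0]; simp
    have m2 : F.toReal ^ (A0 * (1 - θ)) * F.toReal ^ (A1 * θ) = F.toReal ^ A := by
      rw [← Real.rpow_add_of_nonneg hF0 (by positivity) (by positivity)]; congr 1; rw [eA]; ring
    have m3 : m.toReal ^ (Q0 * (1 - θ)) * m.toReal ^ (Q1 * θ) = m.toReal ^ Q := by
      rw [← Real.rpow_add_of_nonneg hm0 (by positivity) (by positivity)]; congr 1; rw [eQ]; ring
    calc _ = ((M:ℝ)^(1-θ) * (M:ℝ)^θ) * (F.toReal^(A0*(1-θ)) * F.toReal^(A1*θ)) * (m.toReal^(Q0*(1-θ)) * m.toReal^(Q1*θ)) := by ring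
      _ = _ := by rw [m1, m2, m3]
  rw [e4] at st
  rw [← ofReal_norm]
  refine (ENNReal.ofReal_le_ofReal st).trans (le_of_eq ?_)
  rw [ENNReal.ofReal_mul (by positivity), ENNReal.ofReal_mul (by positivity), ENNReal.toReal_rpow, ENNReal.toReal_rpow,
    ENNReal.ofReal_toReal (by finiteness), ENNReal.ofReal_toReal (by finiteness)]
  simp


lemma minkowski_const {X : Type*} [MeasurableSpace X] (μ : Measure X) [IsFiniteMeasure μ] {n : X → ℝ≥0∞} (hn : Measurable n) {A ε : ℝ}
    (hA : 0 < A) (hA1 : A ≤ 1) :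
    (∫⁻ x, (n x + ENNReal.ofReal ε) ^ (1 / A) ∂μ) ^ A ≤ (∫⁻ x, n x ^ (1 / A) ∂μ) ^ A + ENNReal.ofReal ε * μ Set.univ ^ A := by
  have := ENNReal.lintegral_Lp_add_le (μ := μ) (p := 1 / A) (f := n) (g := fun _ => ENNReal.ofReal ε)
    (by fun_prop) (by fun_prop) (by rw [le_div_iff₀ hA]; linarith)
  simp only [Pi.add_apply, one_div_one_div] at this
  refine this.trans (le_of_eq ?_)
  congr 1
  rw [lintegral_const, ENNReal.mul_rpow_of_nonneg _ _ hA.le, ← ENNReal.rpow_mul, one_div_mul_cancel hA.ne', ENNReal.rpow_one]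

set_option maxHeartbeats 1000000 in
lemma est_interp {α P0 Q0 P1 Q1 P Q θ : ℝ} {M : NNReal} (h0 : Est α P0 Q0 M) (h1 : Est α P1 Q1 M)
    (hP0 : 0 < P0) (hQ0 : 0 < Q0) (hP1 : 0 < P1) (hQ1 : 0 < Q1)
    (hA0 : 0 < 2 * Q0 + P0 - 2) (hA1 : 0 < 2 * Q1 + P1 - 2)
    (hP0' : P0 ≤ 1) (hQ0' : Q0 ≤ 1) (hP1' : P1 ≤ 1) (hQ1' : Q1 ≤ 1)
    (hθ0 : 0 ≤ θ) (hθ1 : θ ≤ 1) (eP : P = P0 + θ * (P1 - P0)) (eQ : Q = Q0 + θ * (Q1 - Q0)) : Est α P Q M := by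
  intro N hN f G hf hG
  have conv : ∀ x y : ℝ, 0 < x → 0 < y → 0 < x + θ * (y - x) := by
    intro x y hx hy
    rcases eq_or_lt_of_le hθ0 with h | h
    · rw [← h]; simpa
    · nlinarith
  have conv1 : ∀ x y : ℝ, x ≤ 1 → y ≤ 1 → x + θ * (y - x) ≤ 1 := by intro x y hx hy; nlinarith
  have hP : 0 < P := eP ▸ conv _ _ hP0 hP1
  have hQ : 0 < Q := eQ ▸ conv _ _ hQ0 hQ1
  have hP1 : P ≤ 1 := eP ▸ conv1 _ _ hP0' hP1'
  have hQ1 : Q ≤ 1 := eQ ▸ conv1 _ _ hQ0' hQ1'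
  have eA : 2 * Q + P - 2 = (2 * Q0 + P0 - 2) + θ * ((2 * Q1 + P1 - 2) - (2 * Q0 + P0 - 2)) := by rw [eP, eQ]; ring
  have hA : 0 < 2 * Q + P - 2 := eA ▸ conv _ _ hA0 hA1
  have hA1' : 2 * Q + P - 2 ≤ 1 := by linarith
  set A := 2 * Q + P - 2 with hAd
  have hfm := hf.meas
  have hGm := hG.meas
  set I := Set.Icc (-N) N with hI
  set If := Set.Icc N⁻¹ N with hIf
  set V : ℝ≥0∞ := volume I with hV
  have hVt : V ≠ ⊤ := by rw [hV, hI, Real.volume_Icc]; finiteness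
  have hV0 : V ≠ 0 := by rw [hV, hI, Real.volume_Icc]; simp; linarith
  have hVf : volume If ≠ ⊤ := by rw [hIf, Real.volume_Icc]; finiteness
  haveI : IsFiniteMeasure (volume.restrict I) := ⟨by simpa using hVt.lt_top⟩
  haveI : IsFiniteMeasure (volume.restrict If) := ⟨by simpa using hVf.lt_top⟩
  refine eps_lim (k1 := volume If ^ A) (k2 := V ^ P * V ^ Q) (hf.Fn_top hA) (hG.Mn_top hP hQ) (by finiteness)
    (by finiteness) fun ε hε => ?_
  set b : ℝ → ℝ := fun ξ => ‖f ξ‖ + ε with hb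
  set g : ℝ × ℝ → ℝ := fun z => ‖G z‖ + ε with hg
  have hbe : ∀ ξ, ENNReal.ofReal (b ξ) = ‖f ξ‖ₑ + ENNReal.ofReal ε := fun ξ => by
    simp only [hb]; rw [ENNReal.ofReal_add (norm_nonneg _) hε.le, ofReal_norm]
  have hge : ∀ ξ, ENNReal.ofReal (g ξ) = ‖G ξ‖ₑ + ENNReal.ofReal ε := fun ξ => by
    simp only [hg]; rw [ENNReal.ofReal_add (norm_nonneg _) hε.le, ofReal_norm]
  have hgm : Measurable g := by simp only [hg]; fun_prop
  set n : ℝ → ℝ≥0∞ := fun t => ∫⁻ x in I, ENNReal.ofReal (g (t, x)) ^ (1 / P) with hn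
  have hnm : Measurable n := Measurable.lintegral_prod_right' (f := fun z : ℝ × ℝ => ENNReal.ofReal (g z) ^ (1 / P)) (by fun_prop)
  obtain ⟨Bf, hBf⟩ := hf.bdd
  obtain ⟨BG, hBG⟩ := hG.bdd
  have hsP : 0 ≤ 1 / P := by positivity
  have hn1 : ∀ t, ENNReal.ofReal ε ^ (1 / P) * V ≤ n t := by
    intro t
    simp only [hn]
    rw [show ENNReal.ofReal ε ^ (1 / P) * V = ∫⁻ x in I, ENNReal.ofReal ε ^ (1 / P) by simp [hV]]
    refine lintegral_mono fun x => ENNReal.rpow_le_rpow ?_ hsP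
    rw [hge]; exact le_add_self
  have hn2 : ∀ t, n t ≤ ENNReal.ofReal (BG + ε) ^ (1 / P) * V := by
    intro t
    simp only [hn]
    rw [show ENNReal.ofReal (BG + ε) ^ (1 / P) * V = ∫⁻ x in I, ENNReal.ofReal (BG + ε) ^ (1 / P) by simp [hV]]
    refine lintegral_mono fun x => ENNReal.rpow_le_rpow (ENNReal.ofReal_le_ofReal ?_) hsP
    simp only [hg]; linarith [hBG (t, x)]
  set a : ℝ → ℝ := fun t => (n t ^ P).toReal with ha
  have hnt : ∀ t, n t ^ P ≠ ⊤ := fun t => ENNReal.rpow_ne_top_of_nonneg hP.le (ne_top_of_le_ne_top (by finiteness) (hn2 t))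
  have hae : ∀ t, ENNReal.ofReal (a t) = n t ^ P := fun t => ENNReal.ofReal_toReal (hnt t)
  set c := ((ENNReal.ofReal ε ^ (1 / P) * V) ^ P).toReal with hc
  set d := ((ENNReal.ofReal (BG + ε) ^ (1 / P) * V) ^ P).toReal with hd
  have hc0 : 0 < c := by
    refine ENNReal.toReal_pos ?_ (by finiteness)
    have h1 : ENNReal.ofReal ε ≠ 0 := by simpa using hε
    have h2 : ENNReal.ofReal ε ^ (1 / P) ≠ 0 := by
      rw [Ne, ENNReal.rpow_eq_zero_iff]; push Not; exact ⟨fun h => absurd h h1, fun h => absurd h (by simp)⟩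
    rw [Ne, ENNReal.rpow_eq_zero_iff_of_pos hP]
    exact mul_ne_zero h2 hV0
  have hac : ∀ t, c ≤ a t := fun t => ENNReal.toReal_mono (hnt t) (ENNReal.rpow_le_rpow (hn1 t) hP.le)
  have had : ∀ t, a t ≤ d := fun t => ENNReal.toReal_mono (by finiteness) (ENNReal.rpow_le_rpow (hn2 t) hP.le)
  have core := interp_core (b := b) (g := g) (a := a) (ε := min ε c) (B := max (Bf + ε) (max (BG + ε) d)) h0 h1 hP0 hQ0 (by assumption) (by assumption) hA0 hA1 rfl rfl hθ0 hθ1 eP eQ eA hP hQ hA hN hf hG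
    (lt_min hε hc0) (by simp only [hb]; fun_prop) (fun ξ => (min_le_left _ _).trans (by simp only [hb]; linarith [norm_nonneg (f ξ)]))
    (fun ξ => le_trans (by simp only [hb]; linarith [hBf ξ]) (le_max_left _ _)) (fun ξ => by simp only [hb]; linarith)
    hgm (by simp only [ha]; fun_prop) (fun ξ => (min_le_left _ _).trans (by simp only [hg]; linarith [norm_nonneg (G ξ)]))
    (fun ξ => le_trans (by simp only [hg]; linarith [hBG ξ]) ((le_max_left _ _).trans (le_max_right _ _))) (fun ξ => by simp only [hg]; linarith)
    (fun t => (min_le_right _ _).trans (hac t)) (fun t => (had t).trans ((le_max_right _ _).trans (le_max_right _ _)))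
    (fun t => by rw [hae, ← ENNReal.rpow_mul, mul_one_div_cancel hP.ne', ENNReal.rpow_one])
  refine core.trans ?_
  gcongr
  · simp only [hbe]
    refine (minkowski_const (volume.restrict If) (n := fun ξ => ‖f ξ‖ₑ) (by fun_prop) hA hA1').trans ?_
    rw [Measure.restrict_apply_univ]
    unfold Fn
    exact add_le_add (ENNReal.rpow_le_rpow (setLIntegral_le_lintegral _ _) hA.le) le_rfl
  · have hm1 : ∀ t, ENNReal.ofReal (a t) ≤ (∫⁻ x, ‖G (t, x)‖ₑ ^ (1 / P)) ^ P + ENNReal.ofReal (ε * (V ^ P).toReal) := by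
      intro t
      rw [hae]
      simp only [hn, hge]
      refine (minkowski_const (volume.restrict I) (n := fun x => ‖G (t, x)‖ₑ) (by fun_prop) hP hP1).trans ?_
      rw [Measure.restrict_apply_univ, ENNReal.ofReal_mul hε.le, ENNReal.ofReal_toReal (by finiteness)]
      exact add_le_add (ENNReal.rpow_le_rpow (setLIntegral_le_lintegral _ _) hP.le) le_rfl
    have hsQ : 0 ≤ 1 / Q := by positivity
    have hkm : Measurable fun t => (∫⁻ x, ‖G (t, x)‖ₑ ^ (1 / P)) ^ P :=
      (Measurable.lintegral_prod_right' (f := fun z : ℝ × ℝ => ‖G z‖ₑ ^ (1 / P)) (by fun_prop)).pow_const _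
    calc _ ≤ (∫⁻ t in I, ((∫⁻ x, ‖G (t, x)‖ₑ ^ (1 / P)) ^ P + ENNReal.ofReal (ε * (V ^ P).toReal)) ^ (1 / Q)) ^ Q := by
          refine ENNReal.rpow_le_rpow (lintegral_mono fun t => ENNReal.rpow_le_rpow (hm1 t) hsQ) hQ.le
      _ ≤ _ := (minkowski_const (volume.restrict I) hkm hQ hQ1)
      _ ≤ _ := by
          rw [Measure.restrict_apply_univ, ENNReal.ofReal_mul hε.le, ENNReal.ofReal_toReal (by finiteness), mul_assoc]
          refine add_le_add ?_ le_rfl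
          unfold Mn
          refine ENNReal.rpow_le_rpow ((setLIntegral_le_lintegral _ _).trans (le_of_eq ?_)) hQ.le
          refine lintegral_congr fun t => ?_
          rw [← ENNReal.rpow_mul, mul_one_div]

lemma est_HY {α P0 : ℝ} (h1 : 1 / 2 ≤ P0) (h2 : P0 ≤ 1) : ∃ M, Est α P0 1 M := by
  have hC := (est_C α).mono (le_max_left _ 1)
  have hO := (est_O α).mono (le_max_right (Real.sqrt (2 * Real.pi)).toNNReal 1)
  exact ⟨_, est_interp (θ := 2 * P0 - 1) hC hO (by norm_num) (by norm_num) (by norm_num) (by norm_num) (by norm_num) (by norm_num)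
    (by norm_num) (by norm_num) (by norm_num) (by norm_num) (by linarith) (by linarith) (by ring) (by ring)⟩

lemma est_edge' {α P : ℝ} (hα : 0 < α) (hP0 : 3 / 4 < P) (hP1 : P ≤ 1) : ∃ M : NNReal, Est α P (3 / 4) M := by
  rcases eq_or_lt_of_le hP1 with h | h
  · rw [h]; exact est_A hα
  · exact est_edge hα hP0 h

/-- All estimates needed. -/
lemma est_region {α P Q : ℝ} (hα : 0 < α) (hP1 : P ≤ 1) (hQ1 : Q ≤ 1) (hQ0 : 3 / 4 ≤ Q)
    (h : 3 / 4 < P ∨ (P ≤ 3 / 4 ∧ 3 / 2 < P + Q) ∨ (P = 1 / 2 ∧ Q = 1)) : ∃ M : NNReal, Est α P Q M := by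
  have go : ∀ P0 P1' : ℝ, 1 / 2 ≤ P0 → P0 ≤ 1 → 3 / 4 < P1' → P1' ≤ 1 → P = P0 + (4 * (1 - Q)) * (P1' - P0) → ∃ M : NNReal, Est α P Q M := by
    intro P0 P1' a1 a2 a3 a4 e
    obtain ⟨M0, h0⟩ := est_HY (α := α) a1 a2
    obtain ⟨M1, h1⟩ := est_edge' hα a3 a4
    exact ⟨_, est_interp (θ := 4 * (1 - Q)) (h0.mono (le_max_left M0 M1)) (h1.mono (le_max_right M0 M1)) (by linarith) (by norm_num)
      (by linarith) (by norm_num) (by linarith) (by linarith) a2 (by norm_num) a4 (by norm_num) (by linarith) (by linarith) e (by ring)⟩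
  rcases h with h | ⟨h, h'⟩ | ⟨rfl, rfl⟩
  · exact go P P (by linarith) hP1 h hP1 (by ring)
  · exact go (P - (1 - Q)) (P - (1 - Q) + 1 / 4) (by linarith) (by linarith) (by linarith) (by linarith) (by ring)
  · exact ⟨_, est_C α⟩


lemma NiceG.mono {N N' : ℝ} (h : N ≤ N') {G : ℝ × ℝ → ℂ} (hG : NiceG N G) : NiceG N' G :=
  ⟨hG.meas, hG.bdd, fun z hz => hG.supp z fun hz' => hz
    ⟨⟨by linarith [hz'.1.1], by linarith [hz'.1.2]⟩, ⟨by linarith [hz'.2.1], by linarith [hz'.2.2]⟩⟩⟩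

/-- weighted integrability of the pairing integrand -/
lemma integrable_pair {α Y N : ℝ} {f : ℝ → ℂ} {G : ℝ × ℝ → ℂ} (hf : Measurable f)
    (hfi : Integrable fun ξ => ((|ξ| ^ (α * Y) : ℝ) : ℂ) * f ξ) (hG : NiceG N G) :
    Integrable fun w : (ℝ × ℝ) × ℝ => KK α Y w.1.1 w.1.2 w.2 * f w.2 * G w.1 := by
  have h1 := hG.integrable.mul_prod hfi
  have hGm := hG.meas
  refine Integrable.mono h1 (by fun_prop : Measurable _).aestronglyMeasurable (Filter.Eventually.of_forall fun w => le_of_eq ?_)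
  rw [norm_mul, norm_mul, norm_KK, norm_mul, norm_mul, Complex.norm_real, Real.norm_of_nonneg (by positivity)]
  ring

lemma est_ext_pos {α P Q : ℝ} {M : NNReal} (h : Est α P Q M) (hA : 0 < 2 * Q + P - 2) {N : ℝ} {f : ℝ → ℂ} {G : ℝ × ℝ → ℂ} (hf : Measurable f)
    (hfi : Integrable fun ξ => ((|ξ| ^ (α * (1 - Q)) : ℝ) : ℂ) * f ξ) (hG : NiceG N G) (hf0 : ∀ ξ ≤ 0, f ξ = 0) :
    ‖pair α (1 - Q) f G‖ₑ ≤ M * Fn (2 * Q + P - 2) f * Mn P Q G := by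
  set R : ℕ → ℝ := fun n => n + 1 + |N| with hR
  have hR1 : ∀ n, 1 ≤ R n := fun n => by simp only [hR]; have := abs_nonneg N; have : (0:ℝ) ≤ n := n.cast_nonneg; linarith
  set S : ℕ → Set ℝ := fun n => Set.Icc (R n)⁻¹ (R n) ∩ {ξ | ‖f ξ‖ ≤ n} with hS
  have hSm : ∀ n, MeasurableSet (S n) := fun n => measurableSet_Icc.inter (measurableSet_le (by fun_prop) (by fun_prop))
  have hb : ∀ n ξ, ‖(S n).indicator f ξ‖ ≤ ‖f ξ‖ := fun n ξ => norm_indicator_le_norm_self _ _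
  have hest : ∀ n, ‖pair α (1 - Q) ((S n).indicator f) G‖ₑ ≤ M * Fn (2 * Q + P - 2) f * Mn P Q G := by
    intro n
    refine (h (R n) (by linarith [hR1 n]) _ G ⟨hf.indicator (hSm n), ⟨n, fun ξ => ?_⟩, fun ξ hξ => ?_⟩ (hG.mono ?_)).trans ?_
    · by_cases hξ : ξ ∈ S n
      · rw [Set.indicator_of_mem hξ]; exact hξ.2
      · rw [Set.indicator_of_notMem hξ]; simp
    · exact Set.indicator_of_notMem (fun h' => hξ h'.1) _
    · simp only [hR]; have := le_abs_self N; have : (0:ℝ) ≤ n := n.cast_nonneg; linarith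
    · gcongr
      unfold Fn
      gcongr with ξ
      exact enorm_le_iff_norm_le.2 (hb n ξ)
  refine le_of_tendsto (f := fun n => ‖pair α (1 - Q) ((S n).indicator f) G‖ₑ) (x := Filter.atTop) ?_ (Filter.Eventually.of_forall hest)
  refine (continuous_enorm.tendsto _).comp ?_
  unfold pair
  have hGm := hG.meas
  refine tendsto_integral_of_dominated_convergence (fun w => ‖KK α (1 - Q) w.1.1 w.1.2 w.2 * f w.2 * G w.1‖) ?_ (integrable_pair hf hfi hG).norm ?_ ?_
  · intro n
    have := hf.indicator (hSm n)
    exact (by fun_prop : Measurable _).aestronglyMeasurable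
  · intro n
    refine Filter.Eventually.of_forall fun w => ?_
    simp only [norm_mul]
    gcongr
    exact hb n _
  · refine Filter.Eventually.of_forall fun w => ?_
    refine tendsto_const_nhds.congr' ?_
    rcases le_or_gt w.2 0 with h0 | h0
    · refine Filter.Eventually.of_forall fun n => ?_
      have : (S n).indicator f w.2 = 0 := by
        have := hb n w.2
        rw [hf0 _ h0, norm_zero] at this
        exact norm_le_zero_iff.1 this
      simp only [this, hf0 _ h0]
    · have e1 : ∀ᶠ n : ℕ in Filter.atTop, ‖f w.2‖ ≤ n := tendsto_natCast_atTop_atTop.eventually_ge_atTop _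
      have e2 : ∀ᶠ n : ℕ in Filter.atTop, w.2 ≤ n := tendsto_natCast_atTop_atTop.eventually_ge_atTop _
      have e3 : ∀ᶠ n : ℕ in Filter.atTop, w.2⁻¹ ≤ n := tendsto_natCast_atTop_atTop.eventually_ge_atTop _
      filter_upwards [e1, e2, e3] with n h1 h2 h3
      have hN0 := abs_nonneg N
      have : w.2 ∈ S n := by
        refine ⟨⟨?_, by simp only [hR]; linarith⟩, h1⟩
        rw [inv_le_comm₀ (by linarith [hR1 n]) h0]
        simp only [hR]; linarith
      rw [Set.indicator_of_mem this]

lemma pair_neg (α Y : ℝ) (f : ℝ → ℂ) (G : ℝ × ℝ → ℂ) : pair α Y f G = pair α Y (fun ξ => f (-ξ)) (fun z => G (-z)) := by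
  unfold pair
  have mp : (volume : Measure ((ℝ × ℝ) × ℝ)).IsNegInvariant :=
    ⟨((((Measure.measurePreserving_neg (volume : Measure ℝ)).prod (Measure.measurePreserving_neg (volume : Measure ℝ))).prod
      (Measure.measurePreserving_neg (volume : Measure ℝ)))).map_eq⟩
  rw [← integral_neg_eq_self]
  refine integral_congr_ae (Filter.Eventually.of_forall fun w => ?_)
  have : KK α Y (-w).1.1 (-w).1.2 (-w).2 = KK α Y w.1.1 w.1.2 w.2 := by
    unfold KK omegaBO
    simp
  simp only [this]
  rfl

lemma Fn_neg (A : ℝ) (f : ℝ → ℂ) : Fn A (fun ξ => f (-ξ)) = Fn A f := by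
  unfold Fn
  rw [lintegral_neg_eq_self (fun ξ => ‖f ξ‖ₑ ^ (1 / A))]

lemma Mn_neg (P Q : ℝ) (G : ℝ × ℝ → ℂ) : Mn P Q (fun z => G (-z)) = Mn P Q G := by
  unfold Mn
  rw [← lintegral_neg_eq_self (fun t => (∫⁻ x, ‖G (t, x)‖ₑ ^ (1 / P)) ^ (P / Q))]
  congr 1
  refine lintegral_congr fun t => ?_
  rw [← lintegral_neg_eq_self (fun x => ‖G (-t, x)‖ₑ ^ (1 / P))]
  rfl

lemma est_ext {α P Q : ℝ} {M : NNReal} (h : Est α P Q M) (hA : 0 < 2 * Q + P - 2) {N : ℝ} {f : ℝ → ℂ} {G : ℝ × ℝ → ℂ} (hf : Measurable f)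
    (hfi : Integrable fun ξ => ((|ξ| ^ (α * (1 - Q)) : ℝ) : ℂ) * f ξ) (hG : NiceG N G) :
    ‖pair α (1 - Q) f G‖ₑ ≤ 2 * M * Fn (2 * Q + P - 2) f * Mn P Q G := by
  have hGm := hG.meas
  set fp := (Set.Ioi (0:ℝ)).indicator f with hfp
  set fm := (Set.Iio (0:ℝ)).indicator f with hfm
  have hpm : Measurable fp := hf.indicator measurableSet_Ioi
  have hmm : Measurable fm := hf.indicator measurableSet_Iio
  have hpi : Integrable fun ξ => ((|ξ| ^ (α * (1 - Q)) : ℝ) : ℂ) * fp ξ := by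
    refine hfi.mono (by fun_prop : Measurable _).aestronglyMeasurable (Filter.Eventually.of_forall fun ξ => ?_)
    simp only [norm_mul]; gcongr; exact norm_indicator_le_norm_self _ _
  have hmi : Integrable fun ξ => ((|ξ| ^ (α * (1 - Q)) : ℝ) : ℂ) * fm ξ := by
    refine hfi.mono (by fun_prop : Measurable _).aestronglyMeasurable (Filter.Eventually.of_forall fun ξ => ?_)
    simp only [norm_mul]; gcongr; exact norm_indicator_le_norm_self _ _
  have hFp : Fn (2 * Q + P - 2) fp ≤ Fn (2 * Q + P - 2) f := by
    unfold Fn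
    gcongr with ξ
    exact enorm_le_iff_norm_le.2 (norm_indicator_le_norm_self _ _)
  have hFm : Fn (2 * Q + P - 2) fm ≤ Fn (2 * Q + P - 2) f := by
    unfold Fn
    gcongr with ξ
    exact enorm_le_iff_norm_le.2 (norm_indicator_le_norm_self _ _)
  have hsum : pair α (1 - Q) f G = pair α (1 - Q) fp G + pair α (1 - Q) fm G := by
    unfold pair
    rw [← integral_add (integrable_pair hpm hpi hG) (integrable_pair hmm hmi hG)]
    refine integral_congr_ae ?_
    have : ∀ᵐ w : (ℝ × ℝ) × ℝ, w.2 ≠ 0 := by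
      have h0 : ∀ᵐ ξ : ℝ, ξ ≠ 0 := by simp [ae_iff, measure_singleton]
      exact (Measure.quasiMeasurePreserving_snd (μ := (volume : Measure (ℝ × ℝ))) (ν := (volume : Measure ℝ))).ae h0
    filter_upwards [this] with w hw
    rcases lt_or_gt_of_ne hw with h' | h'
    · simp [hfp, hfm, h', h'.le, not_lt.2 h'.le]
    · simp [hfp, hfm, h', h'.le, not_lt.2 h'.le]
  have e1 := est_ext_pos h hA hpm hpi hG (fun ξ hξ => Set.indicator_of_notMem (by simpa using hξ) _)
  have hGn : NiceG N (fun z => G (-z)) := by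
    obtain ⟨B, hB⟩ := hG.bdd
    refine ⟨by fun_prop, ⟨B, fun z => hB _⟩, fun z hz => hG.supp _ fun hz' => hz ?_⟩
    obtain ⟨⟨a, b⟩, c, d⟩ := hz'
    simp only [Prod.fst_neg, Prod.snd_neg] at a b c d
    exact ⟨⟨by linarith, by linarith⟩, by linarith, by linarith⟩
  have e2 := est_ext_pos h hA (f := fun ξ => fm (-ξ)) (by fun_prop) (by simpa using hmi.comp_neg) hGn
    (fun ξ hξ => Set.indicator_of_notMem (by simpa using hξ) _)
  rw [← pair_neg, Fn_neg, Mn_neg] at e2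
  rw [hsum]
  calc _ ≤ _ := enorm_add_le _ _
    _ ≤ _ := add_le_add e1 e2
    _ ≤ M * Fn (2 * Q + P - 2) f * Mn P Q G + M * Fn (2 * Q + P - 2) f * Mn P Q G := by gcongr
    _ = _ := by ring


open scoped FourierTransform in
lemma ft2_eq (u : SchwartzMap (ℝ × ℝ) ℂ) (ξ τ : ℝ) :
    ft2 u ξ τ = (𝓕 (SchwartzMap.compCLMOfContinuousLinearEquiv ℂ Complex.equivRealProdCLM u : SchwartzMap ℂ ℂ))
      (⟨τ / (2 * Real.pi), ξ / (2 * Real.pi)⟩ : ℂ) := by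
  rw [SchwartzMap.fourier_coe, Real.fourier_eq']
  unfold ft2
  rw [← (Complex.volume_preserving_equiv_real_prod).integral_comp Complex.measurableEquivRealProd.measurableEmbedding]
  refine integral_congr_ae (Filter.Eventually.of_forall fun z => ?_)
  simp only [SchwartzMap.compCLMOfContinuousLinearEquiv_apply, Function.comp_apply, smul_eq_mul, Complex.measurableEquivRealProd_apply,
    Complex.equivRealProdCLM_apply]
  congr 1
  congr 1
  have : inner ℝ z (⟨τ / (2 * Real.pi), ξ / (2 * Real.pi)⟩ : ℂ) = (z.re * τ + z.im * ξ) / (2 * Real.pi) := by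
    rw [Complex.inner]; simp; ring
  rw [this]
  have hp : (Real.pi : ℂ) ≠ 0 := by exact_mod_cast Real.pi_ne_zero
  push_cast
  field_simp

lemma continuous_ft2 (u : SchwartzMap (ℝ × ℝ) ℂ) : Continuous fun q : ℝ × ℝ => ft2 u q.1 q.2 := by
  simp only [ft2_eq]
  refine (SchwartzMap.continuous _).comp ?_
  have : (fun q : ℝ × ℝ => (⟨q.2 / (2 * Real.pi), q.1 / (2 * Real.pi)⟩ : ℂ)) = fun q => Complex.equivRealProdCLM.symm (q.2 / (2 * Real.pi), q.1 / (2 * Real.pi)) := by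
    ext q; simp [Complex.ext_iff]
  rw [this]
  fun_prop

lemma schwartz_decay {E : Type*} [NormedAddCommGroup E] [NormedSpace ℝ E] (f : SchwartzMap E ℂ) (k : ℕ) :
    ∃ C : ℝ, 0 ≤ C ∧ ∀ x, (1 + ‖x‖) ^ k * ‖f x‖ ≤ C := by
  have h := fun x => SchwartzMap.one_add_le_sup_seminorm_apply (𝕜 := ℂ) (m := (k, 0)) le_rfl le_rfl f x
  simp only [norm_iteratedFDeriv_zero] at h
  exact ⟨_, le_trans (by positivity) (h 0), h⟩

lemma ft2_decay (u : SchwartzMap (ℝ × ℝ) ℂ) :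
    ∃ C : ℝ, 0 ≤ C ∧ ∀ ξ τ, ‖ft2 u ξ τ‖ ≤ C * ((1 + |ξ|) ^ (-3 : ℝ) * (1 + |τ|) ^ (-2 : ℝ)) := by
  obtain ⟨C, hC0, hC⟩ := schwartz_decay (FourierTransform.fourier (SchwartzMap.compCLMOfContinuousLinearEquiv ℂ Complex.equivRealProdCLM u : SchwartzMap ℂ ℂ) : SchwartzMap ℂ ℂ) 5
  refine ⟨(2 * Real.pi) ^ 5 * C, by positivity, fun ξ τ => ?_⟩
  have h := hC (⟨τ / (2 * Real.pi), ξ / (2 * Real.pi)⟩ : ℂ)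
  rw [← ft2_eq] at h
  set w : ℂ := ⟨τ / (2 * Real.pi), ξ / (2 * Real.pi)⟩ with hw
  have hpi : 1 ≤ 2 * Real.pi := by linarith [Real.pi_gt_three]
  have h1 : |ξ| / (2 * Real.pi) ≤ ‖w‖ := by
    have := Complex.abs_im_le_norm w
    simpa [hw, abs_div, abs_of_pos Real.pi_pos] using this
  have h2 : |τ| / (2 * Real.pi) ≤ ‖w‖ := by
    have := Complex.abs_re_le_norm w
    simpa [hw, abs_div, abs_of_pos Real.pi_pos] using this
  have h1' : 1 + |ξ| ≤ (2 * Real.pi) * (1 + ‖w‖) := by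
    rw [div_le_iff₀ (by positivity)] at h1; linarith
  have h2' : 1 + |τ| ≤ (2 * Real.pi) * (1 + ‖w‖) := by
    rw [div_le_iff₀ (by positivity)] at h2; linarith
  have h3 : (1 + |ξ|) ^ 3 * (1 + |τ|) ^ 2 ≤ (2 * Real.pi) ^ 5 * (1 + ‖w‖) ^ 5 := by
    calc _ ≤ ((2 * Real.pi) * (1 + ‖w‖)) ^ 3 * ((2 * Real.pi) * (1 + ‖w‖)) ^ 2 := by gcongr
      _ = _ := by ring
  have e1 : (1 + |ξ|) ^ (-3 : ℝ) = ((1 + |ξ|) ^ 3)⁻¹ := by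
    rw [Real.rpow_neg (by positivity)]; norm_cast
  have e2 : (1 + |τ|) ^ (-2 : ℝ) = ((1 + |τ|) ^ 2)⁻¹ := by
    rw [Real.rpow_neg (by positivity)]; norm_cast
  rw [e1, e2, ← mul_inv, ← div_eq_mul_inv, le_div_iff₀ (by positivity)]
  calc _ ≤ ‖ft2 u ξ τ‖ * ((2 * Real.pi) ^ 5 * (1 + ‖w‖) ^ 5) := by gcongr
    _ = (2 * Real.pi) ^ 5 * ((1 + ‖w‖) ^ 5 * ‖ft2 u ξ τ‖) := by ring
    _ ≤ _ := by gcongr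

lemma integrable_two : Integrable fun x : ℝ => (1 + |x|) ^ (-2 : ℝ) := by
  have := integrable_one_add_norm (E := ℝ) (μ := volume) (r := 2) (by simp)
  simpa using this

/-- partial Fourier transform in space -/
noncomputable def hh (u : ℝ × ℝ → ℂ) (ξ t : ℝ) : ℂ :=
  ∫ y : ℝ, Complex.exp (-Complex.I * ((y * ξ : ℝ) : ℂ)) * u (t, y)

lemma norm_expnI (x : ℝ) : ‖Complex.exp (-Complex.I * (x : ℂ))‖ = 1 := by
  rw [Complex.norm_exp]; simp

lemma hh_cont (u : SchwartzMap (ℝ × ℝ) ℂ) (ξ : ℝ) : Continuous (hh u ξ) := by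
  obtain ⟨C, hC0, hC⟩ := schwartz_decay u 2
  unfold hh
  refine continuous_of_dominated (bound := fun y => C * (1 + |y|) ^ (-2 : ℝ)) ?_ ?_ (integrable_two.const_mul C) ?_
  · intro t
    have := u.continuous
    exact (by fun_prop : Continuous _).aestronglyMeasurable
  · intro t
    refine Filter.Eventually.of_forall fun y => ?_
    rw [norm_mul, norm_expnI, one_mul]
    rw [Real.rpow_neg (by positivity), ← div_eq_mul_inv, le_div_iff₀ (by positivity)]
    refine le_trans ?_ (hC (t, y))
    rw [mul_comm]
    have : |y| ≤ ‖(t, y)‖ := by rw [← Real.norm_eq_abs]; exact norm_snd_le (t, y)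
    norm_cast
    gcongr
  · refine Filter.Eventually.of_forall fun y => ?_
    have := u.continuous
    fun_prop

lemma hh_int (u : SchwartzMap (ℝ × ℝ) ℂ) (ξ : ℝ) : Integrable (hh u ξ) := by
  unfold hh
  have hu : Integrable (fun z : ℝ × ℝ => Complex.exp (-Complex.I * ((z.2 * ξ : ℝ) : ℂ)) * u z) (volume.prod volume) := by
    have := u.continuous
    refine u.integrable.mono (by fun_prop : Continuous _).aestronglyMeasurable (Filter.Eventually.of_forall fun z => ?_)
    rw [norm_mul, norm_expnI, one_mul]
  exact hu.integral_prod_left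

open scoped FourierTransform in
lemma hh_ft (u : SchwartzMap (ℝ × ℝ) ℂ) (ξ s : ℝ) : 𝓕 (hh u ξ) s = ft2 u ξ (2 * Real.pi * s) := by
  rw [Real.fourier_real_eq_integral_exp_smul]
  unfold hh ft2
  have hu : Integrable (fun p : ℝ × ℝ => Complex.exp (-Complex.I * ((p.1 * (2 * Real.pi * s) + p.2 * ξ : ℝ) : ℂ)) * u p) (volume.prod volume) := by
    have := u.continuous
    refine u.integrable.mono (by fun_prop : Continuous _).aestronglyMeasurable (Filter.Eventually.of_forall fun z => ?_)
    rw [norm_mul, norm_expnI, one_mul]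
  rw [Measure.volume_eq_prod, integral_prod _ hu]
  refine integral_congr_ae (Filter.Eventually.of_forall fun t => ?_)
  simp only [smul_eq_mul]
  rw [← integral_const_mul]
  refine integral_congr_ae (Filter.Eventually.of_forall fun y => ?_)
  simp only
  rw [← mul_assoc, ← Complex.exp_add]
  congr 2
  push_cast; ring

lemma ft2_int (u : SchwartzMap (ℝ × ℝ) ℂ) (ξ : ℝ) : Integrable (ft2 u ξ) := by
  obtain ⟨C, hC0, hC⟩ := ft2_decay u
  have hc : Continuous (ft2 u ξ) := (continuous_ft2 u).comp (by fun_prop : Continuous fun τ : ℝ => (ξ, τ))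
  refine (integrable_two.const_mul (C * (1 + |ξ|) ^ (-3 : ℝ))).mono' hc.aestronglyMeasurable (Filter.Eventually.of_forall fun τ => ?_)
  rw [mul_assoc]; exact hC ξ τ

open scoped FourierTransform in
lemma hh_inv (u : SchwartzMap (ℝ × ℝ) ℂ) (ξ t : ℝ) :
    hh u ξ t = ((2 * Real.pi)⁻¹ : ℝ) * ∫ τ : ℝ, Complex.exp (Complex.I * ((t * τ : ℝ) : ℂ)) * ft2 u ξ τ := by
  have hpi : (2 * Real.pi) ≠ 0 := by positivity
  have e : 𝓕 (hh u ξ) = fun s => ft2 u ξ (2 * Real.pi * s) := funext fun s => hh_ft u ξ s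
  have h := (hh_cont u ξ).fourierInv_fourier_eq (hh_int u ξ) (by
    rw [e]; exact (ft2_int u ξ).comp_mul_left' hpi)
  rw [← congrFun h t, e, Real.fourierInv_eq']
  have := Measure.integral_comp_mul_left (fun τ => Complex.exp (Complex.I * ((t * τ : ℝ) : ℂ)) * ft2 u ξ τ) (2 * Real.pi)
  rw [abs_of_pos (by positivity)] at this
  rw [Complex.real_smul] at this
  rw [← this]
  refine integral_congr_ae (Filter.Eventually.of_forall fun s => ?_)
  simp only [smul_eq_mul]
  congr 2
  simp
  ring


lemma shear_mp (α : ℝ) : MeasurePreserving (fun q : ℝ × ℝ => (q.1, q.2 + omegaBO α q.1)) volume volume := by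
  have hm := measurable_omegaBO α
  have := (MeasurePreserving.id (volume : Measure ℝ)).skew_product (μc := (volume : Measure ℝ)) (μd := volume)
    (g := fun ξ l => l + omegaBO α ξ) (by simp only [Function.uncurry_def]; fun_prop)
    (Filter.Eventually.of_forall fun ξ => (measurePreserving_add_right volume (omegaBO α ξ)).map_eq)
  exact this

lemma weight_le {θ ξ : ℝ} (h0 : 0 ≤ θ) (h1 : θ ≤ 1) : |ξ| ^ θ * (1 + |ξ|) ^ (-3 : ℝ) ≤ (1 + |ξ|) ^ (-2 : ℝ) := by
  have hp : 0 < 1 + |ξ| := by positivity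
  calc _ ≤ (1 + |ξ|) ^ (1:ℝ) * (1 + |ξ|) ^ (-3 : ℝ) := by
        gcongr
        calc |ξ| ^ θ ≤ (1 + |ξ|) ^ θ := Real.rpow_le_rpow (abs_nonneg _) (by linarith) h0
          _ ≤ _ := Real.rpow_le_rpow_of_exponent_le (by linarith [abs_nonneg ξ]) h1
    _ = _ := by rw [← Real.rpow_add hp]; norm_num

/-- The slices of the space-time Fourier transform. -/
noncomputable def sl (α : ℝ) (u : ℝ × ℝ → ℂ) (l ξ : ℝ) : ℂ := ft2 u ξ (l + omegaBO α ξ)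

lemma measurable_sl2 (α : ℝ) (u : SchwartzMap (ℝ × ℝ) ℂ) : Measurable fun q : ℝ × ℝ => sl α u q.2 q.1 := by
  unfold sl
  have hm := measurable_omegaBO α
  exact Measurable.comp (g := fun q : ℝ × ℝ => ft2 u q.1 q.2) (f := fun q : ℝ × ℝ => (q.1, q.2 + omegaBO α q.1))
    (continuous_ft2 u).measurable (by fun_prop)

lemma measurable_sl (α : ℝ) (u : SchwartzMap (ℝ × ℝ) ℂ) (l : ℝ) : Measurable (sl α u l) :=
  Measurable.comp (g := fun q : ℝ × ℝ => sl α u q.2 q.1) (f := fun ξ : ℝ => (ξ, l)) (measurable_sl2 α u) (by fun_prop)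

lemma sl_wint {α θ : ℝ} (h0 : 0 ≤ θ) (h1 : θ ≤ 1) (u : SchwartzMap (ℝ × ℝ) ℂ) (l : ℝ) :
    Integrable fun ξ => ((|ξ| ^ θ : ℝ) : ℂ) * sl α u l ξ := by
  obtain ⟨C, hC0, hC⟩ := ft2_decay u
  have := measurable_sl α u l
  refine (integrable_two.const_mul C).mono' (by fun_prop : Measurable _).aestronglyMeasurable (Filter.Eventually.of_forall fun ξ => ?_)
  rw [norm_mul, Complex.norm_real, Real.norm_of_nonneg (by positivity)]
  have h2 := hC ξ (l + omegaBO α ξ)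
  have h3 : (1 + |l + omegaBO α ξ|) ^ (-2 : ℝ) ≤ 1 :=
    Real.rpow_le_one_of_one_le_of_nonpos (by linarith [abs_nonneg (l + omegaBO α ξ)]) (by norm_num)
  have h4 := weight_le (ξ := ξ) h0 h1
  calc |ξ| ^ θ * ‖sl α u l ξ‖ ≤ |ξ| ^ θ * (C * ((1 + |ξ|) ^ (-3 : ℝ) * 1)) := by
        gcongr
        exact h2.trans (by gcongr)
    _ = C * (|ξ| ^ θ * (1 + |ξ|) ^ (-3 : ℝ)) := by ring
    _ ≤ _ := by gcongr

lemma sl_int2 {α θ : ℝ} (h0 : 0 ≤ θ) (h1 : θ ≤ 1) (u : SchwartzMap (ℝ × ℝ) ℂ) :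
    Integrable fun q : ℝ × ℝ => ((|q.1| ^ θ : ℝ) : ℂ) * sl α u q.2 q.1 := by
  obtain ⟨C, hC0, hC⟩ := ft2_decay u
  have hm := (continuous_ft2 u).measurable
  have h : Integrable fun q : ℝ × ℝ => ((|q.1| ^ θ : ℝ) : ℂ) * ft2 u q.1 q.2 := by
    have := (integrable_two.mul_prod integrable_two).const_mul C
    refine this.mono' (by fun_prop : Measurable _).aestronglyMeasurable (Filter.Eventually.of_forall fun q => ?_)
    rw [norm_mul, Complex.norm_real, Real.norm_of_nonneg (by positivity)]
    have h4 := weight_le (ξ := q.1) h0 h1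
    calc |q.1| ^ θ * ‖ft2 u q.1 q.2‖ ≤ |q.1| ^ θ * (C * ((1 + |q.1|) ^ (-3 : ℝ) * (1 + |q.2|) ^ (-2 : ℝ))) := by
          gcongr; exact hC _ _
      _ = C * ((|q.1| ^ θ * (1 + |q.1|) ^ (-3 : ℝ)) * (1 + |q.2|) ^ (-2 : ℝ)) := by ring
      _ ≤ _ := by gcongr
  exact ((shear_mp α).integrable_comp h.aestronglyMeasurable).2 h

lemma DxProp_eq (α Y : ℝ) (u : SchwartzMap (ℝ × ℝ) ℂ) (t x : ℝ) :
    DxProp (α * Y) u t x = (((2 * Real.pi)⁻¹ : ℝ) : ℂ) * ((((2 * Real.pi)⁻¹ : ℝ) : ℂ) *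
      ∫ ξ, ∫ l, KK α Y t x ξ * sl α u l ξ * Complex.exp (Complex.I * ((t * l : ℝ) : ℂ))) := by
  unfold DxProp
  congr 1
  rw [← integral_const_mul]
  refine integral_congr_ae (Filter.Eventually.of_forall fun ξ => ?_)
  have h := hh_inv u ξ t
  unfold hh at h
  simp only
  rw [h, ← integral_add_right_eq_self _ (omegaBO α ξ), mul_left_comm, ← integral_const_mul]
  congr 1
  refine integral_congr_ae (Filter.Eventually.of_forall fun l => ?_)
  simp only [KK, sl]
  have : Complex.exp (Complex.I * ((t * (l + omegaBO α ξ) : ℝ) : ℂ)) * Complex.exp (Complex.I * ((x * ξ : ℝ) : ℂ)) =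
    Complex.exp (Complex.I * ((x * ξ + t * omegaBO α ξ : ℝ) : ℂ)) * Complex.exp (Complex.I * ((t * l : ℝ) : ℂ)) := by
    rw [← Complex.exp_add, ← Complex.exp_add]
    congr 1; push_cast; ring
  linear_combination ((|ξ| ^ (α * Y) : ℝ) : ℂ) * ft2 u ξ (l + omegaBO α ξ) * this

lemma DxProp_bdd {α Y : ℝ} (h0 : 0 ≤ α * Y) (h1 : α * Y ≤ 1) (u : SchwartzMap (ℝ × ℝ) ℂ) :
    ∃ B : ℝ, ∀ t x, ‖DxProp (α * Y) u t x‖ ≤ B := by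
  refine ⟨(2 * Real.pi)⁻¹ * ((2 * Real.pi)⁻¹ * ∫ ξ, ∫ l, ‖((|ξ| ^ (α * Y) : ℝ) : ℂ) * sl α u l ξ‖), fun t x => ?_⟩
  rw [DxProp_eq, norm_mul, norm_mul, Complex.norm_real, Real.norm_of_nonneg (by positivity)]
  gcongr
  have hi := sl_int2 (α := α) h0 h1 u
  have hi2 := hi.norm.integral_prod_left
  refine norm_integral_le_of_norm_le hi2 (Filter.Eventually.of_forall fun ξ => ?_)
  refine (norm_integral_le_integral_norm _).trans (le_of_eq ?_)
  refine integral_congr_ae (Filter.Eventually.of_forall fun l => ?_)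
  simp only [norm_mul, norm_KK, norm_expI, Complex.norm_real, mul_one]
  rw [Real.norm_of_nonneg (by positivity)]

lemma DxProp_meas (α Y : ℝ) (u : SchwartzMap (ℝ × ℝ) ℂ) :
    Measurable fun z : ℝ × ℝ => DxProp (α * Y) u z.1 z.2 := by
  simp only [DxProp_eq]
  refine Measurable.const_mul (Measurable.const_mul ?_ _) _
  have hm := measurable_sl2 α u
  have h1 : StronglyMeasurable fun w : (ℝ × ℝ) × ℝ => ∫ l, KK α Y w.1.1 w.1.2 w.2 * sl α u l w.2 * Complex.exp (Complex.I * ((w.1.1 * l : ℝ) : ℂ)) := by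
    refine StronglyMeasurable.integral_prod_right' (f := fun v : ((ℝ × ℝ) × ℝ) × ℝ => KK α Y v.1.1.1 v.1.1.2 v.1.2 * sl α u v.2 v.1.2 * Complex.exp (Complex.I * ((v.1.1.1 * v.2 : ℝ) : ℂ))) ?_
    have : Measurable fun v : ((ℝ × ℝ) × ℝ) × ℝ => sl α u v.2 v.1.2 := 
      Measurable.comp (g := fun q : ℝ × ℝ => sl α u q.2 q.1) (f := fun v : ((ℝ × ℝ) × ℝ) × ℝ => (v.1.2, v.2)) hm (by fun_prop)
    exact (by fun_prop : Measurable _).stronglyMeasurable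
  exact (StronglyMeasurable.integral_prod_right' h1).measurable

lemma pairing_le {α P Q : ℝ} {M : NNReal} (h : Est α P Q M) (hA : 0 < 2 * Q + P - 2) (h0 : 0 ≤ α * (1 - Q)) (h1 : α * (1 - Q) ≤ 1)
    (u : SchwartzMap (ℝ × ℝ) ℂ) {N : ℝ} {G : ℝ × ℝ → ℂ} (hG : NiceG N G) :
    ‖∫ z : ℝ × ℝ, DxProp (α * (1 - Q)) u z.1 z.2 * G z‖ₑ ≤
      2 * M * (∫⁻ l, Fn (2 * Q + P - 2) (sl α u l)) * Mn P Q G := by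
  set Y := 1 - Q with hY
  have hGm := hG.meas
  set c : ℂ := (((2 * Real.pi)⁻¹ : ℝ) : ℂ) with hc
  set H : (ℝ × ℝ) × (ℝ × ℝ) → ℂ := fun w => KK α Y w.1.1 w.1.2 w.2.1 * sl α u w.2.2 w.2.1 * Complex.exp (Complex.I * ((w.1.1 * w.2.2 : ℝ) : ℂ)) * G w.1 with hH
  have hm := measurable_sl2 α u
  have hHm : Measurable H := by
    have : Measurable fun w : (ℝ × ℝ) × (ℝ × ℝ) => sl α u w.2.2 w.2.1 :=
      Measurable.comp (g := fun q : ℝ × ℝ => sl α u q.2 q.1) (f := fun w : (ℝ × ℝ) × (ℝ × ℝ) => w.2) hm measurable_snd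
    simp only [hH]; fun_prop
  have hHi : Integrable H (volume.prod volume) := by
    have := hG.integrable.mul_prod (sl_int2 (α := α) h0 h1 u)
    refine this.mono hHm.aestronglyMeasurable (Filter.Eventually.of_forall fun w => le_of_eq ?_)
    simp only [hH, norm_mul, norm_KK, norm_expI, Complex.norm_real, mul_one]
    rw [Real.norm_of_nonneg (by positivity)]; ring
  have e1 : (∫ z : ℝ × ℝ, DxProp (α * Y) u z.1 z.2 * G z) = c * c * ∫ z : ℝ × ℝ, ∫ y : ℝ × ℝ, H (z, y) := by
    rw [← integral_const_mul]
    refine integral_congr_ae ?_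
    filter_upwards [hHi.prod_right_ae] with z hz
    rw [DxProp_eq]
    rw [Measure.volume_eq_prod, integral_prod _ hz]
    rw [mul_assoc, mul_assoc, mul_assoc, ← integral_mul_const]
    congr 2
    refine integral_congr_ae (Filter.Eventually.of_forall fun ξ => ?_)
    simp only
    rw [← integral_mul_const]
  have e2 : (∫ z : ℝ × ℝ, ∫ y : ℝ × ℝ, H (z, y)) = ∫ l : ℝ, ∫ ξ : ℝ, ∫ z : ℝ × ℝ, H (z, (ξ, l)) := by
    rw [integral_integral_swap (f := fun z y => H (z, y)) hHi]
    have := hHi.integral_prod_right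
    rw [Measure.volume_eq_prod ℝ ℝ] at this ⊢
    rw [integral_prod_symm _ this]
  have e3 : ∀ l, (∫ ξ : ℝ, ∫ z : ℝ × ℝ, H (z, (ξ, l))) = pair α Y (sl α u l) (fun z => Complex.exp (Complex.I * ((z.1 * l : ℝ) : ℂ)) * G z) := by
    intro l
    have hGl : NiceG N (fun z => Complex.exp (Complex.I * ((z.1 * l : ℝ) : ℂ)) * G z) :=
      hG.mul (by fun_prop) (B := 1) fun z _ => (norm_expI _).le
    unfold pair
    rw [Measure.volume_eq_prod (ℝ × ℝ) ℝ, integral_prod_symm _ (integrable_pair (measurable_sl α u l) (sl_wint h0 h1 u l) hGl)]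
    refine integral_congr_ae (Filter.Eventually.of_forall fun ξ => ?_)
    refine integral_congr_ae (Filter.Eventually.of_forall fun z => ?_)
    simp only [hH]; ring
  have e4 : ∀ l, ‖∫ ξ : ℝ, ∫ z : ℝ × ℝ, H (z, (ξ, l))‖ₑ ≤ 2 * M * Fn (2 * Q + P - 2) (sl α u l) * Mn P Q G := by
    intro l
    rw [e3]
    have hGl : NiceG N (fun z => Complex.exp (Complex.I * ((z.1 * l : ℝ) : ℂ)) * G z) :=
      hG.mul (by fun_prop) (B := 1) fun z _ => (norm_expI _).le
    refine (est_ext h hA (measurable_sl α u l) (sl_wint h0 h1 u l) hGl).trans (le_of_eq ?_)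
    congr 1
    unfold Mn
    simp only [enorm_mul]
    have : ∀ s : ℝ, ‖Complex.exp (Complex.I * (s : ℂ))‖ₑ = 1 := fun s => by rw [← ofReal_norm, norm_expI]; simp
    simp only [this, one_mul]
  have hFm : Measurable fun l => Fn (2 * Q + P - 2) (sl α u l) := by
    unfold Fn
    refine Measurable.pow_const ?_ _
    exact Measurable.lintegral_prod_left' (f := fun q : ℝ × ℝ => ‖sl α u q.2 q.1‖ₑ ^ (1 / (2 * Q + P - 2))) (by fun_prop)
  have hc1 : ‖c * c‖ₑ ≤ 1 := by
    have hpi : 1 ≤ 2 * Real.pi := by linarith [Real.pi_gt_three]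
    have : ‖c‖ ≤ 1 := by
      rw [hc, Complex.norm_real, Real.norm_of_nonneg (by positivity)]
      exact inv_le_one_of_one_le₀ hpi
    rw [← ofReal_norm, norm_mul]
    refine ENNReal.ofReal_le_one.2 ?_
    nlinarith [norm_nonneg c]
  rw [e1, e2, enorm_mul]
  calc _ ≤ 1 * ∫⁻ l, ‖∫ ξ : ℝ, ∫ z : ℝ × ℝ, H (z, (ξ, l))‖ₑ := by gcongr; exact enorm_integral_le_lintegral_enorm _
    _ ≤ 1 * ∫⁻ l, 2 * M * Fn (2 * Q + P - 2) (sl α u l) * Mn P Q G := by gcongr with l; exact e4 l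
    _ = _ := by
      rw [one_mul, lintegral_mul_const _ (by fun_prop), lintegral_const_mul _ hFm]

lemma jap_pos (x : ℝ) : 0 < jap x := by unfold jap; positivity

lemma measurable_jap : Measurable jap := by unfold jap; fun_prop

lemma slices_le {α A b : ℝ} (hA0 : 0 < A) (hA1 : A < 1) (hb : 1 - A < b) : ∃ C : NNReal, ∀ u : SchwartzMap (ℝ × ℝ) ℂ,
    (∫⁻ l, Fn A (sl α u l)) ≤ C * (∫⁻ q : ℝ × ℝ, (ENNReal.ofReal (jap (q.2 - omegaBO α q.1) ^ b) * ‖ft2 u q.1 q.2‖ₑ) ^ (1 / A)) ^ A := by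
  have hj := measurable_jap
  have hom := measurable_omegaBO α
  have hA2 : 0 < 1 - A := by linarith
  set K : ℝ≥0∞ := (∫⁻ l, ENNReal.ofReal (jap l ^ (-b)) ^ (1 / (1 - A))) ^ (1 - A) with hK
  have hKt : K ≠ ⊤ := by
    refine ENNReal.rpow_ne_top_of_nonneg hA2.le ?_
    have hi := integrable_rpow_neg_one_add_norm_sq (E := ℝ) (μ := volume) (r := b / (1 - A)) (by
      simp; rwa [lt_div_iff₀ hA2, one_mul])
    refine ne_top_of_le_ne_top hi.hasFiniteIntegral.ne (le_of_eq (lintegral_congr fun l => ?_))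
    rw [← ofReal_norm, ENNReal.ofReal_rpow_of_nonneg (by have := jap_pos l; positivity) (by positivity)]
    congr 1
    rw [Real.norm_of_nonneg (by positivity)]
    unfold jap
    rw [← Real.rpow_mul (by positivity), ← Real.rpow_mul (by positivity)]
    simp only [Real.norm_eq_abs, sq_abs]
    congr 1
    field_simp
  refine ⟨K.toNNReal, fun u => ?_⟩
  rw [ENNReal.coe_toNNReal hKt]
  have hm := measurable_sl2 α u
  have hFm : Measurable fun l => Fn A (sl α u l) := by
    unfold Fn
    refine Measurable.pow_const ?_ _
    exact Measurable.lintegral_prod_left' (f := fun q : ℝ × ℝ => ‖sl α u q.2 q.1‖ₑ ^ (1 / A)) (by fun_prop)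
  have e1 : ∀ l, Fn A (sl α u l) = ENNReal.ofReal (jap l ^ (-b)) * (ENNReal.ofReal (jap l ^ b) * Fn A (sl α u l)) := by
    intro l
    have := jap_pos l
    rw [← mul_assoc, ← ENNReal.ofReal_mul (by positivity), ← Real.rpow_add this]
    simp
  have hconj : (1 / (1 - A)).HolderConjugate (1 / A) := by
    rw [Real.holderConjugate_iff]
    refine ⟨by rw [lt_div_iff₀ hA2]; linarith, by simp⟩
  have hol := ENNReal.lintegral_mul_le_Lp_mul_Lq volume hconj (f := fun l => ENNReal.ofReal (jap l ^ (-b)))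
    (g := fun l => ENNReal.ofReal (jap l ^ b) * Fn A (sl α u l)) (by fun_prop) (by fun_prop)
  simp only [Pi.mul_apply, ← e1, one_div_one_div] at hol
  refine hol.trans ?_
  rw [← hK]
  gcongr K * ?_ ^ A
  have hg : Measurable fun q : ℝ × ℝ => (ENNReal.ofReal (jap (q.2 - omegaBO α q.1) ^ b) * ‖ft2 u q.1 q.2‖ₑ) ^ (1 / A) := by
    have := (continuous_ft2 u).measurable
    fun_prop
  rw [← (shear_mp α).lintegral_comp hg, Measure.volume_eq_prod]
  have hg2 := hg.comp (shear_mp α).measurable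
  simp only [Function.comp_def] at hg2
  rw [lintegral_prod_symm' _ hg2]
  refine le_of_eq (lintegral_congr fun l => ?_)
  rw [ENNReal.mul_rpow_of_nonneg _ _ (by positivity)]
  unfold Fn
  rw [← ENNReal.rpow_mul, mul_one_div_cancel hA0.ne', ENNReal.rpow_one, ← lintegral_const_mul _ (by
    have := measurable_sl α u l; fun_prop)]
  refine lintegral_congr fun ξ => ?_
  rw [ENNReal.mul_rpow_of_nonneg _ _ (by positivity)]
  simp [sl]


lemma root_lim {m : ℝ≥0∞} (h0 : m ≠ 0) (ht : m ≠ ⊤) :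
    Filter.Tendsto (fun n : ℕ => m ^ (1 / ((n : ℝ) + 2))) Filter.atTop (nhds 1) := by
  have hx : 0 < m.toReal := ENNReal.toReal_pos h0 ht
  have e : ∀ n : ℕ, m ^ (1 / ((n : ℝ) + 2)) = ENNReal.ofReal (m.toReal ^ (1 / ((n : ℝ) + 2))) := fun n => by
    rw [← ENNReal.ofReal_rpow_of_pos hx, ENNReal.ofReal_toReal ht]
  simp only [e]
  have h1 : Filter.Tendsto (fun n : ℕ => 1 / ((n : ℝ) + 2)) Filter.atTop (nhds 0) := by
    refine tendsto_const_nhds.div_atTop ?_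
    exact Filter.tendsto_atTop_add_const_right _ _ tendsto_natCast_atTop_atTop
  have h2 := ((Real.continuous_const_rpow hx.ne').tendsto 0).comp h1
  have h3 := ENNReal.tendsto_ofReal h2
  simpa using h3

lemma top_lim {X : Type*} [MeasurableSpace X] {μ : Measure X} {g : X → ℝ≥0∞} (hg : Measurable g) :
    essSup g μ ≤ Filter.liminf (fun n : ℕ => (∫⁻ x, g x ^ ((n : ℝ) + 2) ∂μ) ^ (1 / ((n : ℝ) + 2))) Filter.atTop := by
  refine le_of_forall_lt fun a ha => ?_
  obtain ⟨a', ha1, ha2⟩ := exists_between ha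
  refine ha1.trans_le ?_
  have hat : a' ≠ ⊤ := ha2.ne_top
  set E := {x | a' ≤ g x} with hE
  have hE0 : μ E ≠ 0 := by
    intro h
    refine absurd (essSup_le_of_ae_le (μ := μ) (f := g) a' ?_) (not_le.2 ha2)
    rw [Filter.EventuallyLE, ae_iff]
    exact measure_mono_null (fun x hx => by simp only [hE, Set.mem_setOf_eq, not_le] at hx ⊢; exact hx.le) h
  set m := min (μ E) 1 with hm
  have hm0 : m ≠ 0 := by simp [hm, hE0]
  have hmt : m ≠ ⊤ := ne_top_of_le_ne_top one_ne_top (min_le_right _ _)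
  have h1 : Filter.Tendsto (fun n : ℕ => a' * m ^ (1 / ((n : ℝ) + 2))) Filter.atTop (nhds a') := by
    have := ENNReal.Tendsto.const_mul (a := a') (root_lim hm0 hmt) (Or.inr hat)
    simpa using this
  rw [← h1.liminf_eq]
  refine Filter.liminf_le_liminf (Filter.Eventually.of_forall fun n => ?_)
  have hs : (0 : ℝ) < (n : ℝ) + 2 := by positivity
  have h2 : a' ^ ((n : ℝ) + 2) * m ≤ ∫⁻ x, g x ^ ((n : ℝ) + 2) ∂μ := by
    refine le_trans ?_ (mul_meas_ge_le_lintegral (hg.pow_const _) (a' ^ ((n : ℝ) + 2)))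
    gcongr
    refine (min_le_left _ _).trans (measure_mono fun x hx => ?_)
    exact ENNReal.rpow_le_rpow hx hs.le
  calc a' * m ^ (1 / ((n : ℝ) + 2)) = (a' ^ ((n : ℝ) + 2) * m) ^ (1 / ((n : ℝ) + 2)) := by
        rw [ENNReal.mul_rpow_of_nonneg _ _ (by positivity), ← ENNReal.rpow_mul, mul_one_div_cancel hs.ne', ENNReal.rpow_one]
    _ ≤ _ := by gcongr

lemma fatou_pow {X : Type*} [MeasurableSpace X] {μ : Measure X} {x : X → ℝ≥0∞} {y : ℕ → X → ℝ≥0∞} {q : ℝ} (hq : 0 < q)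
    (hy : ∀ n, Measurable (y n)) (hx : ∀ t, x t ≤ Filter.liminf (fun n => y n t) Filter.atTop) {k : ℕ → ℝ≥0∞} {K : ℝ≥0∞}
    (hk : ∀ n, ∫⁻ t, y n t ^ q ∂μ ≤ k n) (hK : Filter.Tendsto k Filter.atTop (nhds K)) : ∫⁻ t, x t ^ q ∂μ ≤ K := by
  have hp : ∀ t, Filter.liminf (fun n => y n t) Filter.atTop ^ q = Filter.liminf (fun n => y n t ^ q) Filter.atTop := by
    intro t
    have h_rpow_mono := ENNReal.strictMono_rpow_of_pos hq
    have h_rpow_surj := (ENNReal.rpow_left_bijective hq.ne.symm).2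
    refine (h_rpow_mono.orderIsoOfSurjective _ h_rpow_surj).liminf_apply ?_ ?_ ?_ ?_
    all_goals isBoundedDefault
  calc ∫⁻ t, x t ^ q ∂μ ≤ ∫⁻ t, Filter.liminf (fun n => y n t ^ q) Filter.atTop ∂μ := by
        refine lintegral_mono fun t => ?_
        rw [← hp]
        exact ENNReal.rpow_le_rpow (hx t) hq.le
    _ ≤ _ := lintegral_liminf_le fun n => (hy n).pow_const _
    _ ≤ Filter.liminf k Filter.atTop := Filter.liminf_le_liminf (Filter.Eventually.of_forall hk)
    _ = K := hK.liminf_eq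

lemma hol_set {N s : ℝ} (hs : 0 < s) (hs1 : s < 1) {h : ℝ → ℝ≥0∞} (hm : Measurable h) (h0 : ∀ t, t ∉ Set.Icc (-N) N → h t = 0) :
    ∫⁻ t, h t ≤ (∫⁻ t, h t ^ (1 / s)) ^ s * ENNReal.ofReal (2 * N) ^ (1 - s) := by
  have hs2 : 0 < 1 - s := by linarith
  have hconj : (1 / s).HolderConjugate (1 / (1 - s)) := by
    rw [Real.holderConjugate_iff]
    refine ⟨by rw [lt_div_iff₀ hs]; linarith, by simp⟩
  have hol := ENNReal.lintegral_mul_le_Lp_mul_Lq (volume.restrict (Set.Icc (-N) N)) hconj (f := h)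
    (g := fun _ => 1) (by fun_prop) (by fun_prop)
  simp only [Pi.mul_apply, mul_one, one_div_one_div, ENNReal.one_rpow, lintegral_const, Measure.restrict_apply_univ, one_mul, Real.volume_Icc] at hol
  rw [setLIntegral_eq_of_zero measurableSet_Icc h0, show N - -N = 2 * N by ring] at hol
  refine hol.trans ?_
  gcongr
  exact Measure.restrict_le_self

lemma Mn_hol_t {N P s : ℝ} {G : ℝ × ℝ → ℂ} (hG : NiceG N G) (hP : 0 < P) (hs : 0 < s) (hs1 : s < 1) :
    Mn P 1 G ≤ ENNReal.ofReal (2 * N) ^ (1 - s) * Mn P s G := by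
  have hGm := hG.meas
  have hnm : Measurable fun t => (∫⁻ x, ‖G (t, x)‖ₑ ^ (1 / P)) :=
    (Measurable.lintegral_prod_right' (f := fun z : ℝ × ℝ => ‖G z‖ₑ ^ (1 / P)) (by fun_prop))
  have := hol_set (N := N) hs hs1 (h := fun t => (∫⁻ x, ‖G (t, x)‖ₑ ^ (1 / P)) ^ P) (by fun_prop) (by
    intro t ht
    have : ∀ x, G (t, x) = 0 := fun x => hG.supp _ fun h => ht h.1
    simp [this, hP])
  unfold Mn
  rw [ENNReal.rpow_one, mul_comm]
  simp only [div_one]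
  refine this.trans (le_of_eq ?_)
  simp only [← ENNReal.rpow_mul, mul_one_div]

lemma Mn_hol_x {N Q s : ℝ} {G : ℝ × ℝ → ℂ} (hG : NiceG N G) (hQ : 0 < Q) (hs : 0 < s) (hs1 : s < 1) :
    Mn 1 Q G ≤ ENNReal.ofReal (2 * N) ^ (1 - s) * Mn s Q G := by
  have hGm := hG.meas
  have hs2 : 0 < 1 - s := by linarith
  have hnm : Measurable fun t => (∫⁻ x, ‖G (t, x)‖ₑ ^ (1 / s)) :=
    (Measurable.lintegral_prod_right' (f := fun z : ℝ × ℝ => ‖G z‖ₑ ^ (1 / s)) (by fun_prop))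
  have hx : ∀ t, ∫⁻ x, ‖G (t, x)‖ₑ ≤ (∫⁻ x, ‖G (t, x)‖ₑ ^ (1 / s)) ^ s * ENNReal.ofReal (2 * N) ^ (1 - s) := fun t =>
    hol_set (N := N) hs hs1 (h := fun x => ‖G (t, x)‖ₑ) (by fun_prop) (by
      intro x ht
      have : G (t, x) = 0 := hG.supp _ fun h => ht h.2
      simp [this])
  unfold Mn
  have h1Q : 0 ≤ 1 / Q := by positivity
  calc _ ≤ (∫⁻ t, ((∫⁻ x, ‖G (t, x)‖ₑ ^ (1 / s)) ^ s * ENNReal.ofReal (2 * N) ^ (1 - s)) ^ (1 / Q)) ^ Q := by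
        refine ENNReal.rpow_le_rpow (lintegral_mono fun t => ENNReal.rpow_le_rpow ?_ h1Q) hQ.le
        simpa using hx t
    _ = _ := by
        simp only [ENNReal.mul_rpow_of_nonneg _ _ h1Q]
        rw [lintegral_mul_const _ (by fun_prop), ENNReal.mul_rpow_of_nonneg _ _ hQ.le, ← ENNReal.rpow_mul _ (1 / Q), one_div_mul_cancel hQ.ne',
          ENNReal.rpow_one, mul_comm]
        simp only [← ENNReal.rpow_mul, mul_one_div]


set_option maxHeartbeats 1000000 in
lemma conv_fin {p q N : ℝ} (hp : 1 < p) (hq : 1 < q) {F : ℝ × ℝ → ℂ} (hF : NiceG N F) {K : ℝ≥0∞}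
    (h : ∀ G, NiceG N G → ‖∫ z, F z * G z‖ₑ ≤ K * Mn (1 - 1 / p) (1 - 1 / q) G) :
    ∫⁻ t, (∫⁻ x, ‖F (t, x)‖ₑ ^ p) ^ (q / p) ≤ K ^ q := by
  have hFm := hF.meas
  have hp0 : 0 < p := by linarith
  have hq0 : 0 < q := by linarith
  have hP : 0 < 1 - 1 / p := by rw [sub_pos, div_lt_one hp0]; exact hp
  have hQ : 0 < 1 - 1 / q := by rw [sub_pos, div_lt_one hq0]; exact hq
  set a : ℝ → ℝ≥0∞ := fun t => ∫⁻ x, ‖F (t, x)‖ₑ ^ p with ha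
  have ham : Measurable a := Measurable.lintegral_prod_right' (f := fun z : ℝ × ℝ => ‖F z‖ₑ ^ p) (by fun_prop)
  have hat : ∀ t, a t ≠ ⊤ := fun t => hF.slice_top hp0 t
  set C : ℕ → ℝ → ℝ≥0∞ := fun n t => min (a t ^ (q / p - 1)) n with hC
  have hCm : ∀ n, Measurable (C n) := fun n => by simp only [hC]; fun_prop
  have hCt : ∀ n t, C n t ≠ ⊤ := fun n t => ne_top_of_le_ne_top (ENNReal.natCast_ne_top n) (min_le_right _ _)
  have key : ∀ n, ∫⁻ t, a t * C n t ≤ K ^ q := by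
    intro n
    set c : ℝ → ℝ := fun t => (C n t).toReal with hc
    have hcm : Measurable c := (hCm n).ennreal_toReal
    have hcC : ∀ t, ENNReal.ofReal (c t) = C n t := fun t => ENNReal.ofReal_toReal (hCt n t)
    have hc0 : ∀ t, 0 ≤ c t := fun t => ENNReal.toReal_nonneg
    have hcn : ∀ t, c t ≤ n := fun t => by
      have := ENNReal.toReal_mono (ENNReal.natCast_ne_top n) (min_le_right (a t ^ (q / p - 1)) (n : ℝ≥0∞))
      simpa using this
    set G : ℝ × ℝ → ℂ := fun z => (starRingEnd ℂ) (F z) * ((‖F z‖ ^ (p - 2) * c z.1 : ℝ) : ℂ) with hG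
    have hGn : ∀ z, ‖G z‖ = ‖F z‖ ^ (p - 1) * c z.1 := by
      intro z
      simp only [hG]
      rw [norm_mul, RCLike.norm_conj, Complex.norm_real, Real.norm_of_nonneg (mul_nonneg (by positivity) (hc0 _)), ← mul_assoc]
      congr 1
      rcases eq_or_lt_of_le (norm_nonneg (F z)) with h0 | h0
      · rw [← h0, zero_mul, Real.zero_rpow (by linarith : 0 < p - 1).ne']
      · nth_rewrite 1 [← Real.rpow_one ‖F z‖]
        rw [← Real.rpow_add h0]; congr 1; ring
    have hFG : ∀ z, F z * G z = ((‖F z * G z‖ : ℝ) : ℂ) := by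
      intro z
      rw [norm_mul, hGn]
      simp only [hG]
      rw [← mul_assoc, Complex.mul_conj, Complex.normSq_eq_norm_sq, ← Complex.ofReal_mul]
      congr 1
      rcases eq_or_lt_of_le (norm_nonneg (F z)) with h0 | h0
      · rw [← h0]; simp
      · rw [← mul_assoc, ← mul_assoc]
        congr 1
        have e1 : ‖F z‖ ^ (p - 1) = ‖F z‖ ^ (p - 2) * ‖F z‖ := by
          nth_rewrite 3 [← Real.rpow_one ‖F z‖]
          rw [← Real.rpow_add h0]; congr 1; ring
        rw [e1]; ring
    have hGm : Measurable G := by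
      simp only [hG]
      exact (Complex.continuous_conj.measurable.comp hFm).mul (by fun_prop)
    have hGN : NiceG N G := by
      obtain ⟨B, hB⟩ := hF.bdd
      refine ⟨hGm, ⟨B ^ (p - 1) * n, fun z => ?_⟩, fun z hz => by simp [hG, hF.supp z hz]⟩
      rw [hGn]
      have hB0 : 0 ≤ B := (norm_nonneg _).trans (hB z)
      refine mul_le_mul (Real.rpow_le_rpow (norm_nonneg _) (hB z) (by linarith)) (hcn _) (hc0 _) (by positivity)
    have hGe : ∀ z, ‖G z‖ₑ = ‖F z‖ₑ ^ (p - 1) * C n z.1 := by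
      intro z
      rw [← ofReal_norm, hGn, ENNReal.ofReal_mul (by positivity), hcC, ← ENNReal.ofReal_rpow_of_nonneg (norm_nonneg _) (by linarith), ofReal_norm]
    have hFGi : Integrable fun z => F z * G z := by
      obtain ⟨B, hB⟩ := hF.bdd
      exact (hGN.mul hFm (B := B) fun z _ => hB z).integrable
    set I := ∫⁻ t, a t * C n t with hI
    have e1 : ‖∫ z, F z * G z‖ₑ = I := by
      have : (∫ z, F z * G z) = ((∫ z, ‖F z * G z‖ : ℝ) : ℂ) := by
        exact (integral_congr_ae (Filter.Eventually.of_forall hFG)).trans integral_complex_ofReal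
      rw [this, ← ofReal_norm, Complex.norm_real, Real.norm_of_nonneg (integral_nonneg fun z => norm_nonneg _),
        ofReal_integral_norm_eq_lintegral_enorm hFGi, Measure.volume_eq_prod, lintegral_prod _ (by fun_prop)]
      refine lintegral_congr fun t => ?_
      simp only [ha]
      rw [← lintegral_mul_const _ (by fun_prop)]
      refine lintegral_congr fun x => ?_
      rw [enorm_mul, hGe, ← mul_assoc]
      congr 1
      nth_rewrite 1 [← ENNReal.rpow_one ‖F (t, x)‖ₑ]
      rw [← ENNReal.rpow_add_of_nonneg _ _ (by norm_num) (by linarith)]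
      congr 1; ring
    have hIt : I ≠ ⊤ := by rw [← e1]; exact enorm_ne_top
    have e2 : Mn (1 - 1 / p) (1 - 1 / q) G ≤ I ^ (1 - 1 / q) := by
      unfold Mn
      refine ENNReal.rpow_le_rpow (lintegral_mono fun t => ?_) hQ.le
      have e3 : ∫⁻ x, ‖G (t, x)‖ₑ ^ (1 / (1 - 1 / p)) = a t * C n t ^ (1 / (1 - 1 / p)) := by
        simp only [ha]
        rw [← lintegral_mul_const _ (by fun_prop)]
        refine lintegral_congr fun x => ?_
        rw [hGe, ENNReal.mul_rpow_of_nonneg _ _ (by positivity), ← ENNReal.rpow_mul]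
        congr 2
        have : p - 1 ≠ 0 := (by linarith : 0 < p - 1).ne'
        field_simp
      simp only
      rw [e3]
      by_cases h0 : a t = 0
      · rw [h0, zero_mul, zero_mul, ENNReal.zero_rpow_of_pos (by positivity)]
      rw [ENNReal.mul_rpow_of_nonneg _ _ (by positivity), ← ENNReal.rpow_mul]
      have hq1 : q - 1 ≠ 0 := (by linarith : 0 < q - 1).ne'
      have hp1 : p - 1 ≠ 0 := (by linarith : 0 < p - 1).ne'
      have hq1' : 0 < q - 1 := by linarith
      have e4 : 1 / (1 - 1 / p) * ((1 - 1 / p) / (1 - 1 / q)) = 1 / (q - 1) + 1 := by field_simp; ring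
      rw [e4, ENNReal.rpow_add_of_nonneg _ _ (by positivity) (by norm_num), ENNReal.rpow_one, ← mul_assoc]
      gcongr
      calc a t ^ ((1 - 1 / p) / (1 - 1 / q)) * C n t ^ (1 / (q - 1)) ≤
          a t ^ ((1 - 1 / p) / (1 - 1 / q)) * (a t ^ (q / p - 1)) ^ (1 / (q - 1)) := by
            gcongr; exact min_le_left _ _
        _ = a t ^ (1:ℝ) := by
            rw [← ENNReal.rpow_mul, ← ENNReal.rpow_add _ _ h0 (hat t)]
            congr 1
            field_simp
            ring
        _ = a t := ENNReal.rpow_one _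
    have e5 : I ≤ K * I ^ (1 - 1 / q) := by
      calc I = _ := e1.symm
        _ ≤ _ := h G hGN
        _ ≤ _ := by gcongr
    by_cases hI0 : I = 0
    · rw [hI0]; exact zero_le
    have e6 : I ^ (1 / q) ≤ K := by
      have e7 : I = I ^ (1 / q) * I ^ (1 - 1 / q) := by
        rw [← ENNReal.rpow_add _ _ hI0 hIt]; simp
      have hr0 : I ^ (1 - 1 / q) ≠ 0 := by simp [hI0, hIt]
      have hrt : I ^ (1 - 1 / q) ≠ ⊤ := ENNReal.rpow_ne_top_of_nonneg hQ.le hIt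
      rw [e7] at e5
      rw [← e7] at e5
      have e8 : I ^ (1 / q) * I ^ (1 - 1 / q) ≤ K * I ^ (1 - 1 / q) := e7 ▸ e5
      exact (ENNReal.mul_le_mul_iff_left hr0 hrt).1 e8
    calc I = (I ^ (1 / q)) ^ q := by rw [← ENNReal.rpow_mul, one_div_mul_cancel hq0.ne', ENNReal.rpow_one]
      _ ≤ _ := ENNReal.rpow_le_rpow e6 hq0.le
  have lim := lintegral_tendsto_of_tendsto_of_monotone (μ := volume) (f := fun n t => a t * C n t) (F := fun t => a t ^ (q / p))
    (fun n => (ham.mul (hCm n)).aemeasurable)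
    (Filter.Eventually.of_forall fun t m n hmn => by
      simp only [hC]
      gcongr)
    (Filter.Eventually.of_forall fun t => by
      have h1 : Filter.Tendsto (fun n => C n t) Filter.atTop (nhds (min (a t ^ (q / p - 1)) ⊤)) :=
        tendsto_const_nhds.min ENNReal.tendsto_nat_nhds_top
      have h2 := ENNReal.Tendsto.const_mul (a := a t) h1 (Or.inr (hat t))
      rw [min_top_right] at h2
      convert h2 using 2
      by_cases h0 : a t = 0
      · rw [h0, zero_mul, ENNReal.zero_rpow_of_pos (by positivity)]
      · nth_rewrite 2 [← ENNReal.rpow_one (a t)]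
        rw [← ENNReal.rpow_add _ _ h0 (hat t)]
        congr 1; ring)
  exact le_of_tendsto' lim key


noncomputable def trunc (F : ℝ × ℝ → ℂ) (n : ℕ) : ℝ × ℝ → ℂ :=
  Set.indicator (Set.Icc (-((n:ℝ) + 1)) ((n:ℝ) + 1) ×ˢ Set.Icc (-((n:ℝ) + 1)) ((n:ℝ) + 1)) F

lemma trunc_nice {F : ℝ × ℝ → ℂ} (hF : Measurable F) {B : ℝ} (hB : ∀ z, ‖F z‖ ≤ B) (n : ℕ) :
    NiceG ((n:ℝ) + 1) (trunc F n) := by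
  refine ⟨hF.indicator (measurableSet_Icc.prod measurableSet_Icc), ⟨B, fun z => ?_⟩, fun z hz => Set.indicator_of_notMem hz _⟩
  exact (norm_indicator_le_norm_self _ _).trans (hB z)

lemma trunc_mul {F G : ℝ × ℝ → ℂ} {n : ℕ} (hG : NiceG ((n:ℝ) + 1) G) (z : ℝ × ℝ) :
    trunc F n z * G z = F z * G z := by
  by_cases hz : z ∈ Set.Icc (-((n:ℝ) + 1)) ((n:ℝ) + 1) ×ˢ Set.Icc (-((n:ℝ) + 1)) ((n:ℝ) + 1)
  · rw [trunc, Set.indicator_of_mem hz]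
  · rw [hG.supp z hz, mul_zero, mul_zero]

lemma trunc_tendsto (F : ℝ × ℝ → ℂ) (z : ℝ × ℝ) :
    Filter.Tendsto (fun n => trunc F n z) Filter.atTop (nhds (F z)) := by
  refine tendsto_const_nhds.congr' ?_
  obtain ⟨n0, h0⟩ := exists_nat_ge (max |z.1| |z.2|)
  filter_upwards [Filter.eventually_ge_atTop n0] with n hn
  have hn' : (n0 : ℝ) ≤ n := by exact_mod_cast hn
  have h1 : |z.1| ≤ (n:ℝ) + 1 := by linarith [le_max_left |z.1| |z.2|]
  have h2 : |z.2| ≤ (n:ℝ) + 1 := by linarith [le_max_right |z.1| |z.2|]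
  rw [trunc, Set.indicator_of_mem]
  exact ⟨abs_le.1 h1, abs_le.1 h2⟩

lemma trunc_liminf {F : ℝ × ℝ → ℂ} (hF : Measurable F) (p : ℝ≥0∞) (t : ℝ) :
    eLpNorm (fun x => F (t, x)) p volume ≤
      Filter.liminf (fun n => eLpNorm (fun x => trunc F n (t, x)) p volume) Filter.atTop := by
  refine Lp.eLpNorm_lim_le_liminf_eLpNorm (fun n => ?_) _ (Filter.Eventually.of_forall fun x => trunc_tendsto F (t, x))
  have : Measurable (trunc F n) := hF.indicator (measurableSet_Icc.prod measurableSet_Icc)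
  exact (this.comp (measurable_prodMk_left (x := t))).aestronglyMeasurable

lemma mixed_fin {q : ℝ≥0∞} (hq0 : q ≠ 0) (hq : q ≠ ⊤) {x : ℝ → ℝ≥0∞} {K : ℝ≥0∞}
    (h : ∫⁻ t, x t ^ q.toReal ≤ K ^ q.toReal) : eLpNorm (fun t => (x t).toReal) q volume ≤ K := by
  have hq' : 0 < q.toReal := ENNReal.toReal_pos hq0 hq
  rw [eLpNorm_eq_lintegral_rpow_enorm_toReal hq0 hq]
  calc _ ≤ (K ^ q.toReal) ^ (1 / q.toReal) := by
        refine ENNReal.rpow_le_rpow ((lintegral_mono fun t => ?_).trans h) (by positivity)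
        refine ENNReal.rpow_le_rpow ?_ hq'.le
        rw [Real.enorm_of_nonneg ENNReal.toReal_nonneg]
        exact ENNReal.ofReal_toReal_le
    _ = K := by rw [← ENNReal.rpow_mul, mul_one_div_cancel hq'.ne', ENNReal.rpow_one]

lemma mixed_top {x : ℝ → ℝ≥0∞} {K : ℝ≥0∞}
    (h : ∀ᵐ t, x t ≤ K) : eLpNorm (fun t => (x t).toReal) ⊤ volume ≤ K := by
  rw [eLpNorm_exponent_top]
  refine essSup_le_of_ae_le K ?_
  filter_upwards [h] with t ht
  rw [Real.enorm_of_nonneg ENNReal.toReal_nonneg]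
  exact ENNReal.ofReal_toReal_le.trans ht

lemma slice_meas {F : ℝ × ℝ → ℂ} (hF : Measurable F) (s : ℝ) :
    Measurable fun t => (∫⁻ x, ‖F (t, x)‖ₑ ^ s) ^ (1 / s) := by
  have : Measurable fun t => ∫⁻ x, ‖F (t, x)‖ₑ ^ s :=
    Measurable.lintegral_prod_right' (f := fun z : ℝ × ℝ => ‖F z‖ₑ ^ s) (by fun_prop)
  fun_prop

lemma root_lim' (N : ℝ) (hN : 0 < N) (K : ℝ≥0∞) :
    Filter.Tendsto (fun n : ℕ => K * ENNReal.ofReal (2 * N) ^ (1 / ((n:ℝ) + 2))) Filter.atTop (nhds K) := by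
  have := ENNReal.Tendsto.const_mul (a := K) (root_lim (m := ENNReal.ofReal (2 * N)) (by simp [hN]) ENNReal.ofReal_ne_top)
    (Or.inl one_ne_zero)
  rwa [mul_one] at this

lemma dual_ff {p q : ℝ≥0∞} (hp : 1 < p) (hpt : p ≠ ⊤) (hq : 1 < q) (hqt : q ≠ ⊤) {F : ℝ × ℝ → ℂ} (hF : Measurable F)
    {B : ℝ} (hB : ∀ z, ‖F z‖ ≤ B) {K : ℝ≥0∞}
    (h : ∀ N G, NiceG N G → ‖∫ z, F z * G z‖ₑ ≤ K * Mn (1 - 1 / p.toReal) (1 - 1 / q.toReal) G) :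
    eLpNorm (fun t => (eLpNorm (fun x => F (t, x)) p volume).toReal) q volume ≤ K := by
  have hp' : 1 < p.toReal := by simpa using (ENNReal.toReal_lt_toReal one_ne_top hpt).2 hp
  have hq' : 1 < q.toReal := by simpa using (ENNReal.toReal_lt_toReal one_ne_top hqt).2 hq
  have hp0 : p ≠ 0 := (zero_lt_one.trans hp).ne'
  have hq0 : q ≠ 0 := (zero_lt_one.trans hq).ne'
  refine mixed_fin hq0 hqt ?_
  refine fatou_pow (by linarith) (fun n => ?_) (trunc_liminf hF p) (fun n => ?_) tendsto_const_nhds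
  · simp only [eLpNorm_eq_lintegral_rpow_enorm_toReal hp0 hpt]
    exact slice_meas (trunc_nice hF hB n).meas _
  · refine le_trans (le_of_eq ?_) (conv_fin hp' hq' (trunc_nice hF hB n) (K := K) fun G hG => ?_)
    · refine lintegral_congr fun t => ?_
      rw [eLpNorm_eq_lintegral_rpow_enorm_toReal hp0 hpt, ← ENNReal.rpow_mul]
      congr 1; ring
    · rw [integral_congr_ae (Filter.Eventually.of_forall (trunc_mul hG))]
      exact h _ G hG

lemma dual_ft {p : ℝ≥0∞} (hp : 1 < p) (hpt : p ≠ ⊤) {F : ℝ × ℝ → ℂ} (hF : Measurable F)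
    {B : ℝ} (hB : ∀ z, ‖F z‖ ≤ B) {K : ℝ≥0∞}
    (h : ∀ N G, NiceG N G → ‖∫ z, F z * G z‖ₑ ≤ K * Mn (1 - 1 / p.toReal) 1 G) :
    eLpNorm (fun t => (eLpNorm (fun x => F (t, x)) p volume).toReal) ⊤ volume ≤ K := by
  have hp' : 1 < p.toReal := by simpa using (ENNReal.toReal_lt_toReal one_ne_top hpt).2 hp
  have hp0 : p ≠ 0 := (zero_lt_one.trans hp).ne'
  have hP : 0 < 1 - 1 / p.toReal := by rw [sub_pos, div_lt_one (by linarith)]; exact hp'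
  refine mixed_top ?_
  have hm : ∀ n, Measurable fun t => eLpNorm (fun x => trunc F n (t, x)) p volume := fun n => by
    simp only [eLpNorm_eq_lintegral_rpow_enorm_toReal hp0 hpt]
    exact slice_meas (trunc_nice hF hB n).meas _
  have hk : ∀ n, ∀ᵐ t, eLpNorm (fun x => trunc F n (t, x)) p volume ≤ K := by
    intro n
    have hN : (0:ℝ) < (n:ℝ) + 1 := by positivity
    have h1 : essSup (fun t => eLpNorm (fun x => trunc F n (t, x)) p volume) volume ≤ K := by
      refine (top_lim (hm n)).trans ?_
      rw [← (root_lim' ((n:ℝ) + 1) hN K).liminf_eq]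
      refine Filter.liminf_le_liminf (Filter.Eventually.of_forall fun k => ?_)
      have hs : (1:ℝ) < (k:ℝ) + 2 := by have : (0:ℝ) ≤ k := Nat.cast_nonneg k; linarith
      have hs0 : (0:ℝ) < (k:ℝ) + 2 := by linarith
      have h2 := conv_fin hp' hs (trunc_nice hF hB n)
        (K := K * ENNReal.ofReal (2 * ((n:ℝ) + 1)) ^ (1 / ((k:ℝ) + 2))) fun G hG => by
          rw [integral_congr_ae (Filter.Eventually.of_forall (trunc_mul hG))]
          refine (h _ G hG).trans ?_
          rw [mul_assoc]
          gcongr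
          have := Mn_hol_t hG hP (s := 1 - 1 / ((k:ℝ) + 2)) (by rw [sub_pos, div_lt_one hs0]; exact hs)
            (by rw [sub_lt_self_iff]; positivity)
          rwa [_root_.sub_sub_cancel] at this
      have h3 := ENNReal.rpow_le_rpow h2 (by positivity : 0 ≤ 1 / ((k:ℝ) + 2))
      rw [← ENNReal.rpow_mul (K * _), mul_one_div_cancel hs0.ne', ENNReal.rpow_one] at h3
      refine le_trans (le_of_eq ?_) h3
      congr 1
      refine lintegral_congr fun t => ?_
      rw [eLpNorm_eq_lintegral_rpow_enorm_toReal hp0 hpt, ← ENNReal.rpow_mul]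
      congr 1; ring
    filter_upwards [ENNReal.ae_le_essSup (μ := volume) (fun t => eLpNorm (fun x => trunc F n (t, x)) p volume)] with t ht
    exact ht.trans h1
  filter_upwards [ae_all_iff.2 hk] with t ht
  refine (trunc_liminf hF p t).trans ?_
  exact (Filter.liminf_le_liminf (Filter.Eventually.of_forall ht)).trans (by simp)

lemma dual_tf {q : ℝ≥0∞} (hq : 1 < q) (hqt : q ≠ ⊤) {F : ℝ × ℝ → ℂ} (hF : Measurable F)
    {B : ℝ} (hB : ∀ z, ‖F z‖ ≤ B) {K : ℝ≥0∞}
    (h : ∀ N G, NiceG N G → ‖∫ z, F z * G z‖ₑ ≤ K * Mn 1 (1 - 1 / q.toReal) G) :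
    eLpNorm (fun t => (eLpNorm (fun x => F (t, x)) ⊤ volume).toReal) q volume ≤ K := by
  have hq' : 1 < q.toReal := by simpa using (ENNReal.toReal_lt_toReal one_ne_top hqt).2 hq
  have hq0 : q ≠ 0 := (zero_lt_one.trans hq).ne'
  have hq0' : 0 < q.toReal := by linarith
  have hQ : 0 < 1 - 1 / q.toReal := by rw [sub_pos, div_lt_one (by linarith)]; exact hq'
  refine mixed_fin hq0 hqt ?_
  have hm : ∀ n (k : ℕ), Measurable fun t => (∫⁻ x, ‖trunc F n (t, x)‖ₑ ^ ((k:ℝ) + 2)) ^ (1 / ((k:ℝ) + 2)) := 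
    fun n k => slice_meas (trunc_nice hF hB n).meas _
  have hm2 : ∀ n, Measurable fun t => Filter.liminf (fun k : ℕ => (∫⁻ x, ‖trunc F n (t, x)‖ₑ ^ ((k:ℝ) + 2)) ^ (1 / ((k:ℝ) + 2))) Filter.atTop :=
    fun n => Measurable.liminf (hm n)
  have hle : ∀ n t, eLpNorm (fun x => trunc F n (t, x)) ⊤ volume ≤ 
      Filter.liminf (fun k : ℕ => (∫⁻ x, ‖trunc F n (t, x)‖ₑ ^ ((k:ℝ) + 2)) ^ (1 / ((k:ℝ) + 2))) Filter.atTop := by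
    intro n t
    rw [eLpNorm_exponent_top]
    have := ((trunc_nice hF hB n).meas.comp (measurable_prodMk_left (x := t)))
    exact top_lim (g := fun x => ‖trunc F n (t, x)‖ₑ) this.enorm
  refine fatou_pow hq0' hm2 
    (fun t => (trunc_liminf hF ⊤ t).trans (Filter.liminf_le_liminf (Filter.Eventually.of_forall fun n => hle n t))) 
    (fun n => ?_) tendsto_const_nhds
  have hN : (0:ℝ) < (n:ℝ) + 1 := by positivity
  refine fatou_pow hq0' (hm n) (fun t => le_rfl) (fun k => ?_) 
    ((ENNReal.continuous_rpow_const.tendsto K).comp (root_lim' ((n:ℝ) + 1) hN K))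
  have hs : (1:ℝ) < (k:ℝ) + 2 := by have : (0:ℝ) ≤ k := Nat.cast_nonneg k; linarith
  have hs0 : (0:ℝ) < (k:ℝ) + 2 := by linarith
  refine le_trans (le_of_eq ?_) (conv_fin hs hq' (trunc_nice hF hB n)
    (K := K * ENNReal.ofReal (2 * ((n:ℝ) + 1)) ^ (1 / ((k:ℝ) + 2))) fun G hG => ?_)
  · refine lintegral_congr fun t => ?_
    rw [← ENNReal.rpow_mul]
    congr 1; ring
  · rw [integral_congr_ae (Filter.Eventually.of_forall (trunc_mul hG))]
    refine (h _ G hG).trans ?_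
    rw [mul_assoc]
    gcongr
    have := Mn_hol_x hG hQ (s := 1 - 1 / ((k:ℝ) + 2)) (by rw [sub_pos, div_lt_one hs0]; exact hs)
      (by rw [sub_lt_self_iff]; positivity)
    rwa [_root_.sub_sub_cancel] at this


lemma Xnorm_eq {α b A : ℝ} (hA : 0 < A) {r' : ℝ≥0∞} (h0 : r' ≠ 0) (ht : r' ≠ ⊤) (hr : r'.toReal = 1 / A) (u : ℝ × ℝ → ℂ) :
    (∫⁻ q : ℝ × ℝ, (ENNReal.ofReal (jap (q.2 - omegaBO α q.1) ^ b) * ‖ft2 u q.1 q.2‖ₑ) ^ (1 / A)) ^ A = Xnorm α 0 b r' u := by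
  unfold Xnorm
  rw [eLpNorm_eq_lintegral_rpow_enorm_toReal h0 ht, hr, one_div_one_div]
  congr 1
  refine lintegral_congr fun q => ?_
  congr 1
  rw [Real.rpow_zero, one_mul, enorm_mul, Real.enorm_of_nonneg (Real.rpow_nonneg (jap_pos _).le _), enorm_norm]

/-- Strichartz estimates transferred to X̂^{0,b}_r (Lemma 2.2, second part). -/
theorem stmt1 (α : ℝ) (hα0 : 0 < α) (hα1 : α ≤ 1)
    (r r' : ℝ≥0∞) (hr : 1 ≤ r) (hrfin : r ≠ ⊤) (hconj : 1 / r + 1 / r' = 1)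
    (b : ℝ) (hb : 1 / r.toReal < b)
    (q p : ℝ≥0∞) (hscal : 2 / q + 1 / p = 1 / r)
    (hcase : (4 ≤ q ∧ 4 < p) ∨ (1 / 4 ≤ 1 / p ∧ 1 / p + 1 / q < 1 / 2) ∨
      (q = ⊤ ∧ p = 2)) :
    ∃ C > (0 : ℝ), ∀ u : SchwartzMap (ℝ × ℝ) ℂ,
      mixedNorm q p (DxProp (α / q.toReal) (⇑u)) ≤
        ENNReal.ofReal C * Xnorm α 0 b r' (⇑u) := by
  have hr0 : r ≠ 0 := (zero_lt_one.trans_le hr).ne'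
  have hrinv : r⁻¹ ≠ ⊤ := ENNReal.inv_ne_top.2 hr0
  simp only [div_eq_mul_inv, one_mul] at hscal hconj hcase hb
  have hpt : p⁻¹ ≠ ⊤ := fun h => hrinv (by rw [← hscal, h, add_top])
  have hqt : q⁻¹ ≠ ⊤ := fun h => hrinv (by rw [← hscal, h, ENNReal.mul_top two_ne_zero, top_add])
  have hr't : r'⁻¹ ≠ ⊤ := fun h => by rw [h, add_top] at hconj; exact top_ne_one hconj
  obtain ⟨x, hx⟩ : ∃ x, x = (p⁻¹).toReal := ⟨_, rfl⟩
  obtain ⟨y, hy⟩ : ∃ y, y = (q⁻¹).toReal := ⟨_, rfl⟩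
  have hx0 : 0 ≤ x := hx ▸ ENNReal.toReal_nonneg
  have hy0 : 0 ≤ y := hy ▸ ENNReal.toReal_nonneg
  have hxp : x = 1 / p.toReal := by rw [hx, ENNReal.toReal_inv, one_div]
  have hyq : y = 1 / q.toReal := by rw [hy, ENNReal.toReal_inv, one_div]
  have hz0 : 0 < (r.toReal)⁻¹ := inv_pos.2 (ENNReal.toReal_pos hr0 hrfin)
  have hs : 2 * y + x = (r.toReal)⁻¹ := by
    have := congrArg ENNReal.toReal hscal
    rw [ENNReal.toReal_add (ENNReal.mul_ne_top ofNat_ne_top hqt) hpt, ENNReal.toReal_mul, ENNReal.toReal_inv r, ← hx, ← hy] at this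
    simpa using this
  have hr' : (r.toReal)⁻¹ + (r'.toReal)⁻¹ = 1 := by
    have := congrArg ENNReal.toReal hconj
    rw [ENNReal.toReal_add hrinv hr't, ENNReal.toReal_inv r, ENNReal.toReal_inv r'] at this
    simpa using this
  have hc : (y ≤ 1 / 4 ∧ x < 1 / 4) ∨ (1 / 4 ≤ x ∧ x + y < 1 / 2) ∨ (y = 0 ∧ x = 1 / 2) := by
    rcases hcase with ⟨h1, h2⟩ | ⟨h1, h2⟩ | ⟨h1, h2⟩
    · left
      have h1' := ENNReal.toReal_mono (by simp) (ENNReal.inv_le_inv.2 h1)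
      have h2' := (ENNReal.toReal_lt_toReal hpt (by simp)).2 (ENNReal.inv_lt_inv.2 h2)
      rw [← hy] at h1'; rw [← hx] at h2'
      simp at h1' h2'
      constructor <;> linarith
    · right; left
      have h1' := ENNReal.toReal_mono hpt h1
      have h2' := (ENNReal.toReal_lt_toReal (ENNReal.add_ne_top.2 ⟨hpt, hqt⟩) (by simp)).2 h2
      rw [ENNReal.toReal_add hpt hqt, ← hx, ← hy] at h2'; rw [← hx] at h1'
      simp at h1' h2'
      constructor <;> linarith
    · right; right
      subst h1; subst h2
      simp at hx hy
      exact ⟨hy, by rw [hx]; norm_num⟩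
  have hx1 : x < 1 := by rcases hc with h | h | h <;> linarith [h.1, h.2]
  have hy1 : y ≤ 1 / 4 := by rcases hc with h | h | h <;> linarith [h.1, h.2]
  have hp1 : 1 < p := by
    rw [← ENNReal.inv_lt_one, ← ENNReal.toReal_lt_toReal hpt one_ne_top, ← hx]; simpa using hx1
  have hq1 : 1 < q := by
    rw [← ENNReal.inv_lt_one, ← ENNReal.toReal_lt_toReal hqt one_ne_top, ← hy]; simp; linarith
  obtain ⟨P, hP⟩ : ∃ P, P = 1 - x := ⟨_, rfl⟩
  obtain ⟨Q, hQ⟩ : ∃ Q, Q = 1 - y := ⟨_, rfl⟩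
  obtain ⟨M, hM⟩ := est_region (α := α) (P := P) (Q := Q) hα0 (by linarith) (by linarith) (by linarith) (by
    rcases hc with h | h | h
    · left; linarith [h.1, h.2]
    · right; left; constructor <;> linarith [h.1, h.2]
    · right; right; constructor <;> linarith [h.1, h.2])
  have hA0 : 0 < 2 * Q + P - 2 := by rcases hc with h | h | h <;> linarith [h.1, h.2]
  have hA1 : 2 * Q + P - 2 < 1 := by linarith
  have hAr : (r'.toReal)⁻¹ = 2 * Q + P - 2 := by linarith
  have hr0' : r' ≠ 0 := fun h => hr't (by rw [h, ENNReal.inv_zero])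
  have hrt' : r' ≠ ⊤ := fun h => by
    rw [h] at hAr; simp at hAr; linarith
  have hrA : r'.toReal = 1 / (2 * Q + P - 2) := by rw [← hAr, one_div, inv_inv]
  obtain ⟨C, hC⟩ := slices_le (α := α) hA0 hA1 (b := b) (by linarith)
  refine ⟨2 * M * C + 1, by positivity, fun u => ?_⟩
  have hth : α / q.toReal = α * (1 - Q) := by rw [hQ, hyq]; ring
  have h0 : 0 ≤ α * (1 - Q) := mul_nonneg hα0.le (by linarith)
  have h1 : α * (1 - Q) ≤ 1 := by nlinarith
  obtain ⟨B, hB⟩ := DxProp_bdd h0 h1 u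
  have hmeas := DxProp_meas α (1 - Q) u
  rw [hth]
  set K : ℝ≥0∞ := 2 * M * C * Xnorm α 0 b r' (⇑u) with hK
  have hmain : ∀ N G, NiceG N G → ‖∫ z : ℝ × ℝ, DxProp (α * (1 - Q)) u z.1 z.2 * G z‖ₑ ≤ K * Mn P Q G := by
    intro N G hG
    refine (pairing_le hM hA0 h0 h1 u hG).trans ?_
    rw [hK, mul_assoc (2 * (M : ℝ≥0∞)) (C : ℝ≥0∞)]
    gcongr
    rw [← Xnorm_eq hA0 hr0' hrt' hrA]
    exact hC u
  have hfin : mixedNorm q p (DxProp (α * (1 - Q)) (⇑u)) ≤ K := by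
    unfold mixedNorm
    by_cases hpT : p = ⊤
    · have hqT : q ≠ ⊤ := fun h => by
        rw [h] at hyq; rw [hpT] at hxp; simp at hxp hyq; linarith
      have hP1 : P = 1 := by rw [hpT] at hxp; simp at hxp; linarith
      subst hpT
      refine dual_tf (F := fun z : ℝ × ℝ => DxProp (α * (1 - Q)) u z.1 z.2) hq1 hqT hmeas (fun z => hB z.1 z.2) ?_
      intro N G hG
      have h3 := hmain N G hG
      rw [← hyq, ← hQ]
      rwa [hP1] at h3
    · by_cases hqT : q = ⊤
      · have hQ1 : Q = 1 := by rw [hqT] at hyq; simp at hyq; linarith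
        subst hqT
        have := dual_ft (K := K) (F := fun z : ℝ × ℝ => DxProp (α * (1 - Q)) u z.1 z.2) hp1 hpT hmeas (fun z => hB z.1 z.2) (by
          intro N G hG
          have := hmain N G hG
          rw [← hxp, ← hP]
          rwa [hQ1] at this ⊢)
        exact this
      · refine dual_ff (F := fun z : ℝ × ℝ => DxProp (α * (1 - Q)) u z.1 z.2) hp1 hpT hq1 hqT hmeas (fun z => hB z.1 z.2) ?_
        rw [← hyq, ← hQ, ← hxp, ← hP]
        exact hmain
  refine hfin.trans ?_
  rw [hK]
  gcongr
  rw [ENNReal.ofReal_add (by positivity) (by norm_num), ENNReal.ofReal_mul (by positivity), ENNReal.ofReal_mul (by norm_num)]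
  simp
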